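/- Let a,m,b>0 satisfy max{9b/2, 4b+1/b} < a/m < 9b/2 + 2/b, and suppose ∫_{U₂}^{9bm/2} (u − 2mb + √(u² − 4umb))/(2b²) du > (1/2)(a − U₂)². Then there exist constants V_c > 0, r_I > 0, δ₀ > 0 and C > 0 (depending only on a,b,m) such that for every δ ∈ (0,δ₀) there exist bounded, twice continuously differentiable functions u,v : (0,∞) → ℝ solving u'' + u'/r + a − u − u v² = 0 and δ²(v'' + v'/r) − m v + u v²(1 − b v) = 0 on (0,∞), with (u(r),v(r)) → (a,0) as r → ∞, such that the limit v(0⁺) := lim_{r→0⁺} v(r) exists and satisfies |v(0⁺) − V_c| ≤ C δ, and there is a radius r_δ with |r_δ − r_I| ≤ C δ at which v(r_δ) = 1/(3b). (Existence of radially symmetric vegetation spot solutions with a single interface at radius r_I + O(δ).) -/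

import Mathlib

open Real MeasureTheory Set Filter
set_option linter.all false


lemma angle_step (t : ℝ → ℝ) (ht : Continuous t) (φ : ℝ) (hφ : ∀ s ∈ Icc (0:ℝ) 1, sin (t s + φ) ≠ 0)
    (h : 0 < sin (t 1 - t 0)) : t 0 < t 1 := by
  by_contra hle
  push Not at hle
  have h1 : t 1 - t 0 ≤ -π := by
    by_contra h2
    push Not at h2
    have := sin_nonpos_of_nonpos_of_neg_pi_le (x := t 1 - t 0) (by linarith) h2.le
    linarith
  -- a multiple of π lies between
  obtain ⟨k, hk1, hk2⟩ : ∃ k : ℤ, t 1 + φ ≤ k * π ∧ k * π ≤ t 0 + φ := by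
    refine ⟨⌊(t 0 + φ) / π⌋, ?_, ?_⟩
    · have := Int.lt_floor_add_one ((t 0 + φ) / π)
      rw [div_lt_iff₀ pi_pos] at this
      nlinarith [pi_pos]
    · have := Int.floor_le ((t 0 + φ) / π)
      rwa [le_div_iff₀ pi_pos] at this
  obtain ⟨s, hs, hst⟩ : ∃ s ∈ Icc (0:ℝ) 1, t s + φ = k * π := by
    have := intermediate_value_Icc' (zero_le_one' ℝ) (f := fun s => t s + φ) (by fun_prop)
    exact this ⟨hk1, hk2⟩
  exact hφ s hs (by rw [hst]; exact sin_int_mul_pi k)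

lemma poincare_miranda {x0 x1 y0 y1 : ℝ} (hx : x0 < x1) (hy : y0 < y1) (f g : ℝ × ℝ → ℝ)
    (hf : Continuous f) (hg : Continuous g)
    (hl : ∀ y ∈ Icc y0 y1, f (x0, y) < 0) (hr : ∀ y ∈ Icc y0 y1, 0 < f (x1, y))
    (hb : ∀ x ∈ Icc x0 x1, g (x, y0) < 0) (ht : ∀ x ∈ Icc x0 x1, 0 < g (x, y1)) :
    ∃ p : ℝ × ℝ, p.1 ∈ Icc x0 x1 ∧ p.2 ∈ Icc y0 y1 ∧ f p = 0 ∧ g p = 0 := by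
  by_contra hno
  push Not at hno
  let c : ℝ × ℝ → ℝ × ℝ := fun p => (projIcc x0 x1 hx.le p.1, projIcc y0 y1 hy.le p.2)
  have hc : Continuous c := by fun_prop
  let F : ℝ × ℝ → ℂ := fun p => (f (c p) : ℂ) + (g (c p) : ℂ) * Complex.I
  have hF : Continuous F := by fun_prop
  have hF0 : ∀ p, F p ≠ 0 := by
    intro p h0
    have hre : f (c p) = 0 := by simpa [F] using congrArg Complex.re h0
    have him : g (c p) = 0 := by simpa [F] using congrArg Complex.im h0
    exact hno (c p) (projIcc x0 x1 hx.le p.1).2 (projIcc y0 y1 hy.le p.2).2 hre him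
  obtain ⟨l, hl1, hl2⟩ := Complex.exists_continuousOn_eqOn_exp_comp (U := (univ : Set (ℝ × ℝ)))
    (by
      have := (convex_univ (𝕜 := ℝ) (E := ℝ × ℝ)).contractibleSpace univ_nonempty
      exact (inferInstance : SimplyConnectedSpace (univ : Set (ℝ × ℝ)))) isOpen_univ (g := F) hF.continuousOn
    (by rintro ⟨p, -, hp⟩; exact hF0 p hp)
  have hlc : Continuous l := continuousOn_univ.1 hl1
  have hcos : ∀ p, f (c p) = exp (l p).re * cos (l p).im := by
    intro p
    have := congrArg Complex.re (hl2 (mem_univ p))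
    simp only [Function.comp, Complex.exp_re] at this
    rw [this]; simp [F]
  have hsin : ∀ p, g (c p) = exp (l p).re * sin (l p).im := by
    intro p
    have := congrArg Complex.im (hl2 (mem_univ p))
    simp only [Function.comp, Complex.exp_im] at this
    rw [this]; simp [F]
  have cpos : ∀ p, 0 < f (c p) → 0 < cos (l p).im := fun p h => by
    rw [hcos] at h; exact (pos_iff_pos_of_mul_pos h).1 (exp_pos _)
  have cneg : ∀ p, f (c p) < 0 → cos (l p).im < 0 := fun p h => by
    rw [hcos] at h; exact (pos_iff_neg_of_mul_neg h).1 (exp_pos _)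
  have spos : ∀ p, 0 < g (c p) → 0 < sin (l p).im := fun p h => by
    rw [hsin] at h; exact (pos_iff_pos_of_mul_pos h).1 (exp_pos _)
  have sneg : ∀ p, g (c p) < 0 → sin (l p).im < 0 := fun p h => by
    rw [hsin] at h; exact (pos_iff_neg_of_mul_neg h).1 (exp_pos _)
  have hcc : ∀ x ∈ Icc x0 x1, ∀ y ∈ Icc y0 y1, c (x, y) = (x, y) := by
    intro x hx' y hy'; simp [c, projIcc_of_mem hx.le hx', projIcc_of_mem hy.le hy']
  have mx0 : x0 ∈ Icc x0 x1 := ⟨le_rfl, hx.le⟩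
  have mx1 : x1 ∈ Icc x0 x1 := ⟨hx.le, le_rfl⟩
  have my0 : y0 ∈ Icc y0 y1 := ⟨le_rfl, hy.le⟩
  have my1 : y1 ∈ Icc y0 y1 := ⟨hy.le, le_rfl⟩
  have L : ∀ y ∈ Icc y0 y1, cos (l (x0, y)).im < 0 := fun y h => cneg _ (by
    rw [hcc _ mx0 _ h]; exact hl y h)
  have R : ∀ y ∈ Icc y0 y1, 0 < cos (l (x1, y)).im := fun y h => cpos _ (by
    rw [hcc _ mx1 _ h]; exact hr y h)
  have B : ∀ x ∈ Icc x0 x1, sin (l (x, y0)).im < 0 := fun y h => sneg _ (by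
    rw [hcc _ h _ my0]; exact hb y h)
  have T : ∀ x ∈ Icc x0 x1, 0 < sin (l (x, y1)).im := fun y h => spos _ (by
    rw [hcc _ h _ my1]; exact ht y h)
  have hmx : ∀ s ∈ Icc (0:ℝ) 1, x0 + s * (x1 - x0) ∈ Icc x0 x1 := by
    rintro s ⟨h0, h1⟩; constructor <;> nlinarith
  have hmy : ∀ s ∈ Icc (0:ℝ) 1, y0 + s * (y1 - y0) ∈ Icc y0 y1 := by
    rintro s ⟨h0, h1⟩; constructor <;> nlinarith
  have hmx' : ∀ s ∈ Icc (0:ℝ) 1, x1 - s * (x1 - x0) ∈ Icc x0 x1 := by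
    rintro s ⟨h0, h1⟩; constructor <;> nlinarith
  have hmy' : ∀ s ∈ Icc (0:ℝ) 1, y1 - s * (y1 - y0) ∈ Icc y0 y1 := by
    rintro s ⟨h0, h1⟩; constructor <;> nlinarith
  have s1 := angle_step (fun s => (l (x0 + s * (x1 - x0), y0)).im) (by fun_prop) 0
    (fun s hs => by simpa using (B _ (hmx s hs)).ne) (by
      simp only [zero_mul, add_zero, one_mul, add_sub_cancel, sin_sub]
      have := L _ my0; have := R _ my0; have := B _ mx0; have := B _ mx1
      nlinarith)
  have s2 := angle_step (fun s => (l (x1, y0 + s * (y1 - y0))).im) (by fun_prop) (π/2)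
    (fun s hs => by simpa [sin_add_pi_div_two] using (R _ (hmy s hs)).ne') (by
      simp only [zero_mul, add_zero, one_mul, add_sub_cancel, sin_sub]
      have := R _ my0; have := R _ my1; have := B _ mx1; have := T _ mx1
      nlinarith)
  have s3 := angle_step (fun s => (l (x1 - s * (x1 - x0), y1)).im) (by fun_prop) 0
    (fun s hs => by simpa using (T _ (hmx' s hs)).ne') (by
      simp only [zero_mul, sub_zero, one_mul, sub_sub_cancel, sin_sub]
      have := L _ my1; have := R _ my1; have := T _ mx0; have := T _ mx1
      nlinarith)
  have s4 := angle_step (fun s => (l (x0, y1 - s * (y1 - y0))).im) (by fun_prop) (π/2)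
    (fun s hs => by simpa [sin_add_pi_div_two] using (L _ (hmy' s hs)).ne) (by
      simp only [zero_mul, sub_zero, one_mul, sub_sub_cancel, sin_sub]
      have := L _ my0; have := L _ my1; have := B _ mx0; have := T _ mx0
      nlinarith)
  simp only [zero_mul, sub_zero, add_zero, one_mul, sub_sub_cancel, add_sub_cancel] at s1 s2 s3 s4
  linarith

lemma topo_lemma {x0 x1 y0 y1 : ℝ} (hx : x0 < x1) (hy : y0 < y1) (A B : Set (ℝ × ℝ))
    (hA : IsOpen A) (hB : IsOpen B) (hAB : Disjoint A B) (f : ℝ × ℝ → ℝ) (hf : Continuous f)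
    (hb : ∀ x ∈ Icc x0 x1, (x, y0) ∈ A) (ht : ∀ x ∈ Icc x0 x1, (x, y1) ∈ B)
    (hl : ∀ y ∈ Icc y0 y1, (x0, y) ∉ A → (x0, y) ∉ B → f (x0, y) < 0)
    (hr : ∀ y ∈ Icc y0 y1, (x1, y) ∉ A → (x1, y) ∉ B → 0 < f (x1, y)) :
    ∃ p : ℝ × ℝ, p.1 ∈ Icc x0 x1 ∧ p.2 ∈ Icc y0 y1 ∧ p ∉ A ∧ p ∉ B ∧ f p = 0 := by
  by_contra hno
  push Not at hno
  have mx0 : x0 ∈ Icc x0 x1 := ⟨le_rfl, hx.le⟩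
  have my0 : y0 ∈ Icc y0 y1 := ⟨le_rfl, hy.le⟩
  have hAne : (Aᶜ).Nonempty := ⟨_, disjoint_right.1 hAB (ht x0 mx0)⟩
  have hBne : (Bᶜ).Nonempty := ⟨_, disjoint_left.1 hAB (hb x0 mx0)⟩
  have pos : ∀ (S : Set (ℝ × ℝ)), IsClosed S → S.Nonempty → ∀ p, p ∉ S →
      0 < Metric.infDist p S := fun S hS hn p hp => (hS.notMem_iff_infDist_pos hn).1 hp
  let g : ℝ × ℝ → ℝ := fun p => Metric.infDist p Bᶜ - Metric.infDist p Aᶜ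
  have gA : ∀ p ∈ A, g p < 0 := fun p hp => by
    have h1 := pos _ hA.isClosed_compl hAne p (by simpa using hp)
    have h2 : Metric.infDist p Bᶜ = 0 := Metric.infDist_zero_of_mem (disjoint_left.1 hAB hp)
    simp only [g]; linarith
  have gB : ∀ p ∈ B, 0 < g p := fun p hp => by
    have h1 := pos _ hB.isClosed_compl hBne p (by simpa using hp)
    have h2 : Metric.infDist p Aᶜ = 0 := Metric.infDist_zero_of_mem (disjoint_right.1 hAB hp)
    simp only [g]; linarith
  let N : Set (ℝ × ℝ) := (Icc x0 x1 ×ˢ Icc y0 y1) ∩ (Aᶜ ∩ Bᶜ)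
  have hN : IsClosed N := (isClosed_Icc.prod isClosed_Icc).inter
    (hA.isClosed_compl.inter hB.isClosed_compl)
  let C1 := (N ∩ {p | f p ≤ 0}) ∪ ({x0} ×ˢ Icc y0 y1)
  let C2 := (N ∩ {p | 0 ≤ f p}) ∪ ({x1} ×ˢ Icc y0 y1)
  have hC1 : IsClosed C1 := (hN.inter (isClosed_le hf continuous_const)).union
    (isClosed_singleton.prod isClosed_Icc)
  have hC2 : IsClosed C2 := (hN.inter (isClosed_le continuous_const hf)).union
    (isClosed_singleton.prod isClosed_Icc)
  have hC1n : C1.Nonempty := ⟨(x0, y0), Or.inr ⟨rfl, my0⟩⟩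
  have hC2n : C2.Nonempty := ⟨(x1, y0), Or.inr ⟨rfl, my0⟩⟩
  have hdis : ∀ p ∈ C1, p ∉ C2 := by
    rintro ⟨x, y⟩ (⟨⟨⟨h1, h2⟩, h3, h4⟩, h5⟩ | ⟨h1, h2⟩) (⟨⟨⟨k1, k2⟩, k3, k4⟩, k5⟩ | ⟨k1, k2⟩)
    · exact hno _ h1 h2 h3 h4 (le_antisymm h5 k5)
    · simp only [mem_singleton_iff] at k1; subst k1
      exact absurd (hr y h2 h3 h4) (not_lt.2 h5)
    · simp only [mem_singleton_iff] at h1; subst h1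
      exact absurd (hl y k2 k3 k4) (not_lt.2 k5)
    · simp only [mem_singleton_iff] at h1 k1; linarith
  let F : ℝ × ℝ → ℝ := fun p => Metric.infDist p C1 - Metric.infDist p C2
  have F1 : ∀ p ∈ C1, F p < 0 := fun p hp => by
    have h1 := pos _ hC2 hC2n p (hdis p hp)
    have h2 : Metric.infDist p C1 = 0 := Metric.infDist_zero_of_mem hp
    simp only [F]; linarith
  have F2 : ∀ p ∈ C2, 0 < F p := fun p hp => by
    have h1 := pos _ hC1 hC1n p (fun h => hdis p h hp)
    have h2 : Metric.infDist p C2 = 0 := Metric.infDist_zero_of_mem hp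
    simp only [F]; linarith
  obtain ⟨p, hp1, hp2, hp3, hp4⟩ := poincare_miranda hx hy F g
    ((Metric.continuous_infDist_pt _).sub (Metric.continuous_infDist_pt _))
    ((Metric.continuous_infDist_pt _).sub (Metric.continuous_infDist_pt _))
    (fun y h => F1 _ (Or.inr ⟨rfl, h⟩)) (fun y h => F2 _ (Or.inr ⟨rfl, h⟩))
    (fun x h => gA _ (hb x h)) (fun x h => gB _ (ht x h))
  have hpN : p ∈ N := ⟨⟨hp1, hp2⟩, fun h => (gA p h).ne hp4, fun h => (gB p h).ne' hp4⟩
  rcases le_total (f p) 0 with h | h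
  · exact (F1 p (Or.inl ⟨hpN, h⟩)).ne hp3
  · exact (F2 p (Or.inl ⟨hpN, h⟩)).ne' hp3


set_option linter.unusedSectionVars false
set_option linter.unusedVariables false
section flow
variable {E : Type*} [NormedAddCommGroup E] [NormedSpace ℝ E] [CompleteSpace E]

/-- radial average -/
noncomputable def radW (G : ℝ → E) (s : ℝ) : E := s • ∫ τ in (0:ℝ)..1, τ • G (s * τ)

lemma radW_cont {X : Type*} [TopologicalSpace X] (G : X → ℝ → E)
    (hG : Continuous (fun p : X × ℝ => G p.1 p.2)) :
    Continuous (fun p : X × ℝ => radW (G p.1) p.2) := by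
  unfold radW
  refine continuous_snd.smul ?_
  apply intervalIntegral.continuous_parametric_intervalIntegral_of_continuous'
    (f := fun (p : X × ℝ) τ => τ • G p.1 (p.2 * τ))
  have : Continuous (fun q : (X × ℝ) × ℝ => G q.1.1 (q.1.2 * q.2)) :=
    hG.comp (f := fun q : (X × ℝ) × ℝ => (q.1.1, q.1.2 * q.2)) (by fun_prop)
  exact continuous_snd.smul this

lemma radW_cont' (G : ℝ → E) (hG : Continuous G) : Continuous (radW G) := by
  have := radW_cont (X := Unit) (fun _ => G) (hG.comp continuous_snd)
  exact this.comp (f := fun s : ℝ => ((), s)) (by fun_prop)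

lemma radW_sub (G H : ℝ → E) (hG : Continuous G) (hH : Continuous H) (s : ℝ) :
    radW G s - radW H s = radW (fun t => G t - H t) s := by
  unfold radW
  rw [← smul_sub, ← intervalIntegral.integral_sub]
  · simp only [smul_sub]
  · exact Continuous.intervalIntegrable (by fun_prop) _ _
  · exact Continuous.intervalIntegrable (by fun_prop) _ _

lemma radW_hasDeriv (G : ℝ → E) (hG : Continuous G) {r : ℝ} (hr : 0 < r) :
    HasDerivAt (radW G) (G r - r⁻¹ • radW G r) r := by
  have key : ∀ s, 0 < s → radW G s = s⁻¹ • ∫ t in (0:ℝ)..s, t • G t := by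
    intro s hs
    have := intervalIntegral.smul_integral_comp_mul_left (a := 0) (b := 1)
      (fun t => t • G t) s
    simp only [mul_zero, mul_one] at this
    rw [← this, smul_smul, inv_mul_cancel₀ hs.ne', one_smul, radW,
      ← intervalIntegral.integral_smul]
    simp only [smul_smul]
  have h1 : HasDerivAt (fun s : ℝ => s⁻¹ • ∫ t in (0:ℝ)..s, t • G t)
      (r⁻¹ • (r • G r) + (-(r ^ 2)⁻¹) • ∫ t in (0:ℝ)..r, t • G t) r := by
    refine (hasDerivAt_inv hr.ne').smul ?_
    exact (Continuous.integral_hasStrictDerivAt (f := fun t => t • G t) (by fun_prop) 0 r).hasDerivAt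
  have h2 := h1.congr_of_eventuallyEq (f₁ := radW G)
    (by filter_upwards [Ioi_mem_nhds hr] with s hs using key s hs)
  convert! h2 using 1
  rw [key r hr, smul_smul, smul_smul, inv_mul_cancel₀ hr.ne', one_smul, neg_smul, sub_eq_add_neg,
    pow_two, mul_inv]

lemma radW_bound (G : ℝ → E) (hG : Continuous G) {c lam : ℝ} (hc : 0 ≤ c) (hl : 0 < lam)
    (h : ∀ t, 0 ≤ t → ‖G t‖ ≤ c * exp (lam * t)) {r : ℝ} (hr : 0 ≤ r) :
    ‖∫ s in (0:ℝ)..r, radW G s‖ ≤ c / lam ^ 2 * exp (lam * r) := by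
  have h1 : ∀ s, 0 ≤ s → ‖radW G s‖ ≤ c / lam * exp (lam * s) := by
    intro s hs
    rw [radW, norm_smul, norm_of_nonneg hs]
    have e1 : ‖∫ τ in (0:ℝ)..1, τ • G (s * τ)‖ ≤ ∫ τ in (0:ℝ)..1, c * exp (lam * (s * τ)) := by
      apply intervalIntegral.norm_integral_le_of_norm_le zero_le_one
      · refine Eventually.of_forall fun τ hτ => ?_
        rw [norm_smul, norm_of_nonneg hτ.1.le]
        calc τ * ‖G (s * τ)‖ ≤ 1 * ‖G (s*τ)‖ := by gcongr; exact hτ.2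
          _ ≤ _ := by rw [one_mul]; exact h _ (mul_nonneg hs hτ.1.le)
      · exact Continuous.intervalIntegrable (by fun_prop) _ _
    have e2 : ∫ τ in (0:ℝ)..1, s * (c * exp (lam * (s * τ))) =
        c / lam * exp (lam * (s * 1)) - c / lam * exp (lam * (s * 0)) := by
      apply intervalIntegral.integral_eq_sub_of_hasDerivAt
        (f := fun τ => c / lam * exp (lam * (s * τ)))
      · intro τ _
        have := ((((hasDerivAt_id τ).const_mul s).const_mul lam).exp).const_mul (c / lam)
        convert! this using 1
        simp only [id]; field_simp
      · exact Continuous.intervalIntegrable (by fun_prop) _ _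
    rw [intervalIntegral.integral_const_mul] at e2
    calc _ ≤ s * ∫ τ in (0:ℝ)..1, c * exp (lam * (s * τ)) := by gcongr
      _ ≤ _ := by rw [e2]; simp; positivity
  have e1 : ‖∫ s in (0:ℝ)..r, radW G s‖ ≤ ∫ s in (0:ℝ)..r, c / lam * exp (lam * s) := by
    apply intervalIntegral.norm_integral_le_of_norm_le hr
    · exact Eventually.of_forall fun s hs => h1 s hs.1.le
    · exact Continuous.intervalIntegrable (by fun_prop) _ _
  have e2 : ∫ s in (0:ℝ)..r, c / lam * exp (lam * s) =
      c / lam ^ 2 * exp (lam * r) - c / lam ^ 2 * exp (lam * 0) := by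
    apply intervalIntegral.integral_eq_sub_of_hasDerivAt (f := fun s => c / lam ^ 2 * exp (lam * s))
    · intro τ _
      have := (((hasDerivAt_id τ).const_mul lam).exp).const_mul (c / lam ^ 2)
      convert! this using 1
      simp only [id]; field_simp
    · exact Continuous.intervalIntegrable (by fun_prop) _ _
  rw [e2] at e1
  refine e1.trans ?_
  have : 0 ≤ c / lam ^ 2 * exp (lam * 0) := by positivity
  linarith

theorem flow_exists (F : E → E) {K : NNReal} (hF : LipschitzWith K F) :
    ∃ X P : E → ℝ → E, (∀ x, X x 0 = x) ∧ (∀ x, P x 0 = 0) ∧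
      Continuous (fun p : E × ℝ => X p.1 p.2) ∧ Continuous (fun p : E × ℝ => P p.1 p.2) ∧
      (∀ x r, 0 < r → HasDerivAt (X x) (P x r) r) ∧
      (∀ x r, 0 < r → HasDerivAt (P x) (F (X x r) - r⁻¹ • P x r) r) := by
  set lam : ℝ := Real.sqrt (2 * K + 1) with hlam
  have hl2 : lam ^ 2 = 2 * K + 1 := Real.sq_sqrt (by positivity)
  have hl : 0 < lam := Real.sqrt_pos.2 (by positivity)
  let G : BoundedContinuousFunction ℝ E → ℝ → E := fun Z t => F (exp (lam * |t|) • Z t)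
  have hFc : Continuous F := hF.continuous
  have hGc : ∀ Z, Continuous (G Z) := fun Z => by
    have := Z.continuous
    fun_prop
  have hGb : ∀ Z t, 0 ≤ t → ‖G Z t‖ ≤ (‖F 0‖ + K * ‖Z‖) * exp (lam * t) := by
    intro Z t ht
    have h1 : ‖G Z t - F 0‖ ≤ K * (exp (lam * t) * ‖Z‖) := by
      have := hF.norm_sub_le (exp (lam * |t|) • Z t) 0
      simp only [G]
      refine this.trans ?_
      rw [sub_zero, norm_smul, norm_of_nonneg (exp_pos _).le, abs_of_nonneg ht]
      gcongr; exact Z.norm_coe_le_norm t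
    have h2 : ‖G Z t‖ ≤ ‖F 0‖ + ‖G Z t - F 0‖ := by
      simpa using norm_add_le (F 0) (G Z t - F 0)
    have h3 : 1 ≤ exp (lam * t) := one_le_exp (by positivity)
    nlinarith [norm_nonneg (F 0)]
  let I : BoundedContinuousFunction ℝ E → ℝ → E := fun Z r => ∫ s in (0:ℝ)..|r|, radW (G Z) s
  have hIc : ∀ Z, Continuous (I Z) := fun Z =>
    (intervalIntegral.continuous_primitive (fun a b =>
      (radW_cont' _ (hGc Z)).intervalIntegrable a b) 0).comp continuous_abs
  let Φ : E → BoundedContinuousFunction ℝ E → BoundedContinuousFunction ℝ E := fun x Z =>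
    BoundedContinuousFunction.ofNormedAddCommGroup (fun r => exp (-(lam * |r|)) • (x + I Z r))
      (by have := hIc Z; fun_prop) (‖x‖ + (‖F 0‖ + K * ‖Z‖) / lam ^ 2) (by
        intro r
        have h1 := radW_bound (G Z) (hGc Z) (by positivity) hl (hGb Z) (abs_nonneg r)
        rw [norm_smul, norm_of_nonneg (exp_pos _).le]
        have h2 : exp (-(lam * |r|)) ≤ 1 := exp_le_one_iff.2 (by
          have := abs_nonneg r; nlinarith)
        have h3 : exp (-(lam * |r|)) * exp (lam * |r|) = 1 := by rw [← exp_add]; simp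
        calc _ ≤ exp (-(lam * |r|)) * (‖x‖ + (‖F 0‖ + K * ‖Z‖) / lam ^ 2 * exp (lam * |r|)) := by
              gcongr; exact (norm_add_le _ _).trans (by gcongr)
          _ = exp (-(lam * |r|)) * ‖x‖ + (‖F 0‖ + K * ‖Z‖) / lam ^ 2 *
              (exp (-(lam * |r|)) * exp (lam * |r|)) := by ring
          _ ≤ _ := by rw [h3]; nlinarith [norm_nonneg x])
  have hΦ : ∀ x Z r, Φ x Z r = exp (-(lam * |r|)) • (x + I Z r) := fun x Z r => rfl
  have hcon : ∀ x, ContractingWith (1/2) (Φ x) := by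
    intro x
    refine ⟨by norm_num, LipschitzWith.of_dist_le_mul fun Z Y => ?_⟩
    rw [BoundedContinuousFunction.dist_le (by positivity)]
    intro r
    have hsub : I Z r - I Y r = ∫ s in (0:ℝ)..|r|, radW (fun t => G Z t - G Y t) s := by
      simp only [I]
      rw [← intervalIntegral.integral_sub ((radW_cont' _ (hGc Z)).intervalIntegrable _ _)
        ((radW_cont' _ (hGc Y)).intervalIntegrable _ _)]
      simp only [radW_sub _ _ (hGc Z) (hGc Y)]
    have hb : ∀ t, 0 ≤ t → ‖G Z t - G Y t‖ ≤ (K * dist Z Y) * exp (lam * t) := by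
      intro t ht
      refine (hF.norm_sub_le _ _).trans ?_
      rw [← smul_sub, norm_smul, norm_of_nonneg (exp_pos _).le, abs_of_nonneg ht, ← dist_eq_norm]
      have := BoundedContinuousFunction.dist_coe_le_dist (f := Z) (g := Y) t
      calc (K:ℝ) * (exp (lam * t) * dist (Z t) (Y t)) ≤ K * (exp (lam * t) * dist Z Y) := by gcongr
        _ = _ := by ring
    have h1 := radW_bound (fun t => G Z t - G Y t) ((hGc Z).sub (hGc Y)) (by positivity) hl hb
      (abs_nonneg r)
    rw [dist_eq_norm, hΦ, hΦ, ← smul_sub, add_sub_add_left_eq_sub, hsub, norm_smul,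
      norm_of_nonneg (exp_pos _).le]
    have h3 : exp (-(lam * |r|)) * exp (lam * |r|) = 1 := by rw [← exp_add]; simp
    calc _ ≤ exp (-(lam * |r|)) * (K * dist Z Y / lam ^ 2 * exp (lam * |r|)) := by gcongr
      _ = K * dist Z Y / lam ^ 2 * (exp (-(lam * |r|)) * exp (lam * |r|)) := by ring
      _ = K * dist Z Y / lam ^ 2 := by rw [h3, mul_one]
      _ ≤ _ := by
        rw [hl2, div_le_iff₀ (by positivity)]
        push_cast
        have : 0 ≤ dist Z Y := dist_nonneg
        nlinarith [K.2]
  let Z : E → BoundedContinuousFunction ℝ E := fun x => (hcon x).fixedPoint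
  have hZ : ∀ x, Φ x (Z x) = Z x := fun x => (hcon x).fixedPoint_isFixedPt
  have hZL : LipschitzWith 2 Z := by
    refine LipschitzWith.of_dist_le_mul fun x y => ?_
    have := (hcon x).fixedPoint_lipschitz_in_map (hcon y) (C := dist x y) (fun z => by
      rw [BoundedContinuousFunction.dist_le dist_nonneg]
      intro r
      rw [dist_eq_norm, hΦ, hΦ, ← smul_sub, add_sub_add_right_eq_sub, norm_smul,
        norm_of_nonneg (exp_pos _).le, dist_eq_norm]
      have h2 : exp (-(lam * |r|)) ≤ 1 := exp_le_one_iff.2 (by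
          have := abs_nonneg r; nlinarith)
      nlinarith [norm_nonneg (x - y)])
    refine this.trans (le_of_eq ?_)
    push_cast; ring
  have hZc : Continuous (fun p : E × ℝ => Z p.1 p.2) := by
    have : Continuous (fun q : (BoundedContinuousFunction ℝ E) × ℝ => q.1 q.2) := continuous_eval
    exact this.comp (f := fun p : E × ℝ => (Z p.1, p.2))
      ((hZL.continuous.comp continuous_fst).prodMk continuous_snd)
  let X : E → ℝ → E := fun x r => exp (lam * |r|) • Z x r
  have hXc : Continuous (fun p : E × ℝ => X p.1 p.2) := by fun_prop
  have hX : ∀ x r, X x r = x + I (Z x) r := by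
    intro x r
    simp only [X]
    conv_lhs => rw [← hZ x]
    rw [hΦ, smul_smul, ← exp_add]; simp
  let P : E → ℝ → E := fun x r => radW (fun t => F (X x t)) r
  have hGX : ∀ x, G (Z x) = fun t => F (X x t) := fun x => rfl
  refine ⟨X, P, ?_, ?_, hXc, ?_, ?_, ?_⟩
  · intro x; rw [hX]; simp [I]
  · intro x; simp [P, radW]
  · exact radW_cont (fun x t => F (X x t)) (hFc.comp hXc)
  · intro x r hr
    have hd : HasDerivAt (fun r => x + ∫ s in (0:ℝ)..r, radW (G (Z x)) s) (P x r) r := by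
      have := ((radW_cont' _ (hGc (Z x))).integral_hasStrictDerivAt 0 r).hasDerivAt
      exact this.const_add x
    refine hd.congr_of_eventuallyEq ?_
    filter_upwards [Ioi_mem_nhds hr] with s hs
    rw [hX]; simp only [I, abs_of_pos (mem_Ioi.1 hs)]
  · intro x r hr
    exact radW_hasDeriv _ (hGX x ▸ hGc (Z x)) hr
end flow


lemma Jint (n : ℕ) {r : ℝ} (hr : 0 < r) :
    IntegrableOn (fun t => cosh t ^ n * exp (-(r * cosh t))) (Ioi 0) := by
  have h1 : IntegrableOn (fun t : ℝ => (n.factorial / (r/2)^n) * exp (-(r/2) * t)) (Ioi 0) :=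
    (exp_neg_integrableOn_Ioi 0 (by positivity)).const_mul _
  refine Integrable.mono' h1 ?_ ?_
  · exact (Continuous.aestronglyMeasurable (by fun_prop))
  · refine (ae_restrict_mem measurableSet_Ioi).mono fun t ht => ?_
    have hc : 0 < cosh t := cosh_pos t
    rw [norm_of_nonneg (by positivity)]
    have h2 := pow_div_factorial_le_exp (r/2 * cosh t) (by positivity) n
    have h3 : t ≤ cosh t := by
      have := self_le_sinh_iff.2 (le_of_lt (mem_Ioi.1 ht))
      exact this.trans (sinh_lt_cosh t).le
    have h4 : exp (-(r * cosh t)) = exp (-(r/2*cosh t)) * exp (-(r/2 * cosh t)) := by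
      rw [← exp_add]; ring_nf
    have h5 : exp (-(r/2 * cosh t)) ≤ exp (-(r/2) * t) := by
      apply exp_le_exp.2; nlinarith
    have h6 : cosh t ^ n * exp (-(r/2 * cosh t)) ≤ n.factorial / (r/2)^n := by
      rw [exp_neg, ← div_eq_mul_inv, div_le_div_iff₀ (exp_pos _) (by positivity)]
      rw [div_le_iff₀ (by positivity), mul_pow] at h2
      linarith
    calc _ = (cosh t ^ n * exp (-(r/2 * cosh t))) * exp (-(r/2 * cosh t)) := by rw [h4]; ring
      _ ≤ _ := by gcongr

noncomputable def JJ (n : ℕ) (r : ℝ) : ℝ := ∫ t in Ioi (0:ℝ), cosh t ^ n * exp (-(r * cosh t))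

lemma JJ_deriv (n : ℕ) {r : ℝ} (hr : 0 < r) : HasDerivAt (JJ n) (-JJ (n+1) r) r := by
  have := (hasDerivAt_integral_of_dominated_loc_of_deriv_le (μ := volume.restrict (Ioi (0:ℝ)))
    (F := fun r t => cosh t ^ n * exp (-(r * cosh t)))
    (F' := fun r t => -(cosh t ^ (n+1) * exp (-(r * cosh t))))
    (bound := fun t => cosh t ^ (n+1) * exp (-(r/2 * cosh t))) (s := Ioi (r/2)) (x₀ := r)
    (Ioi_mem_nhds (by linarith)) ?_ (Jint n hr) ?_ ?_ (Jint (n+1) (by linarith)) ?_).2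
  · convert! this using 1
    rw [integral_neg]; rfl
  · exact Eventually.of_forall fun x => Continuous.aestronglyMeasurable (by fun_prop)
  · exact Continuous.aestronglyMeasurable (by fun_prop)
  · refine Eventually.of_forall fun t x hx => ?_
    have hc : 0 < cosh t := cosh_pos t
    rw [norm_neg, norm_of_nonneg (by positivity)]
    have : r/2 < x := hx
    gcongr
  · refine Eventually.of_forall fun t x hx => ?_
    have := ((((hasDerivAt_id x).mul_const (cosh t)).neg).exp).const_mul (cosh t ^ n)
    convert! this using 1
    simp only [Pi.neg_apply, id]; ring

lemma JJ_pos (n : ℕ) {r : ℝ} (hr : 0 < r) : 0 < JJ n r := by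
  have := (setIntegral_pos_iff_support_of_nonneg_ae (μ := volume) (s := Ioi (0:ℝ))
    (f := fun t => cosh t ^ n * exp (-(r * cosh t)))
    (Eventually.of_forall fun t => by have := cosh_pos t; simp only [Pi.zero_apply]; positivity)
    (Jint n hr)).2
  apply this
  have hs : Function.support (fun t => cosh t ^ n * exp (-(r * cosh t))) = univ := by
    ext t; have := cosh_pos t
    simp only [Function.mem_support, mem_univ, iff_true]; positivity
  rw [hs]; simp

lemma JJ_lin (A B C : ℝ) {r : ℝ} (hr : 0 < r) : ∫ t in Ioi (0:ℝ),
    (A * (cosh t ^ 2 * exp (-(r * cosh t))) + B * (cosh t ^ 1 * exp (-(r * cosh t))) +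
      C * (cosh t ^ 0 * exp (-(r * cosh t)))) = A * JJ 2 r + B * JJ 1 r + C * JJ 0 r := by
  have h2 := (Jint 2 hr).const_mul A
  have h1 := (Jint 1 hr).const_mul B
  have h0 := (Jint 0 hr).const_mul C
  have h21 : IntegrableOn (fun t => A * (cosh t ^ 2 * exp (-(r * cosh t))) +
    B * (cosh t ^ 1 * exp (-(r * cosh t)))) (Ioi 0) := h2.add h1
  rw [integral_add h21 h0, integral_add h2 h1, integral_const_mul, integral_const_mul,
    integral_const_mul]
  rfl

lemma JJ_rel {r : ℝ} (hr : 0 < r) : JJ 1 r = r * (JJ 2 r - JJ 0 r) := by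
  have hder : ∀ t ∈ Ici (0:ℝ), HasDerivAt (fun t => sinh t * exp (-(r * cosh t)))
      (cosh t ^ 1 * exp (-(r * cosh t)) - r * (cosh t ^ 2 * exp (-(r * cosh t)) -
        cosh t ^ 0 * exp (-(r * cosh t)))) t := by
    intro t _
    have := (hasDerivAt_sinh t).mul ((((hasDerivAt_cosh t).const_mul r).neg).exp)
    convert! this using 1
    have := cosh_sq t
    simp only [Pi.neg_apply]
    have h2 : cosh t ^ 2 - 1 = sinh t ^ 2 := by rw [this]; ring
    linear_combination -r * exp (-(r * cosh t)) * h2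
  have hint : IntegrableOn (fun t => cosh t ^ 1 * exp (-(r * cosh t)) -
      r * (cosh t ^ 2 * exp (-(r * cosh t)) - cosh t ^ 0 * exp (-(r * cosh t)))) (Ioi 0) :=
    (Jint 1 hr).sub (((Jint 2 hr).sub (Jint 0 hr)).const_mul r)
  have hlim : Tendsto (fun t => sinh t * exp (-(r * cosh t))) atTop (nhds 0) := by
    have h0 : Tendsto (fun t => cosh t) atTop atTop := by
      refine tendsto_atTop_mono' _ ?_ tendsto_id
      filter_upwards [eventually_ge_atTop 0] with t ht
      exact (self_le_sinh_iff.2 ht).trans (sinh_lt_cosh t).le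
    have h1 : Tendsto (fun x : ℝ => x * exp (-(r * x))) atTop (nhds 0) := by
      have := (tendsto_pow_mul_exp_neg_atTop_nhds_zero 1).comp
        (tendsto_id.const_mul_atTop hr)
      have := this.const_mul r⁻¹
      simp only [mul_zero] at this
      refine this.congr fun x => ?_
      simp only [Function.comp, id, pow_one]; field_simp
    refine squeeze_zero' ?_ ?_ (h1.comp h0)
    · filter_upwards [eventually_ge_atTop 0] with t ht
      have := sinh_nonneg_iff.2 ht
      positivity
    · refine Eventually.of_forall fun t => ?_
      have := (sinh_lt_cosh t).le
      simp only [Function.comp]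
      gcongr
  have := integral_Ioi_of_hasDerivAt_of_tendsto' hder hint hlim
  have l := JJ_lin (-r) 1 r hr
  simp only [sinh_zero, zero_mul, sub_zero] at this
  have e : ∀ t : ℝ, cosh t ^ 1 * exp (-(r * cosh t)) - r * (cosh t ^ 2 * exp (-(r * cosh t)) -
      cosh t ^ 0 * exp (-(r * cosh t))) = -r * (cosh t ^ 2 * exp (-(r * cosh t))) +
      1 * (cosh t ^ 1 * exp (-(r * cosh t))) + r * (cosh t ^ 0 * exp (-(r * cosh t))) := by
    intro t; ring
  simp only [e] at this
  rw [l] at this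
  linarith

/-- decaying modified Bessel function and its logarithmic derivative -/
lemma exists_K : ∃ K κ : ℝ → ℝ, ∀ r, 0 < r → 0 < K r ∧ HasDerivAt K (-(κ r * K r)) r ∧
    HasDerivAt κ (κ r ^ 2 - 1 - κ r / r) r ∧ 1 ≤ κ r ∧ κ r ^ 2 - 1 - κ r / r ≤ 0 := by
  refine ⟨JJ 0, fun r => JJ 1 r / JJ 0 r, fun r hr => ?_⟩
  have p0 := JJ_pos 0 hr
  have p1 := JJ_pos 1 hr
  have rel := JJ_rel hr
  have d0 := JJ_deriv 0 hr
  have d1 := JJ_deriv 1 hr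
  have e2 : JJ 2 r = JJ 0 r + JJ 1 r / r := by field_simp; linarith
  have ge1 : JJ 0 r ≤ JJ 1 r := by
    apply setIntegral_mono (Jint 0 hr) (Jint 1 hr)
    intro t
    have := one_le_cosh t
    simp only [pow_zero, pow_one]
    gcongr
  have cs : JJ 1 r ^ 2 ≤ JJ 0 r * JJ 2 r := by
    have l := JJ_lin ((JJ 0 r)^2) (-(2 * JJ 0 r * JJ 1 r)) ((JJ 1 r) ^ 2) hr
    have h : 0 ≤ JJ 0 r ^ 2 * JJ 2 r + -(2 * JJ 0 r * JJ 1 r) * JJ 1 r + JJ 1 r ^ 2 * JJ 0 r := by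
      rw [← l]
      apply integral_nonneg
      intro t
      have : (JJ 0 r)^2 * (cosh t ^ 2 * exp (-(r * cosh t))) +
        -(2 * JJ 0 r * JJ 1 r) * (cosh t ^ 1 * exp (-(r * cosh t))) +
        (JJ 1 r) ^ 2 * (cosh t ^ 0 * exp (-(r * cosh t))) =
        (JJ 0 r * cosh t - JJ 1 r)^2 * exp (-(r * cosh t)) := by ring
      simp only [Pi.zero_apply]
      rw [this]; positivity
    nlinarith
  refine ⟨p0, ?_, ?_, ?_, ?_⟩
  · convert! d0 using 1
    field_simp
  · convert! d1.div d0 p0.ne' using 1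
    change _ = (-JJ 2 r * JJ 0 r - JJ 1 r * -JJ 1 r) / JJ 0 r ^ 2
    rw [e2]; field_simp; ring
  · rwa [le_div_iff₀ p0, one_mul]
  · have : (JJ 1 r / JJ 0 r)^2 - 1 - JJ 1 r / JJ 0 r / r = (JJ 1 r ^ 2 - JJ 0 r * JJ 2 r) / JJ 0 r ^ 2 := by
      rw [e2]; field_simp; ring
    rw [this]
    apply div_nonpos_of_nonpos_of_nonneg <;> [linarith; positivity]


lemma mono_of_d {f f' : ℝ → ℝ} {s t : ℝ} (hc : ContinuousOn f (Icc s t))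
    (hd : ∀ r ∈ Ioo s t, HasDerivAt f (f' r) r) (hp : ∀ r ∈ Ioo s t, 0 ≤ f' r) :
    MonotoneOn f (Icc s t) := by
  refine monotoneOn_of_deriv_nonneg (convex_Icc s t) hc ?_ ?_
  · rw [interior_Icc]; exact fun r hr => (hd r hr).differentiableAt.differentiableWithinAt
  · rw [interior_Icc]; exact fun r hr => by rw [(hd r hr).deriv]; exact hp r hr

lemma anti_of_d {f f' : ℝ → ℝ} {s t : ℝ} (hc : ContinuousOn f (Icc s t))
    (hd : ∀ r ∈ Ioo s t, HasDerivAt f (f' r) r) (hp : ∀ r ∈ Ioo s t, f' r ≤ 0) :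
    AntitoneOn f (Icc s t) := by
  refine antitoneOn_of_deriv_nonpos (convex_Icc s t) hc ?_ ?_
  · rw [interior_Icc]; exact fun r hr => (hd r hr).differentiableAt.differentiableWithinAt
  · rw [interior_Icc]; exact fun r hr => by rw [(hd r hr).deriv]; exact hp r hr

lemma smono_of_d {f f' : ℝ → ℝ} {s t : ℝ} (hc : ContinuousOn f (Icc s t))
    (hd : ∀ r ∈ Ioo s t, HasDerivAt f (f' r) r) (hp : ∀ r ∈ Ioo s t, 0 < f' r) :
    StrictMonoOn f (Icc s t) := by
  refine strictMonoOn_of_deriv_pos (convex_Icc s t) hc ?_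
  rw [interior_Icc]; exact fun r hr => by rw [(hd r hr).deriv]; exact hp r hr

lemma santi_of_d {f f' : ℝ → ℝ} {s t : ℝ} (hc : ContinuousOn f (Icc s t))
    (hd : ∀ r ∈ Ioo s t, HasDerivAt f (f' r) r) (hp : ∀ r ∈ Ioo s t, f' r < 0) :
    StrictAntiOn f (Icc s t) := by
  refine strictAntiOn_of_deriv_neg (convex_Icc s t) hc ?_
  rw [interior_Icc]; exact fun r hr => by rw [(hd r hr).deriv]; exact hp r hr

/-- lower/upper increment bounds -/
lemma incr_ge {f f' : ℝ → ℝ} {s t c : ℝ} (hst : s ≤ t) (hc : ContinuousOn f (Icc s t))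
    (hd : ∀ r ∈ Ioo s t, HasDerivAt f (f' r) r) (hp : ∀ r ∈ Ioo s t, c ≤ f' r) :
    c * (t - s) ≤ f t - f s := by
  have h := mono_of_d (f := fun r => f r - c * r) (f' := fun r => f' r - c)
    (hc.sub (by fun_prop)) (fun r hr => by
      convert! (hd r hr).sub ((hasDerivAt_id r).const_mul c) using 1
      simp) (fun r hr => by
      have := hp r hr; linarith)
  have := h (left_mem_Icc.2 hst) (right_mem_Icc.2 hst) hst
  simp only at this; linarith

lemma incr_le {f f' : ℝ → ℝ} {s t c : ℝ} (hst : s ≤ t) (hc : ContinuousOn f (Icc s t))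
    (hd : ∀ r ∈ Ioo s t, HasDerivAt f (f' r) r) (hp : ∀ r ∈ Ioo s t, f' r ≤ c) :
    f t - f s ≤ c * (t - s) := by
  have := incr_ge (f := fun r => - f r) (f' := fun r => - f' r) (c := -c) hst hc.neg
    (fun r hr => (hd r hr).neg) (fun r hr => by have := hp r hr; linarith)
  linarith

/-- radial second order pair -/
def Rad (x p f : ℝ → ℝ) (s t : ℝ) : Prop :=
  ContinuousOn x (Icc s t) ∧ ContinuousOn p (Icc s t) ∧
    ∀ r ∈ Ioo s t, HasDerivAt x (p r) r ∧ HasDerivAt p (f r - p r / r) r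

lemma Rad.sub {x p f : ℝ → ℝ} {s t s' t' : ℝ} (h : Rad x p f s t) (hs : s ≤ s') (ht : t' ≤ t) :
    Rad x p f s' t' :=
  ⟨h.1.mono (Icc_subset_Icc hs ht), h.2.1.mono (Icc_subset_Icc hs ht),
    fun r hr => h.2.2 r (Ioo_subset_Ioo hs ht hr)⟩

lemma Rad.rp_deriv {x p f : ℝ → ℝ} {s t : ℝ} (h : Rad x p f s t) (hs : 0 ≤ s) {r : ℝ}
    (hr : r ∈ Ioo s t) : HasDerivAt (fun r => r * p r) (r * f r) r := by
  have h0 : r ≠ 0 := (hs.trans_lt hr.1).ne'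
  convert! (hasDerivAt_id r).mul (h.2.2 r hr).2 using 1
  simp only [id]; field_simp; ring

/-- basic bounds for radial pairs -/
lemma Rad.p_ge {x p f : ℝ → ℝ} {t c : ℝ} (h : Rad x p f 0 t) (h0 : p 0 = 0)
    (hf : ∀ r ∈ Ioo 0 t, c ≤ f r) : ∀ r ∈ Icc 0 t, c * r / 2 ≤ p r := by
  intro r hr
  have hm := mono_of_d (f := fun r => r * p r - c * r^2/2) (f' := fun r => r * f r - c * r)
    (s := 0) (t := t)
    ((continuousOn_id.mul h.2.1).sub (by fun_prop)) (fun r hr => by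
      convert! (h.rp_deriv le_rfl hr).sub ((((hasDerivAt_id r).pow 2).const_mul c).div_const 2) using 1
      simp; ring) (fun r hr => by have := hf r hr; have := hr.1; nlinarith)
  have := hm (left_mem_Icc.2 (hr.1.trans hr.2)) hr hr.1
  simp only [zero_mul] at this
  rcases hr.1.eq_or_lt with h1 | h1
  · rw [← h1, h0]; simp
  · have : r * (c * r / 2) ≤ r * p r := by nlinarith
    exact le_of_mul_le_mul_left this h1

lemma Rad.neg {x p f : ℝ → ℝ} {s t : ℝ} (h : Rad x p f s t) :
    Rad (fun r => -x r) (fun r => -p r) (fun r => -f r) s t := by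
  refine ⟨h.1.neg, h.2.1.neg, fun r hr => ⟨(h.2.2 r hr).1.neg, ?_⟩⟩
  convert! (h.2.2 r hr).2.neg using 1; ring

lemma Rad.p_le {x p f : ℝ → ℝ} {t c : ℝ} (h : Rad x p f 0 t) (h0 : p 0 = 0)
    (hf : ∀ r ∈ Ioo 0 t, f r ≤ c) : ∀ r ∈ Icc 0 t, p r ≤ c * r / 2 := by
  intro r hr
  have := h.neg.p_ge (c := -c) (by simp [h0]) (fun r hr => by have := hf r hr; linarith) r hr
  linarith

lemma Rad.p_gt {x p f : ℝ → ℝ} {t : ℝ} (h : Rad x p f 0 t)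
    (hf : ∀ r ∈ Ioo 0 t, 0 < f r) : ∀ r ∈ Ioc 0 t, 0 < p r := by
  intro r hr
  have hm := smono_of_d (f := fun r => r * p r) (f' := fun r => r * f r)
    (s := 0) (t := t) (continuousOn_id.mul h.2.1) (fun r hr => h.rp_deriv le_rfl hr)
    (fun r hr => mul_pos hr.1 (hf r hr))
  have := hm (left_mem_Icc.2 (hr.1.le.trans hr.2)) (Ioc_subset_Icc_self hr) hr.1
  simp only [zero_mul] at this
  exact (pos_iff_pos_of_mul_pos this).1 hr.1

/-- maximum principle -/
lemma Rad.max_principle {x p f : ℝ → ℝ} {s t : ℝ} (h : Rad x p f s t) (hs : 0 ≤ s)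
    (hf : ∀ r ∈ Ioo s t, 0 < x r → 0 < f r) (ht : x t ≤ 0) (h0 : x s ≤ 0 ∨ 0 ≤ s * p s) :
    ∀ r ∈ Icc s t, x r ≤ 0 := by
  intro r hr
  by_contra hpos
  push Not at hpos
  obtain ⟨r1, hr1, hmax⟩ := isCompact_Icc.exists_isMaxOn ⟨r, hr⟩ h.1
  have hx1 : 0 < x r1 := hpos.trans_le (hmax hr)
  have hne : r1 < t := lt_of_le_of_ne hr1.2 (fun e => by rw [e] at hx1; linarith)
  have hp1 : 0 ≤ r1 * p r1 := by
    rcases hr1.1.eq_or_lt with e | e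
    · rw [← e] at hx1 ⊢
      rcases h0 with h0 | h0
      · linarith
      · exact h0
    · have hm : IsLocalMax x r1 := by
        filter_upwards [Icc_mem_nhds e hne] with y hy using hmax hy
      have := hm.hasDerivAt_eq_zero (h.2.2 r1 ⟨e, hne⟩).1
      rw [this]; simp
  obtain ⟨r2, hr2, hr2t, hxp⟩ : ∃ r2, r1 < r2 ∧ r2 ≤ t ∧ ∀ y ∈ Icc r1 r2, 0 < x y := by
    have := (h.1 r1 hr1).eventually (lt_mem_nhds hx1)
    obtain ⟨η, hη, hb⟩ := Metric.mem_nhdsWithin_iff.1 this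
    refine ⟨min t (r1 + η/2), by simp [hne, hη], min_le_left _ _, fun y hy => hb ⟨?_, hr1.1.trans hy.1, hy.2.trans (min_le_left _ _)⟩⟩
    rw [Metric.mem_ball, Real.dist_eq, abs_lt]
    have := hy.2.trans (min_le_right _ _)
    constructor <;> linarith [hy.1]
  have hsub := h.sub hr1.1 hr2t
  have hs1 : 0 ≤ r1 := hs.trans hr1.1
  have hm := smono_of_d (f := fun r => r * p r) (f' := fun r => r * f r)
    (continuousOn_id.mul hsub.2.1) (fun r hr => hsub.rp_deriv hs1 hr)
    (fun r hr' => mul_pos (hs1.trans_lt hr'.1) (hf r ⟨hr1.1.trans_lt hr'.1, hr'.2.trans_le hr2t⟩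
      (hxp r (Ioo_subset_Icc_self hr'))))
  have hxm := smono_of_d hsub.1 (fun r hr => (hsub.2.2 r hr).1) (fun r hr' => by
    have := hm (left_mem_Icc.2 hr2.le) (Ioo_subset_Icc_self hr') hr'.1
    simp only at this
    exact (pos_iff_pos_of_mul_pos (hp1.trans_lt this)).1 (hs1.trans_lt hr'.1))
  have := hxm (left_mem_Icc.2 hr2.le) (right_mem_Icc.2 hr2.le) hr2
  exact absurd (hmax (a := r2) ⟨hr1.1.trans hr2.le, hr2t⟩) (not_le.2 this)

/-- Gronwall for radial pairs -/
lemma Rad.gronwall {x p f e e' : ℝ → ℝ} {t L : ℝ} (h : Rad x p f 0 t) (hL : 0 ≤ L)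
    (h0 : p 0 = 0) (hec : ContinuousOn e (Icc 0 t))
    (hed : ∀ r ∈ Ioo 0 t, HasDerivAt e (e' r) r) (hep : ∀ r ∈ Ioo 0 t, 0 ≤ e' r)
    (hf : ∀ r ∈ Ioo 0 t, |f r| ≤ L * |x r| + e' r) :
    ∀ r ∈ Icc 0 t, |x r| ≤ (|x 0| + (e r - e 0)) * exp ((1 + L) * r) ∧
      |p r| ≤ (|x 0| + (e r - e 0)) * exp ((1 + L) * r) := by
  have key : ∀ d, 0 < d → ∀ r ∈ Icc 0 t,
      √(x r ^ 2 + p r ^ 2 + d ^ 2) ≤ (|x 0| + d + (e r - e 0)) * exp ((1 + L) * r) := by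
    intro d hd r hr
    have hpos : ∀ r, 0 < x r ^ 2 + p r ^ 2 + d ^ 2 := fun r => by positivity
    have hanti := anti_of_d (s := 0) (t := t)
      (f := fun r => √(x r ^ 2 + p r ^ 2 + d ^ 2) * exp (-((1 + L) * r)) - e r)
      (f' := fun r => (2 * x r * p r + 2 * p r * (f r - p r / r)) / (2 * √(x r ^ 2 + p r ^ 2 + d ^ 2))
        * exp (-((1 + L) * r)) + √(x r ^ 2 + p r ^ 2 + d ^ 2) *
          (exp (-((1 + L) * r)) * -(1 + L)) - e' r)
      ((((((h.1.pow 2).add (h.2.1.pow 2)).add continuousOn_const).sqrt).mul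
        (by fun_prop)).sub hec) (by
        intro r hr
        obtain ⟨h1, h2⟩ := h.2.2 r hr
        have a1 := ((((h1.pow 2).add (h2.pow 2)).add_const (d^2)).sqrt (hpos r).ne')
        have a2 := (((hasDerivAt_id r).const_mul (1 + L)).neg).exp
        convert! (a1.mul a2).sub (hed r hr) using 1
        simp) (by
        intro r hr
        set N := √(x r ^ 2 + p r ^ 2 + d ^ 2) with hN
        have hN0 : 0 < N := sqrt_pos.2 (hpos r)
        have hN2 : N ^ 2 = x r ^ 2 + p r ^ 2 + d ^ 2 := sq_sqrt (hpos r).le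
        have hxN : |x r| ≤ N := abs_le_sqrt (by nlinarith)
        have hpN : |p r| ≤ N := abs_le_sqrt (by nlinarith)
        have he1 : exp (-((1 + L) * r)) ≤ 1 := exp_le_one_iff.2 (by have := hr.1; nlinarith)
        have he0 := exp_pos (-((1 + L) * r))
        have b1 : x r * p r ≤ N * N := (le_abs_self _).trans (by rw [abs_mul]; gcongr)
        have b2 : p r * f r ≤ N * (L * N + e' r) := by
          refine (le_abs_self _).trans ?_
          rw [abs_mul]
          gcongr
          exact (hf r hr).trans (by gcongr)
        have b3 : 0 ≤ p r * (p r / r) := by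
          rw [← mul_div_assoc]; exact div_nonneg (mul_self_nonneg _) hr.1.le
        have b4 : (2 * x r * p r + 2 * p r * (f r - p r / r)) / (2 * N) ≤ (1 + L) * N + e' r := by
          rw [div_le_iff₀ (by positivity)]
          nlinarith
        have := hep r hr
        calc _ ≤ ((1 + L) * N + e' r) * exp (-((1 + L) * r)) +
              N * (exp (-((1 + L) * r)) * -(1 + L)) - e' r := by gcongr
          _ = e' r * (exp (-((1 + L) * r)) - 1) := by ring
          _ ≤ 0 := mul_nonpos_of_nonneg_of_nonpos this (by linarith))
    have := hanti (left_mem_Icc.2 (hr.1.trans hr.2)) hr hr.1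
    simp only [h0, mul_zero, neg_zero, exp_zero, mul_one] at this
    have h3 : √(x 0 ^ 2 + 0 ^ 2 + d ^ 2) ≤ |x 0| + d := by
      rw [sqrt_le_left (by positivity)]
      have := sq_abs (x 0)
      nlinarith [abs_nonneg (x 0)]
    have h4 : exp (-((1 + L) * r)) * exp ((1 + L) * r) = 1 := by rw [← exp_add]; simp
    calc √(x r ^ 2 + p r ^ 2 + d ^ 2)
        = (√(x r ^ 2 + p r ^ 2 + d ^ 2) * exp (-((1 + L) * r))) * exp ((1 + L) * r) := by
          rw [mul_assoc, h4, mul_one]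
      _ ≤ _ := by gcongr; linarith
  intro r hr
  have lim : ∀ y, (∀ d, 0 < d → y ≤ (|x 0| + d + (e r - e 0)) * exp ((1 + L) * r)) →
      y ≤ (|x 0| + (e r - e 0)) * exp ((1 + L) * r) := by
    intro y hy
    have hc : Tendsto (fun d : ℝ => (|x 0| + d + (e r - e 0)) * exp ((1 + L) * r))
        (nhdsWithin 0 (Ioi 0)) (nhds ((|x 0| + 0 + (e r - e 0)) * exp ((1 + L) * r))) :=
      (Continuous.tendsto (by fun_prop) 0).mono_left nhdsWithin_le_nhds
    rw [add_zero] at hc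
    exact ge_of_tendsto hc (eventually_nhdsWithin_of_forall fun d hd => hy d hd)
  exact ⟨lim _ fun d hd => (abs_le_sqrt (by nlinarith)).trans (key d hd r hr),
    lim _ fun d hd => (abs_le_sqrt (by nlinarith)).trans (key d hd r hr)⟩


lemma boot {x : ℝ → ℝ} {s t : ℝ} (hc : ContinuousOn x (Icc s t)) (h0 : 0 < x s)
    (h : ∀ r ∈ Ioc s t, (∀ y ∈ Ico s r, 0 < x y) → 0 < x r) : ∀ r ∈ Icc s t, 0 < x r := by
  by_contra hno
  push Not at hno
  obtain ⟨r, hr, hx⟩ := hno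
  have hcl : IsCompact (Icc s t ∩ x ⁻¹' Iic 0) :=
    isCompact_Icc.of_isClosed_subset (hc.preimage_isClosed_of_isClosed isClosed_Icc isClosed_Iic)
      inter_subset_left
  obtain ⟨y, ⟨hy1, hy2⟩, hmin⟩ := hcl.exists_isLeast ⟨r, hr, hx⟩
  have hsy : s < y := lt_of_le_of_ne hy1.1 (fun e => by
    rw [← e] at hy2; exact absurd h0 (not_lt.2 hy2))
  have := h y ⟨hsy, hy1.2⟩ (fun z hz => by
    by_contra hz'
    exact absurd (hmin ⟨⟨hz.1, hz.2.le.trans hy1.2⟩, not_lt.1 hz'⟩) (not_le.2 hz.2))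
  exact absurd this (not_lt.2 hy2)

lemma Rad.end_deriv {x p f : ℝ → ℝ} {s t : ℝ} (h : Rad x p f s t) (hst : s < t)
    (hx : ∀ r ∈ Icc s t, x r ≤ 0) (ht : x t = 0) : 0 ≤ p t := by
  by_contra hn
  push Not at hn
  have := (h.2.1 t (right_mem_Icc.2 hst.le)).eventually (gt_mem_nhds hn)
  obtain ⟨η, hη, hb⟩ := Metric.mem_nhdsWithin_iff.1 this
  have hlt : max s (t - η/2) < t := max_lt hst (by linarith)
  have hsub := h.sub (le_max_left s (t - η/2)) le_rfl
  have hanti := santi_of_d hsub.1 (fun r hr => (hsub.2.2 r hr).1) (fun r hr => hb ⟨by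
    rw [Metric.mem_ball, Real.dist_eq, abs_lt]
    have := (le_max_right s (t - η/2)).trans_lt hr.1
    constructor <;> linarith [hr.2], (le_max_left s (t - η/2)).trans hr.1.le, hr.2.le⟩)
  have h1 := hanti (left_mem_Icc.2 hlt.le) (right_mem_Icc.2 hlt.le) hlt
  have h2 := hx _ ⟨le_max_left _ _, hlt.le⟩
  linarith

structure RF (h : ℝ → ℝ) (L U : ℝ) (X P : ℝ → ℝ → ℝ) : Prop where
  L0 : 0 ≤ L
  lip : ∀ y z, |h y - h z| ≤ L * |y - z|
  mono : ∀ z y, U ≤ z → z ≤ y → y - z ≤ h y - h z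
  zero : ∀ u, u ≤ U → h u = 0
  X0 : ∀ x, X x 0 = x
  P0 : ∀ x, P x 0 = 0
  Xc : Continuous (fun p : ℝ × ℝ => X p.1 p.2)
  Pc : Continuous (fun p : ℝ × ℝ => P p.1 p.2)
  dX : ∀ x r, 0 < r → HasDerivAt (X x) (P x r) r
  dP : ∀ x r, 0 < r → HasDerivAt (P x) (h (X x r) - P x r / r) r

lemma RF.exists (h : ℝ → ℝ) (L U : ℝ) (L0 : 0 ≤ L) (lip : ∀ y z, |h y - h z| ≤ L * |y - z|)
    (mono : ∀ z y, U ≤ z → z ≤ y → y - z ≤ h y - h z) (zero : ∀ u, u ≤ U → h u = 0) :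
    ∃ X P, RF h L U X P := by
  have hl : LipschitzWith (Real.toNNReal L) h := LipschitzWith.of_dist_le_mul fun y z => by
    rw [Real.dist_eq, Real.dist_eq, Real.coe_toNNReal L L0]; exact lip y z
  obtain ⟨X, P, h1, h2, h3, h4, h5, h6⟩ := flow_exists h hl
  exact ⟨X, P, L0, lip, mono, zero, h1, h2, h3, h4, h5, fun x r hr => by
    convert! h6 x r hr using 1; simp [div_eq_inv_mul]⟩

section
variable {h : ℝ → ℝ} {L U : ℝ} {X P : ℝ → ℝ → ℝ}

lemma RF.Xc' (H : RF h L U X P) (α : ℝ) : Continuous (X α) :=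
  H.Xc.comp (f := fun r : ℝ => (α, r)) (by fun_prop)
lemma RF.Pc' (H : RF h L U X P) (α : ℝ) : Continuous (P α) :=
  H.Pc.comp (f := fun r : ℝ => (α, r)) (by fun_prop)
lemma RF.rad (H : RF h L U X P) (α t : ℝ) : Rad (X α) (P α) (fun r => h (X α r)) 0 t :=
  ⟨(H.Xc' α).continuousOn, (H.Pc' α).continuousOn, fun r hr => ⟨H.dX α r hr.1, H.dP α r hr.1⟩⟩
lemma RF.hmono (H : RF h L U X P) : Monotone h := by
  intro z y hzy
  rcases le_total U z with hz | hz
  · have := H.mono z y hz hzy; linarith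
  · rw [H.zero z hz]
    rcases le_total U y with hy | hy
    · have := H.mono U y le_rfl hy; rw [H.zero U le_rfl] at this; linarith
    · rw [H.zero y hy]
lemma RF.hnn (H : RF h L U X P) (u : ℝ) : 0 ≤ h u := by
  rcases le_total U u with hz | hz
  · rw [← H.zero U le_rfl]; exact H.hmono hz
  · rw [H.zero u hz]
lemma RF.hpos (H : RF h L U X P) {u : ℝ} (hu : U < u) : 0 < h u := by
  have := H.mono U u le_rfl hu.le; rw [H.zero U le_rfl] at this; linarith
lemma RF.hcont (H : RF h L U X P) : Continuous h := by
  have hl : LipschitzWith (Real.toNNReal L) h := LipschitzWith.of_dist_le_mul fun y z => by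
    rw [Real.dist_eq, Real.dist_eq, Real.coe_toNNReal L H.L0]; exact H.lip y z
  exact hl.continuous
lemma RF.Pnn (H : RF h L U X P) (α : ℝ) {r : ℝ} (hr : 0 ≤ r) : 0 ≤ P α r := by
  have := (H.rad α r).p_ge (c := 0) (H.P0 α) (fun s _ => H.hnn _) r ⟨hr, le_rfl⟩
  simpa using this
lemma RF.Xmono (H : RF h L U X P) (α : ℝ) {s r : ℝ} (hs : 0 ≤ s) (hr : s ≤ r) :
    X α s ≤ X α r :=
  mono_of_d (H.rad α r).1 (fun y hy => ((H.rad α r).2.2 y hy).1) (fun y hy => H.Pnn α hy.1.le)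
    ⟨hs, hr⟩ ⟨hs.trans hr, le_rfl⟩ hr
lemma RF.Xge (H : RF h L U X P) (α : ℝ) {r : ℝ} (hr : 0 ≤ r) : α ≤ X α r := by
  have := H.Xmono α le_rfl hr; rwa [H.X0] at this
lemma RF.Pge (H : RF h L U X P) (α : ℝ) {r : ℝ} (hr : 0 ≤ r) : h α * r / 2 ≤ P α r :=
  (H.rad α r).p_ge (H.P0 α) (fun s hs => H.hmono (H.Xge α hs.1.le)) r ⟨hr, le_rfl⟩
lemma RF.Ple (H : RF h L U X P) (α : ℝ) {r : ℝ} (hr : 0 ≤ r) : P α r ≤ h (X α r) * r / 2 :=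
  (H.rad α r).p_le (H.P0 α) (fun s hs => H.hmono (H.Xmono α hs.1.le hs.2.le)) r ⟨hr, le_rfl⟩
lemma RF.Ppos (H : RF h L U X P) {α : ℝ} (hα : U < α) {r : ℝ} (hr : 0 < r) : 0 < P α r := by
  have := H.Pge α hr.le
  have := H.hpos hα
  have : 0 < h α * r / 2 := by positivity
  linarith
lemma RF.Xsmono (H : RF h L U X P) {α : ℝ} (hα : U < α) : StrictMonoOn (X α) (Ici 0) := by
  intro s hs r hr hsr
  exact smono_of_d (H.rad α r).1 (fun y hy => ((H.rad α r).2.2 y hy).1)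
    (fun y hy => H.Ppos hα hy.1) ⟨hs, hsr.le⟩ ⟨hr, le_rfl⟩ hsr
lemma RF.Xge2 (H : RF h L U X P) (α : ℝ) {r : ℝ} (hr : 0 ≤ r) : α + h α * r^2 / 4 ≤ X α r := by
  have hm := mono_of_d (f := fun r => X α r - h α * r^2/4) (f' := fun r => P α r - h α * r / 2)
    (s := 0) (t := r) ((H.rad α r).1.sub (by fun_prop)) (fun r hr => by
      convert! (H.dX α r hr.1).sub ((((hasDerivAt_id r).pow 2).const_mul (h α)).div_const 4) using 1
      simp; ring) (fun s hs => by have := H.Pge α hs.1.le; linarith)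
  have := hm (left_mem_Icc.2 hr) (right_mem_Icc.2 hr) hr
  simp [H.X0] at this; linarith
lemma RF.Xle2 (H : RF h L U X P) (α : ℝ) {r : ℝ} (hr : 0 ≤ r) :
    X α r ≤ α + h (X α r) * r^2 / 4 := by
  have hm := anti_of_d (f := fun s => X α s - h (X α r) * s^2/4)
    (f' := fun s => P α s - h (X α r) * s / 2)
    (s := 0) (t := r) ((H.rad α r).1.sub (by fun_prop)) (fun s hs => by
      convert! (H.dX α s hs.1).sub ((((hasDerivAt_id s).pow 2).const_mul (h (X α r))).div_const 4) using 1
      simp; ring) (fun s hs => by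
        have h1 := H.Ple α hs.1.le
        have h2 := H.hmono (H.Xmono α hs.1.le hs.2.le)
        have := hs.1
        nlinarith)
  have := hm (left_mem_Icc.2 hr) (right_mem_Icc.2 hr) hr
  simp [H.X0] at this; linarith
lemma RF.dep (H : RF h L U X P) (α β : ℝ) {r : ℝ} (hr : 0 ≤ r) :
    |X α r - X β r| ≤ |α - β| * exp ((1 + L) * r) ∧
    |P α r - P β r| ≤ |α - β| * exp ((1 + L) * r) := by
  have hR : Rad (fun r => X α r - X β r) (fun r => P α r - P β r)
      (fun r => h (X α r) - h (X β r)) 0 r := by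
    refine ⟨(H.rad α r).1.sub (H.rad β r).1, (H.rad α r).2.1.sub (H.rad β r).2.1, fun s hs =>
      ⟨(H.dX α s hs.1).sub (H.dX β s hs.1), ?_⟩⟩
    convert! (H.dP α s hs.1).sub (H.dP β s hs.1) using 1; ring
  have := hR.gronwall (e := fun _ => 0) (e' := fun _ => 0) H.L0 (by simp [H.P0])
    continuousOn_const (fun s _ => hasDerivAt_const s 0) (fun _ _ => le_rfl)
    (fun s _ => by simpa using H.lip _ _) r ⟨hr, le_rfl⟩
  simpa [H.X0] using this
lemma RF.XU (H : RF h L U X P) {r : ℝ} (hr : 0 ≤ r) : X U r = U := by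
  have hR : Rad (fun r => X U r - U) (P U) (fun r => h (X U r)) 0 r :=
    ⟨(H.rad U r).1.sub continuousOn_const, (H.rad U r).2.1, fun s hs =>
      ⟨(H.dX U s hs.1).sub_const U, H.dP U s hs.1⟩⟩
  have := (hR.gronwall (e := fun _ => 0) (e' := fun _ => 0) H.L0 (by simp [H.P0])
    continuousOn_const (fun s _ => hasDerivAt_const s 0) (fun _ _ => le_rfl)
    (fun s _ => by
      have := H.lip (X U s) U
      rw [H.zero U le_rfl] at this; simpa using this) r ⟨hr, le_rfl⟩).1
  simp [H.X0] at this; linarith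
lemma RF.hit (H : RF h L U X P) {us : ℝ} : ∀ α, ∃ R, α ∈ Ioo U us → 0 < R ∧ X α R = us := by
  intro α
  by_cases hα : α ∈ Ioo U us
  · have hh := H.hpos hα.1
    obtain ⟨T, hT, hT2⟩ : ∃ T : ℝ, 0 ≤ T ∧ us ≤ X α T := by
      refine ⟨√(4 * (us - α) / h α), sqrt_nonneg _, ?_⟩
      have := H.Xge2 α (sqrt_nonneg (4 * (us - α) / h α))
      rw [sq_sqrt (by have := hα.2; apply div_nonneg <;> linarith)] at this
      refine le_trans (le_of_eq ?_) this
      field_simp; ring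
    obtain ⟨R, hR, hR2⟩ := intermediate_value_Icc hT (H.Xc' α).continuousOn
      (⟨by rw [H.X0]; exact hα.2.le, hT2⟩ : us ∈ Icc (X α 0) (X α T))
    refine ⟨R, fun _ => ⟨lt_of_le_of_ne hR.1 fun e => ?_, hR2⟩⟩
    rw [← e, H.X0] at hR2; linarith [hα.2]
  · exact ⟨0, fun h => absurd h hα⟩
/-- ordering of trajectories -/
lemma RF.order (H : RF h L U X P) {α α' : ℝ} (hα : α < α') {r : ℝ}
    (hr : 0 ≤ r) : α' - α ≤ X α' r - X α r := by
  have hR : ∀ t, Rad (fun r => X α' r - X α r) (fun r => P α' r - P α r)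
      (fun r => h (X α' r) - h (X α r)) 0 t := by
    intro t
    refine ⟨(H.rad α' t).1.sub (H.rad α t).1, (H.rad α' t).2.1.sub (H.rad α t).2.1, fun s hs =>
      ⟨(H.dX α' s hs.1).sub (H.dX α s hs.1), ?_⟩⟩
    convert! (H.dP α' s hs.1).sub (H.dP α s hs.1) using 1; ring
  have step : ∀ t, 0 ≤ t → (∀ y ∈ Ico 0 t, 0 < X α' y - X α y) → α' - α ≤ X α' t - X α t := by
    intro t ht hy
    have hp := (hR t).p_ge (c := 0) (by simp [H.P0]) (fun s hs => by
      have := hy s ⟨hs.1.le, hs.2⟩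
      have := H.hmono (show X α s ≤ X α' s by linarith)
      linarith)
    have := mono_of_d (hR t).1 (fun s hs => ((hR t).2.2 s hs).1) (fun s hs => by
      have := hp s (Ioo_subset_Icc_self hs); simpa using this) (left_mem_Icc.2 ht)
      (right_mem_Icc.2 ht) ht
    simp [H.X0] at this; linarith
  have := boot (x := fun r => X α' r - X α r) (hR r).1 (by simp [H.X0, hα])
    (fun t ht hy => by have := step t ht.1.le hy; linarith)
  exact step r hr (fun y hy => this y ⟨hy.1, hy.2.le⟩)

/-- rate of change of the interface slope -/
lemma RF.rate (H : RF h L U X P) {us α α' R R' : ℝ} (hα : U < α) (hαα : α < α')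
    (hR : 0 < R) (hR' : 0 < R') (hXR : X α R = us) (hXR' : X α' R' = us) :
    R' < R ∧ α' - α ≤ h us * R / 2 * (R - R') ∧
    (R - R') * h α / (8 * (3 + L * R' ^ 2)) ≤ P α R - P α' R' := by
  have hL := H.L0
  have ho := H.order hαα hR'.le
  have hlt : R' < R := by
    by_contra hle
    push Not at hle
    have := H.Xmono α hR.le hle
    linarith
  refine ⟨hlt, ?_, ?_⟩
  · have := incr_le (f := X α) (f' := P α) (c := h us * R / 2) hlt.le (H.Xc' α).continuousOn
      (fun r hr => H.dX α r (hR'.trans hr.1)) (fun r hr => by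
        have h0 := hR'.trans hr.1
        have h1 := H.Ple α h0.le
        have h2 := H.hmono (H.Xmono α h0.le hr.2.le)
        rw [hXR] at h2
        have h3 := H.hnn us
        have h4 := hr.2
        nlinarith)
    linarith
  set d := R - R' with hd
  have hd0 : 0 < d := by linarith
  have hyd : ∀ r, 0 ≤ r → HasDerivAt (fun r => X α (r + d)) (P α (r + d)) r ∧
      HasDerivAt (fun r => P α (r + d)) (h (X α (r+d)) - P α (r+d) / (r + d)) r := fun r hr =>
    ⟨HasDerivAt.comp_add_const r d (H.dX α (r+d) (by linarith)),
      HasDerivAt.comp_add_const r d (H.dP α (r+d) (by linarith))⟩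
  have hX := H.Xc' α
  have hP := H.Pc' α
  have hX' := H.Xc' α'
  have hP' := H.Pc' α'
  have rad : Rad (fun r => X α (r + d) - X α' r) (fun r => P α (r+d) - P α' r)
      (fun r => h (X α (r+d)) - h (X α' r) + P α (r+d) * d / (r * (r+d))) 0 R' := by
    refine ⟨by fun_prop, by fun_prop, fun r hr => ⟨(hyd r hr.1.le).1.sub (H.dX α' r hr.1), ?_⟩⟩
    convert! (hyd r hr.1.le).2.sub (H.dP α' r hr.1) using 1
    have : r ≠ 0 := hr.1.ne'
    have : r + d ≠ 0 := by linarith [hr.1]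
    field_simp; ring
  have hforce : ∀ r ∈ Ioo 0 R', d * h α / (2 * R') < P α (r+d) * d / (r * (r+d)) := by
    intro r hr
    have h1 := H.Pge α (show 0 ≤ r + d by linarith [hr.1])
    have h2 := H.hpos hα
    have h0 := hr.1
    have h3 := hr.2
    calc d * h α / (2 * R') < d * h α / (2 * r) := by gcongr
      _ = (h α * (r+d) / 2) * d / (r * (r+d)) := by field_simp
      _ ≤ _ := by gcongr
  have hf0 : 0 < d * h α / (2 * R') := by have := H.hpos hα; positivity
  have hend : X α (R' + d) - X α' R' = 0 := by
    rw [hXR', show R' + d = R by rw [hd]; ring, hXR]; ring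
  have hxle := rad.max_principle le_rfl (fun r hr hx => by
    have := H.hmono (show X α' r ≤ X α (r+d) by linarith)
    have := hforce r hr
    linarith) hend.le (Or.inr (by simp))
  set ε := h α / (4 * R' * (3 + L * R'^2)) with hε
  have hε0 : 0 < ε := by have := H.hpos hα; positivity
  have rad2 : Rad (fun r => X α (r + d) - X α' r + ε * d * ((r - R'/2) * (R' - r)))
      (fun r => P α (r+d) - P α' r + ε * d * (3 * R' / 2 - 2 * r))
      (fun r => h (X α (r+d)) - h (X α' r) + P α (r+d) * d / (r * (r+d))
        + ε * d * (-2 + (3 * R' / 2 - 2 * r) / r)) (R'/2) R' := by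
    have rs := rad.sub (show 0 ≤ R'/2 by linarith) le_rfl
    refine ⟨by fun_prop, by fun_prop, fun r hr => ⟨?_, ?_⟩⟩
    · convert! (rs.2.2 r hr).1.add (((((hasDerivAt_id r).sub_const (R'/2)).mul
        ((hasDerivAt_id r).const_sub R'))).const_mul (ε * d)) using 1
      simp; ring_nf; simp
    · convert! (rs.2.2 r hr).2.add (((((hasDerivAt_id r).const_mul 2).const_sub (3 * R'/2))).const_mul (ε * d)) using 1
      simp; ring
  have hle2 := rad2.max_principle (by linarith) (fun r hr hx => by
      have hr0 : 0 < r := by linarith [hr.1]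
      have h1 := hxle r ⟨hr0.le, hr.2.le⟩
      have h2 := hforce r ⟨hr0, hr.2⟩
      have h3 := H.lip (X α (r+d)) (X α' r)
      rw [abs_of_nonpos h1] at h3
      have h4 := (abs_le.1 h3).1
      have h5 : -1 ≤ (3 * R' / 2 - 2 * r) / r := by
        rw [le_div_iff₀ hr0]; linarith [hr.2]
      have h6 : (r - R'/2) * (R' - r) ≤ R'^2 := by nlinarith [hr.1, hr.2]
      have h7 : ε * d * ((r - R'/2) * (R' - r)) ≤ ε * d * R'^2 := by gcongr
      have h8 : ε * d * (-3) ≤ ε * d * (-2 + (3 * R' / 2 - 2 * r) / r) := by gcongr; linarith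
      have h9 : ε * d * (3 + L * R'^2) < d * h α / (2 * R') := by
        have : ε * d * (3 + L * R'^2) = d * h α / (2 * R') / 2 := by
          rw [hε]; field_simp; norm_num
        rw [this]; linarith
      have h10 : L * (X α (r+d) - X α' r) ≥ L * (-(ε * d * R'^2)) := by
        apply mul_le_mul_of_nonneg_left _ H.L0; linarith
      nlinarith) (by rw [hend]; simp) (Or.inl (by
        have := hxle (R'/2) ⟨by linarith, by linarith⟩
        simpa using this))
  have := rad2.end_deriv (by linarith) hle2 (by rw [hend]; simp)
  rw [show R' + d = R by rw [hd]; ring] at this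
  have e : ε * d * (3 * R' / 2 - 2 * R') = - (d * h α / (8 * (3 + L * R' ^ 2))) := by
    rw [hε]; field_simp; ring
  rw [e] at this; linarith
end


section
variable {h : ℝ → ℝ} {L U : ℝ} {X P : ℝ → ℝ → ℝ}

lemma RF.Rlip (H : RF h L U X P) {us α₁ α₂ : ℝ} {R : ℝ → ℝ}
    (hR : ∀ α, α ∈ Ioo U us → 0 < R α ∧ X α (R α) = us)
    (h1 : U < α₁) (h12 : α₁ ≤ α₂) (h2 : α₂ < us) :
    ∃ LR Rm RM, 0 < LR ∧ 0 < Rm ∧ ∀ α ∈ Icc α₁ α₂, Rm ≤ R α ∧ R α ≤ RM ∧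
      ∀ β ∈ Icc α₁ α₂, |R α - R β| ≤ LR * |α - β| := by
  have hus : 0 < h us := H.hpos (by linarith)
  have hh1 : 0 < h α₁ := H.hpos h1
  set RM := √(4 * (us - α₁) / h α₁)
  set Rm := √(4 * (us - α₂) / h us)
  have hRm : 0 < Rm := sqrt_pos.2 (by apply div_pos <;> linarith)
  have hin : ∀ α ∈ Icc α₁ α₂, α ∈ Ioo U us := fun α hα => ⟨h1.trans_le hα.1, hα.2.trans_lt h2⟩
  have hRM : ∀ α ∈ Icc α₁ α₂, R α ≤ RM := by
    intro α hα
    obtain ⟨r0, rX⟩ := hR α (hin α hα)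
    apply le_sqrt_of_sq_le
    rw [le_div_iff₀ hh1]
    have k1 := H.Xge2 α r0.le
    have k2 := H.hmono hα.1
    rw [rX] at k1
    nlinarith [sq_nonneg (R α), hα.1]
  have hRm' : ∀ α ∈ Icc α₁ α₂, Rm ≤ R α := by
    intro α hα
    obtain ⟨r0, rX⟩ := hR α (hin α hα)
    rw [sqrt_le_left r0.le, div_le_iff₀ hus]
    have k1 := H.Xle2 α r0.le
    rw [rX] at k1
    nlinarith [hα.2]
  have one : ∀ α ∈ Icc α₁ α₂, ∀ β ∈ Icc α₁ α₂,
      R β - R α ≤ exp ((1 + L) * RM) / (h α₁ * Rm / 2) * |α - β| := by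
    intro α hα β hβ
    obtain ⟨r0, rX⟩ := hR α (hin α hα)
    obtain ⟨s0, sX⟩ := hR β (hin β hβ)
    rcases le_total (R β) (R α) with hle | hle
    · exact (sub_nonpos.2 hle).trans (by positivity)
    have := incr_ge (f := X β) (f' := P β) (c := h α₁ * Rm / 2) hle (H.Xc' β).continuousOn
      (fun r hr => H.dX β r (r0.trans hr.1)) (fun r hr => by
        have k0 := r0.trans hr.1
        have k1 := H.Pge β k0.le
        have k2 := H.hmono hβ.1
        have k3 := (hRm' α hα).trans hr.1.le
        have := H.hnn β
        have : h α₁ * Rm ≤ h β * r := by gcongr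
        linarith)
    have d := (H.dep α β r0.le).1
    rw [rX] at d
    rw [sX] at this
    have d2 : |α - β| * exp ((1 + L) * R α) ≤ |α - β| * exp ((1 + L) * RM) := by
      have := hRM α hα
      have := H.L0
      gcongr
    have d3 := le_abs_self (us - X β (R α))
    rw [div_mul_eq_mul_div, le_div_iff₀ (by positivity)]
    nlinarith
  refine ⟨exp ((1 + L) * RM) / (h α₁ * Rm / 2), Rm, RM, by positivity, hRm, fun α hα =>
    ⟨hRm' α hα, hRM α hα, fun β hβ => abs_le.2 ⟨?_, ?_⟩⟩⟩
  · have := one α hα β hβ; linarith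
  · have := one β hβ α hα; rwa [abs_sub_comm] at this

lemma kappa_le {k r : ℝ} (hr : 0 < r) (h1 : 1 ≤ k) (h2 : k ^ 2 - 1 - k / r ≤ 0) : k ≤ 1 + 1 / r := by
  have e : k / r = k * (1 / r) := by ring
  have hp : 0 < 1 / r := by positivity
  rw [e] at h2
  nlinarith

lemma kappa_anti {κ : ℝ → ℝ}
    (hκ : ∀ r, 0 < r → HasDerivAt κ (κ r ^ 2 - 1 - κ r / r) r ∧ 1 ≤ κ r ∧
      κ r ^ 2 - 1 - κ r / r ≤ 0) {s t : ℝ} (hs : 0 < s) (hst : s ≤ t) : κ t ≤ κ s :=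
  anti_of_d (fun r hr => (hκ r (hs.trans_le hr.1)).1.continuousAt.continuousWithinAt)
    (fun r hr => (hκ r (hs.trans hr.1)).1) (fun r hr => (hκ r (hs.trans hr.1)).2.2)
    (left_mem_Icc.2 hst) (right_mem_Icc.2 hst) hst

/-- near the lower equilibrium the slope is large -/
lemma RF.low (H : RF h L U X P) {us a : ℝ} (hUs : U < us) (hsa : us < a) {κ : ℝ → ℝ} {R : ℝ → ℝ}
    (hκ : ∀ r, 0 < r → HasDerivAt κ (κ r ^ 2 - 1 - κ r / r) r ∧ 1 ≤ κ r ∧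
      κ r ^ 2 - 1 - κ r / r ≤ 0)
    (hR : ∀ α, α ∈ Ioo U us → 0 < R α ∧ X α (R α) = us)
    (hE : (a - us) ^ 2 / 2 < ∫ s in U..us, h s) :
    ∃ α, U < α ∧ α < (U + us) / 2 ∧ 0 < P α (R α) - (a - us) * κ (R α) := by
  set G : ℝ → ℝ := fun u => ∫ s in U..u, h s with hG
  have hGd : ∀ u, HasDerivAt G (h u) u := fun u =>
    (H.hcont.integral_hasStrictDerivAt U u).hasDerivAt
  have hGU : G U = 0 := by simp [hG]
  have hhus := H.hpos hUs
  set e := (G us - (a - us)^2/2) / 3 with he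
  have he0 : 0 < e := by have : (a - us) ^ 2 / 2 < G us := hE; rw [he]; linarith
  have hGm : ∀ u, U ≤ u → u ≤ us → 0 ≤ G u ∧ G u ≤ h us * (u - U) ∧ G u ≤ G us := by
    intro u hu1 hu2
    have c := fun s t : ℝ => (continuous_iff_continuousAt.2 fun u => (hGd u).continuousAt).continuousOn (s := Icc s t)
    refine ⟨?_, ?_, ?_⟩
    · have := incr_ge (c := 0) hu1 (c _ _) (fun r _ => hGd r) (fun r hr => H.hnn r)
      rw [hGU] at this; linarith
    · have := incr_le (c := h us) hu1 (c _ _) (fun r _ => hGd r)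
        (fun r hr => H.hmono (hr.2.le.trans hu2))
      rw [hGU] at this; linarith
    · have := incr_ge (c := 0) hu2 (c _ _) (fun r _ => hGd r) (fun r hr => H.hnn r)
      linarith
  set pm := √(2 * G us) with hpm
  have hpm0 : 0 ≤ pm := sqrt_nonneg _
  -- choose M
  obtain ⟨M, hM0, hM1, hM2⟩ : ∃ M : ℝ, 0 < M ∧ pm / M * (us - U) < e ∧
      (a - us)^2/2 * (1 + 1/M)^2 < (a - us)^2/2 + e := by
    have t1 : Tendsto (fun M : ℝ => pm / M * (us - U)) atTop (nhds (0 * (us - U))) :=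
      (tendsto_const_nhds.div_atTop tendsto_id).mul_const _
    have t2 : Tendsto (fun M : ℝ => (a - us)^2/2 * (1 + 1/M)^2) atTop
        (nhds ((a - us)^2/2 * (1 + 0)^2)) :=
      ((tendsto_const_nhds.add (tendsto_const_nhds.div_atTop tendsto_id)).pow 2).const_mul _
    have := (eventually_gt_atTop (0:ℝ)).and ((t1.eventually (gt_mem_nhds (by simpa using he0))).and
      (t2.eventually (gt_mem_nhds (show _ < (a - us)^2/2 + e by rw [add_zero, one_pow, mul_one]; linarith))))
    obtain ⟨M, h⟩ := this.exists
    exact ⟨M, h.1, h.2.1, h.2.2⟩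
  set E := exp ((1 + L) * M)
  set τ := min ((us - U) / 4) (min ((us - U) / 2 / E) (e / 2 / h us / E)) with hτ
  have hE0 : 0 < E := exp_pos _
  have hτ0 : 0 < τ := by
    have : 0 < us - U := by linarith
    positivity
  have hτ1 : τ ≤ (us - U) / 4 := min_le_left _ _
  have hτ2 : τ * E ≤ (us - U) / 2 := by
    rw [← le_div_iff₀ hE0]; exact (min_le_right _ _).trans (min_le_left _ _)
  have hτ3 : h us * (τ * E) ≤ e / 2 := by
    have : τ ≤ e / 2 / h us / E := (min_le_right _ _).trans (min_le_right _ _)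
    rw [le_div_iff₀ hE0, le_div_iff₀ hhus] at this; linarith
  have hα1 : U < U + τ := by linarith
  refine ⟨U + τ, hα1, by linarith, ?_⟩
  set α := U + τ with hα
  obtain ⟨R0, RX⟩ := hR α ⟨hα1, by linarith⟩
  have hXM : X α M - U ≤ τ * E := by
    have := (H.dep α U hM0.le).1
    rw [H.XU hM0.le, hα, add_sub_cancel_left, abs_of_pos hτ0] at this
    exact (le_abs_self _).trans this
  have hMR : M < R α := by
    by_contra hle
    push Not at hle
    have := H.Xmono α R0.le hle
    linarith
  have rX : ∀ r ∈ Icc 0 (R α), U ≤ X α r ∧ X α r ≤ us := fun r hr =>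
    ⟨hα1.le.trans (H.Xge α hr.1), RX ▸ H.Xmono α hr.1 hr.2⟩
  have hXc := H.Xc' α
  have hPc := H.Pc' α
  have hGc : Continuous G := continuous_iff_continuousAt.2 fun u => (hGd u).continuousAt
  have Ed : ∀ r, 0 < r → HasDerivAt (fun r => P α r ^ 2 / 2 - G (X α r)) (-(P α r ^ 2 / r)) r := by
    intro r hr
    convert! (((H.dP α r hr).pow 2).div_const 2).sub ((hGd (X α r)).comp r (H.dX α r hr)) using 1
    simp; field_simp; ring
  have hPb : ∀ r ∈ Icc 0 (R α), P α r ≤ pm := by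
    intro r hr
    have := anti_of_d (s := 0) (t := R α) (f := fun r => P α r ^ 2 / 2 - G (X α r)) (by fun_prop)
      (fun s hs => Ed s hs.1) (fun s hs => by
        have := hs.1
        have : 0 ≤ P α s ^2 / s := by positivity
        linarith) (left_mem_Icc.2 R0.le) hr hr.1
    simp only [H.P0, H.X0] at this
    have g1 := (hGm α hα1.le (by linarith)).1
    have g2 := (hGm _ (rX r hr).1 (rX r hr).2).2.2
    apply le_sqrt_of_sq_le
    linarith
  have fin := mono_of_d (s := M) (t := R α)
    (f := fun r => P α r ^ 2 / 2 - G (X α r) + pm / M * X α r)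
    (f' := fun r => -(P α r ^ 2 / r) + pm / M * P α r) (by fun_prop)
    (fun s hs => (Ed s (hM0.trans hs.1)).add ((H.dX α s (hM0.trans hs.1)).const_mul _))
    (fun s hs => by
      have s0 := hM0.trans hs.1
      have p0 := H.Pnn α s0.le
      have p1 := hPb s ⟨s0.le, hs.2.le⟩
      have : P α s ^2 / s ≤ pm / M * P α s := by
        rw [pow_two, mul_div_right_comm]
        have := hs.1.le
        gcongr
      linarith) (left_mem_Icc.2 hMR.le) (right_mem_Icc.2 hMR.le) hMR.le
  simp only [RX] at fin
  have g3 := (hGm _ (rX M ⟨hM0.le, hMR.le⟩).1 (rX M ⟨hM0.le, hMR.le⟩).2).2.1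
  have g4 : h us * (X α M - U) ≤ h us * (τ * E) := by gcongr
  have g5 : pm / M * us - pm / M * X α M ≤ pm / M * (us - U) := by
    rw [← mul_sub]
    have := (rX M ⟨hM0.le, hMR.le⟩).1
    gcongr
  have k := hκ (R α) R0
  have k1 := kappa_le R0 k.2.1 k.2.2
  have k2 : κ (R α) ≤ 1 + 1 / M := k1.trans (by gcongr)
  have k3 : (a - us)^2 / 2 * κ (R α) ^ 2 ≤ (a - us)^2/2 * (1 + 1/M)^2 := by
    have := k.2.1
    gcongr
  have p2 := sq_nonneg (P α M)
  have : ((a - us) * κ (R α))^2 < P α (R α) ^2 := by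
    have : G us = 3 * e + (a - us)^2/2 := by rw [he]; ring
    rw [mul_pow]; linarith
  have := lt_of_pow_lt_pow_left₀ 2 (H.Pnn α R0.le) this
  linarith

lemma RF.high (H : RF h L U X P) {us a : ℝ} (hUs : U < us) (hsa : us < a) {κ : ℝ → ℝ} {R : ℝ → ℝ}
    (hκ : ∀ r, 0 < r → 1 ≤ κ r)
    (hR : ∀ α, α ∈ Ioo U us → 0 < R α ∧ X α (R α) = us) :
    ∃ α, (U + us) / 2 ≤ α ∧ α < us ∧ P α (R α) - (a - us) * κ (R α) < 0 := by
  have hhm : 0 < h ((U + us)/2) := H.hpos (by linarith)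
  have hhus := H.hpos hUs
  set τ := min ((us - U) / 2) ((a - us)^2 * h ((U+us)/2) / (2 * h us ^2)) with hτ
  have hsa' : 0 < a - us := by linarith
  have hτ0 : 0 < τ := by have : 0 < us - U := by linarith
                         positivity
  have hτ1 : τ ≤ (us - U) / 2 := min_le_left _ _
  have hτ2 : τ * (2 * h us ^ 2) ≤ (a - us)^2 * h ((U+us)/2) := by
    rw [← le_div_iff₀ (by positivity)]; exact min_le_right _ _
  have hm : (U + us) / 2 ≤ us - τ := by linarith
  refine ⟨us - τ, hm, by linarith, ?_⟩
  obtain ⟨R0, RX⟩ := hR (us - τ) ⟨by linarith, by linarith⟩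
  have k := hκ _ R0
  have k1 := H.Ple (us - τ) R0.le
  have k2 := H.Xge2 (us - τ) R0.le
  rw [RX] at k1 k2
  have k3 := H.hmono hm
  have k4 : (h us * R (us - τ) / 2)^2 < (a - us)^2 := by
    have k5 : h ((U+us)/2) * R (us - τ)^2 ≤ 4 * τ := by nlinarith [sq_nonneg (R (us - τ))]
    have k6 : h us ^ 2 * (h ((U+us)/2) * R (us - τ)^2) ≤ h us ^ 2 * (4 * τ) := by gcongr
    have : h ((U+us)/2) * (h us * R (us - τ) / 2)^2 < h ((U+us)/2) * (a - us)^2 := by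
      have : 0 < h ((U+us)/2) * (a - us)^2 := by positivity
      linarith
    exact lt_of_mul_lt_mul_left this hhm.le
  have := lt_of_pow_lt_pow_left₀ 2 hsa'.le k4
  nlinarith

theorem RF.main (H : RF h L U X P) {us a : ℝ} (hUs : U < us) (hsa : us < a) {κ : ℝ → ℝ}
    (hκ : ∀ r, 0 < r → HasDerivAt κ (κ r ^ 2 - 1 - κ r / r) r ∧ 1 ≤ κ r ∧
      κ r ^ 2 - 1 - κ r / r ≤ 0)
    (hE : (a - us) ^ 2 / 2 < ∫ s in U..us, h s) :
    ∃ αI c0 cD LR Rm RM : ℝ, ∃ R : ℝ → ℝ, 0 < c0 ∧ 0 < cD ∧ 0 < LR ∧ 0 < Rm ∧ U < αI - c0 ∧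
      αI + c0 < us ∧ ∀ α ∈ Icc (αI - c0) (αI + c0), Rm ≤ R α ∧ R α ≤ RM ∧ X α (R α) = us ∧
        |R α - R αI| ≤ LR * |α - αI| ∧
        (α ≤ αI → cD * (αI - α) ≤ P α (R α) - (a - us) * κ (R α)) ∧
        (αI ≤ α → P α (R α) - (a - us) * κ (R α) ≤ - (cD * (α - αI))) := by
  choose R hR using H.hit (us := us)
  obtain ⟨α₁, h1, h1m, hD1⟩ := H.low hUs hsa hκ hR hE
  obtain ⟨α₂, h2m, h2, hD2⟩ := H.high hUs hsa (fun r hr => (hκ r hr).2.1) hR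
  have h12 : α₁ ≤ α₂ := by linarith
  obtain ⟨αI, hI1, hI2, hID⟩ : ∃ αI, U < αI ∧ αI < us ∧
      P αI (R αI) - (a - us) * κ (R αI) = 0 := by
    obtain ⟨LR, Rm, RM, hLR, hRm, hb⟩ := H.Rlip hR h1 h12 h2
    have hRc : ContinuousOn R (Icc α₁ α₂) := by
      have : LipschitzOnWith (Real.toNNReal LR) R (Icc α₁ α₂) :=
        LipschitzOnWith.of_dist_le_mul fun x hx y hy => by
          rw [Real.dist_eq, Real.dist_eq, Real.coe_toNNReal LR hLR.le]
          exact (hb x hx).2.2 y hy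
      exact this.continuousOn
    have hPc : ContinuousOn (fun α => P α (R α)) (Icc α₁ α₂) :=
      H.Pc.comp_continuousOn (f := fun α => (α, R α)) (continuousOn_id.prodMk hRc)
    have hκc : ContinuousOn (fun α => κ (R α)) (Icc α₁ α₂) := fun α hα =>
      ((hκ (R α) (hRm.trans_le (hb α hα).1)).1.continuousAt).comp_continuousWithinAt (hRc α hα)
    have := intermediate_value_Icc' h12 (hPc.sub (continuousOn_const.mul hκc))
      (⟨hD2.le, hD1.le⟩ : (0:ℝ) ∈ Icc _ _)
    obtain ⟨αI, hm, he⟩ := this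
    exact ⟨αI, h1.trans_le hm.1, hm.2.trans_lt h2, he⟩
  set c0 := min (αI - U) (us - αI) / 2 with hc0
  have hm0 : 0 < min (αI - U) (us - αI) := lt_min (by linarith) (by linarith)
  have hc1 : 2 * c0 ≤ αI - U := by rw [hc0]; linarith [min_le_left (αI - U) (us - αI)]
  have hc2 : 2 * c0 ≤ us - αI := by rw [hc0]; linarith [min_le_right (αI - U) (us - αI)]
  have hcp : 0 < c0 := by rw [hc0]; linarith
  obtain ⟨LR, Rm, RM, hLR, hRm, hb⟩ := H.Rlip hR (α₁ := αI - c0) (α₂ := αI + c0) (by linarith)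
    (by linarith) (by linarith)
  have hImem : αI ∈ Icc (αI - c0) (αI + c0) := ⟨by linarith, by linarith⟩
  have hRM : 0 < RM := hRm.trans_le ((hb αI hImem).1.trans (hb αI hImem).2.1)
  have hL := H.L0
  have hhus := H.hpos hUs
  have hh1 : 0 < h (αI - c0) := H.hpos (by linarith)
  set cD := h (αI - c0) / (8 * (3 + L * RM ^ 2)) * (2 / (h us * RM)) with hcD
  have hcD0 : 0 < cD := by positivity
  have key : ∀ α ∈ Icc (αI - c0) (αI + c0), ∀ α' ∈ Icc (αI - c0) (αI + c0), α < α' →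
      cD * (α' - α) ≤ (P α (R α) - (a - us) * κ (R α)) - (P α' (R α') - (a - us) * κ (R α')) := by
    intro α hα α' hα' hlt
    obtain ⟨r0, rX⟩ := hR α ⟨by linarith [hα.1], by linarith [hα.2]⟩
    obtain ⟨s0, sX⟩ := hR α' ⟨by linarith [hα'.1], by linarith [hα'.2]⟩
    obtain ⟨q1, q2, q3⟩ := H.rate (us := us) (by linarith [hα.1]) hlt r0 s0 rX sX
    have q4 := kappa_anti hκ s0 q1.le
    have q5 := H.hmono hα.1
    have q6 := (hb α' hα').2.1
    have q6' := (hb α hα).2.1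
    have hd : 0 < R α - R α' := by linarith
    have q7 : α' - α ≤ h us * RM / 2 * (R α - R α') := q2.trans (by gcongr)
    have q5' := H.hnn α
    have q55 : 0 ≤ (R α - R α') * h α := mul_nonneg hd.le q5'
    have q8 : (R α - R α') * h (αI - c0) / (8 * (3 + L * RM ^ 2)) ≤
        (R α - R α') * h α / (8 * (3 + L * R α' ^ 2)) := by gcongr
    have q9 : cD * (α' - α) ≤ cD * (h us * RM / 2 * (R α - R α')) := by gcongr
    have q10 : cD * (h us * RM / 2 * (R α - R α')) =
        (R α - R α') * h (αI - c0) / (8 * (3 + L * RM ^ 2)) := by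
      rw [hcD]; field_simp
    have q11 : (a - us) * κ (R α) ≤ (a - us) * κ (R α') := by
      apply mul_le_mul_of_nonneg_left q4; linarith
    linarith
  refine ⟨αI, c0, cD, LR, Rm, RM, R, hcp, hcD0, hLR, hRm, by linarith, by linarith,
    fun α hα => ⟨(hb α hα).1, (hb α hα).2.1, (hR α ⟨by linarith [hα.1], by linarith [hα.2]⟩).2,
      (hb α hα).2.2 αI hImem, fun hle => ?_, fun hle => ?_⟩⟩
  · rcases hle.eq_or_lt with e | e
    · rw [e, hID]; simp
    · have := key α hα αI hImem e; linarith
  · rcases hle.eq_or_lt with e | e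
    · rw [← e, hID]; simp
    · have := key αI hImem α hα e; linarith
end


structure Par (a m b U cV CV L : ℝ) (V V1 V2 h : ℝ → ℝ) (X P : ℝ → ℝ → ℝ) : Prop where
  a0 : 0 < a
  m0 : 0 < m
  b0 : 0 < b
  U0 : 0 < U
  Uus : U < 9 * b * m / 2
  usa : 9 * b * m / 2 < a
  cV0 : 0 < cV
  CV0 : 0 < CV
  dV : ∀ u, U ≤ u → HasDerivAt V (V1 u) u
  dV1 : ∀ u, U ≤ u → HasDerivAt V1 (V2 u) u
  V1b : ∀ u, U ≤ u → |V1 u| ≤ CV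
  V2b : ∀ u, U ≤ u → |V2 u| ≤ CV
  Veq : ∀ u, U ≤ u → u * V u * (1 - b * V u) = m
  Vlo : ∀ u, U ≤ u → 1 / (2 * b) + cV ≤ V u
  Vhi : ∀ u, U ≤ u → V u ≤ 1 / b
  Vus : V (9 * b * m / 2) = 2 / (3 * b)
  hU : ∀ u, U ≤ u → h u = u + u * V u ^ 2 - a
  rf : RF h L U X P
  hE : (a - 9 * b * m / 2) ^ 2 / 2 < ∫ s in U..(9 * b * m / 2), h s

lemma root_facts (a m b : ℝ) (ha : 0 < a) (hm : 0 < m) (hb : 0 < b)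
    (hp1 : max (9*b/2) (4*b + 1/b) < a/m) (hp2 : a/m < 9*b/2 + 2/b) (V₂ : ℝ)
    (hV₂ : V₂ = (a/m + √((a/m)^2 - 4*(1 + a*b/m))) / (2*(1 + a*b/m))) (U₂ : ℝ)
    (hU₂ : U₂ = m*(a/m - V₂/(1-b*V₂))) :
    1 / (2*b) < V₂ ∧ V₂ < 2/(3*b) ∧ U₂ * V₂ * (1 - b * V₂) = m ∧ U₂ + U₂ * V₂^2 = a ∧
      9*b*m/2 < a := by
  obtain ⟨A, hA⟩ : ∃ A, A = a / m := ⟨_, rfl⟩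
  have haA : a = A * m := by rw [hA]; field_simp
  have hAb : a * b / m = A * b := by rw [hA]; ring
  rw [hAb, ← hA] at hV₂
  rw [← hA] at hp1 hp2 hU₂
  have hA0 : 0 < A := by rw [hA]; positivity
  have h1 := (le_max_left _ _).trans_lt hp1
  have h2 := (le_max_right _ _).trans_lt hp1
  have h3 : 4 * b ^ 2 + 1 < A * b := by
    have := mul_lt_mul_of_pos_right h2 hb
    have e : (4 * b + 1 / b) * b = 4 * b ^ 2 + 1 := by field_simp
    linarith
  have h4 : 2 * (A * b) < 9 * b ^ 2 + 4 := by
    have := mul_lt_mul_of_pos_right hp2 hb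
    have e : (9 * b / 2 + 2 / b) * b = 9 * b ^ 2 / 2 + 2 := by field_simp
    linarith
  have hD : 0 < A ^ 2 - 4 * (1 + A * b) := by
    have : 4 < A * (A - 4 * b) := by
      have k : 1 < (A - 4 * b) * b := by linarith
      have k2 : 4 * b < A := sub_pos.1 ((mul_pos_iff_of_pos_right hb).1 (by linarith))
      linarith [mul_pos (sub_pos.2 k2) (sub_pos.2 k2)]
    linarith
  have hV0 : 0 < V₂ := by rw [hV₂]; positivity
  have hq : (1 + A * b) * V₂ ^ 2 - A * V₂ + 1 = 0 := by
    have hs := sq_sqrt hD.le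
    have hne : (1 + A * b) ≠ 0 := by positivity
    have : (2 * (1 + A * b) * V₂ - A) ^ 2 = A ^ 2 - 4 * (1 + A * b) := by
      rw [← hs, hV₂]; field_simp; ring
    have h4 : 4 * (1 + A * b) * ((1 + A * b) * V₂ ^ 2 - A * V₂ + 1) = 0 := by linarith
    rcases mul_eq_zero.1 h4 with h | h
    · exact absurd h (by positivity)
    · exact h
  have hvert : A < 2 * (1 + A * b) * V₂ := by
    rw [hV₂]
    have := sqrt_pos.2 hD
    have hne : (1 + A * b) ≠ 0 := by positivity
    have e : 2 * (1 + A * b) * ((A + √(A ^ 2 - 4 * (1 + A * b))) / (2 * (1 + A * b))) =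
        A + √(A ^ 2 - 4 * (1 + A * b)) := by
      rw [mul_div_cancel₀]; positivity
    rw [e]; linarith
  have hAb0 : 0 < A * b := by positivity
  obtain ⟨w, hw⟩ : ∃ w, w = b * V₂ := ⟨_, rfl⟩
  have hw0 : 0 < w := by rw [hw]; positivity
  have hqw : (1 + A * b) * w ^ 2 - A * b * w + b ^ 2 = 0 := by
    rw [hw]; linear_combination b ^ 2 * hq
  have hvw : A * b < 2 * (1 + A * b) * w := by
    rw [hw]; linarith [mul_lt_mul_of_pos_right hvert hb]
  have w1 : 1 / 2 < w := by
    by_contra hc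
    push Not at hc
    nlinarith [mul_nonneg (sub_nonneg.2 hc) (sub_pos.2 hvw).le]
  have w2 : w < 2 / 3 := by
    by_contra hc
    push Not at hc
    -- quadratic at 2/3 positive and vertex left of 2/3
    have k : (0:ℝ) ≤ (1 + A * b) * (w + 2/3) - A * b := by
      have : (1 + A * b) * (4 / 3) ≤ (1 + A * b) * (w + 2/3) := by
        apply mul_le_mul_of_nonneg_left _ (by positivity); linarith
      linarith
    have k2 := mul_nonneg (sub_nonneg.2 hc) k
    have e : (w - 2/3) * ((1 + A * b) * (w + 2/3) - A * b) =
      ((1 + A * b) * w ^ 2 - A * b * w + b ^ 2) - (4 - 2 * (A * b) + 9 * b ^ 2) / 9 := by ring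
    linarith
  have hone : 0 < 1 - w := by linarith
  have hUm : U₂ * V₂ * (1 - w) = m := by
    rw [hU₂, ← hw]
    have e : m * (A - V₂ / (1 - w)) * V₂ * (1 - w) = m * (A * V₂ * (1 - w) - V₂ ^ 2) := by
      field_simp
    rw [e, hw]; linear_combination (-m) * hq
  refine ⟨?_, ?_, by rw [← hw]; exact hUm, ?_, ?_⟩
  · rw [div_lt_iff₀ (by positivity)]; linarith
  · rw [lt_div_iff₀ (by positivity)]; linarith
  · have : (U₂ + U₂ * V₂ ^ 2) * (V₂ * (1 - w)) = a * (V₂ * (1 - w)) := by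
      have : (U₂ + U₂ * V₂ ^ 2) * (V₂ * (1 - w)) = (1 + V₂ ^ 2) * m := by rw [← hUm]; ring
      rw [this, haA, hw]; linear_combination m * hq
    exact mul_right_cancel₀ (by positivity) this
  · rw [haA]; linarith [mul_lt_mul_of_pos_right h1 hm]

lemma par_exists (a m b : ℝ) (ha : 0 < a) (hm : 0 < m) (hb : 0 < b)
    (hp1 : max (9*b/2) (4*b + 1/b) < a/m) (hp2 : a/m < 9*b/2 + 2/b) (V₂ : ℝ)
    (hV₂ : V₂ = (a/m + √((a/m)^2 - 4*(1 + a*b/m))) / (2*(1 + a*b/m))) (U₂ : ℝ)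
    (hU₂ : U₂ = m*(a/m - V₂/(1-b*V₂)))
    (hcond : (1/2)*(a-U₂)^2 < ∫ s in U₂..(9*b*m/2), (s - 2*m*b + √(s^2 - 4*s*m*b))/(2*b^2)) :
    ∃ cV CV L V V1 V2 h X P, Par a m b U₂ cV CV L V V1 V2 h X P := by
  obtain ⟨r1, r2, r3, r4, r5⟩ := root_facts a m b ha hm hb hp1 hp2 V₂ hV₂ U₂ hU₂
  have hV0 : 0 < V₂ := lt_trans (by positivity) r1
  have w1 : 1 < 2 * b * V₂ := by
    rw [div_lt_iff₀ (by positivity)] at r1; linarith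
  have w2 : 3 * b * V₂ < 2 := by
    rw [lt_div_iff₀ (by positivity)] at r2; linarith
  have hw : 0 < 1 - b * V₂ := by linarith
  have hU0 : 0 < U₂ := by
    by_contra hc
    push Not at hc
    have := mul_nonneg (mul_nonneg (neg_nonneg.2 hc) hV0.le) hw.le
    linarith
  obtain ⟨s, hs⟩ : ∃ s : ℝ → ℝ, s = fun u => √(1 - 4 * m * b / u) := ⟨_, rfl⟩
  have hsU : s U₂ = 2 * b * V₂ - 1 := by
    rw [hs]
    have : 1 - 4 * m * b / U₂ = (2 * b * V₂ - 1) ^ 2 := by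
      rw [← r3]; field_simp; ring
    simp only [this]
    exact sqrt_sq (by linarith)
  obtain ⟨s0, hs0⟩ : ∃ s0, s0 = s U₂ := ⟨_, rfl⟩
  have hs0p : 0 < s0 := by rw [hs0, hsU]; linarith
  have ssq : ∀ u, U₂ ≤ u → s u ^ 2 = 1 - 4 * m * b / u ∧ s0 ≤ s u ∧ s u ≤ 1 := by
    intro u hu
    have hle : 1 - 4 * m * b / U₂ ≤ 1 - 4 * m * b / u := by
      gcongr
    have h0 : 0 ≤ 1 - 4 * m * b / U₂ := by
      by_contra hc
      have : s U₂ = 0 := by rw [hs]; exact sqrt_eq_zero_of_nonpos (by linarith)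
      linarith
    have hu0 : 0 < u := hU0.trans_le hu
    refine ⟨by rw [hs]; exact sq_sqrt (h0.trans hle), by rw [hs0, hs]; exact sqrt_le_sqrt hle, ?_⟩
    rw [hs]; simp only; rw [sqrt_le_one]
    have : 0 < 4 * m * b / u := by positivity
    linarith
  have sder : ∀ u, U₂ ≤ u → HasDerivAt s (2 * m * b / (u ^ 2 * s u)) u := by
    intro u hu
    have hu0 : 0 < u := hU0.trans_le hu
    have ⟨h1, h2, h3⟩ := ssq u hu
    have hsp : 0 < s u := hs0p.trans_le h2
    have hne : 1 - 4 * m * b / u ≠ 0 := by rw [← h1]; positivity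
    have hd : HasDerivAt (fun u => 1 - 4 * m * b / u) (4 * m * b / u ^ 2) u := by
      convert! ((hasDerivAt_inv hu0.ne').const_mul (4 * m * b)).const_sub 1 using 1
      field_simp
    have := hd.sqrt hne
    convert! this using 1
    have e : √(1 - 4 * m * b / u) = s u := by rw [hs]
    rw [e]; field_simp; ring
  obtain ⟨V, hV⟩ : ∃ V : ℝ → ℝ, V = fun u => (1 + s u) / (2 * b) := ⟨_, rfl⟩
  obtain ⟨V1, hV1⟩ : ∃ V : ℝ → ℝ, V = fun u => m / (u ^ 2 * s u) := ⟨_, rfl⟩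
  obtain ⟨W2, hW2⟩ : ∃ V : ℝ → ℝ, V = fun u => -(m * (2 * u * s u + 2 * m * b / s u)) /
    (u ^ 2 * s u) ^ 2 := ⟨_, rfl⟩
  have dV : ∀ u, U₂ ≤ u → HasDerivAt V (V1 u) u := by
    intro u hu
    have hu0 : 0 < u := hU0.trans_le hu
    have hsp : 0 < s u := hs0p.trans_le (ssq u hu).2.1
    rw [hV, hV1]
    convert! ((sder u hu).const_add 1).div_const (2 * b) using 1
    field_simp
  have dV1 : ∀ u, U₂ ≤ u → HasDerivAt V1 (W2 u) u := by
    intro u hu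
    have hu0 : 0 < u := hU0.trans_le hu
    have hsp : 0 < s u := hs0p.trans_le (ssq u hu).2.1
    rw [hV1, hW2]
    convert! (hasDerivAt_const u m).div (((hasDerivAt_id u).pow 2).mul (sder u hu)) ?_ using 1
    · simp; field_simp
    · simp; constructor <;> positivity
  have hVsq : ∀ u, U₂ ≤ u → u * V u ^ 2 = (u - 2 * m * b + u * s u) / (2 * b ^ 2) := by
    intro u hu
    have hu0 : 0 < u := hU0.trans_le hu
    have h1 := (ssq u hu).1
    have h2 : u * s u ^ 2 = u - 4 * m * b := by rw [h1]; field_simp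
    rw [hV]; field_simp; linear_combination h2
  obtain ⟨hh, hhh⟩ : ∃ f : ℝ → ℝ, f = fun u => u + u * V u ^ 2 - a := ⟨_, rfl⟩
  have dh : ∀ u, U₂ ≤ u → HasDerivAt hh (1 + (V u ^ 2 + u * (2 * V u * V1 u))) u := by
    intro u hu
    rw [hhh]
    convert! ((hasDerivAt_id u).add ((hasDerivAt_id u).mul ((dV u hu).pow 2))).sub_const a using 1
    simp
  have Vb : ∀ u, U₂ ≤ u → V₂ ≤ V u ∧ V u ≤ 1 / b := by
    intro u hu
    have ⟨h1, h2, h3⟩ := ssq u hu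
    rw [hs0, hsU] at h2
    rw [hV]; constructor
    · simp only; rw [le_div_iff₀ (by positivity)]; linarith
    · simp only; rw [div_le_div_iff₀ (by positivity) hb]; nlinarith
  have V1pos : ∀ u, U₂ ≤ u → 0 < V1 u ∧ V1 u ≤ m / (U₂ ^ 2 * s0) ∧ u * V1 u ≤ m / (U₂ * s0) := by
    intro u hu
    have hu0 : 0 < u := hU0.trans_le hu
    have h2 := (ssq u hu).2.1
    have hsp : 0 < s u := hs0p.trans_le h2
    rw [hV1]
    refine ⟨by positivity, by simp only; gcongr, ?_⟩
    have : u * (m / (u ^ 2 * s u)) = m / (u * s u) := by field_simp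
    simp only [this]; gcongr
  obtain ⟨L, hL⟩ : ∃ L, L = 1 + (1 / b) ^ 2 + 2 * (1 / b) * (m / (U₂ * s0)) := ⟨_, rfl⟩
  have hL0 : 0 ≤ L := by rw [hL]; positivity
  have hder : ∀ u, U₂ ≤ u → 1 ≤ 1 + (V u ^ 2 + u * (2 * V u * V1 u)) ∧
      1 + (V u ^ 2 + u * (2 * V u * V1 u)) ≤ L := by
    intro u hu
    have hu0 : 0 < u := hU0.trans_le hu
    obtain ⟨k1, k2⟩ := Vb u hu
    have k0 : 0 < V u := hV0.trans_le k1
    obtain ⟨k3, k4, k5⟩ := V1pos u hu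
    constructor
    · have : 0 ≤ V u ^ 2 + u * (2 * V u * V1 u) := by positivity
      linarith
    · rw [hL]
      have e1 : V u ^ 2 ≤ (1 / b) ^ 2 := by gcongr
      have e2 : 2 * V u * (u * V1 u) ≤ 2 * (1 / b) * (m / (U₂ * s0)) := by gcongr
      linarith
  have hinc : ∀ z y, U₂ ≤ z → z ≤ y → y - z ≤ hh y - hh z ∧ hh y - hh z ≤ L * (y - z) := by
    intro z y hz hzy
    have hc : ContinuousOn hh (Icc z y) := fun u hu =>
      (dh u (hz.trans hu.1)).continuousAt.continuousWithinAt
    have k1 := incr_ge (c := 1) hzy hc (fun u hu => dh u (hz.trans hu.1.le))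
      (fun u hu => (hder u (hz.trans hu.1.le)).1)
    have k2 := incr_le (c := L) hzy hc (fun u hu => dh u (hz.trans hu.1.le))
      (fun u hu => (hder u (hz.trans hu.1.le)).2)
    exact ⟨by linarith, k2⟩
  have hVU : V U₂ = V₂ := by rw [hV]; simp only; rw [hsU]; field_simp; ring
  have hhU : hh U₂ = 0 := by rw [hhh]; simp only; rw [hVU]; linarith
  obtain ⟨h, hhdef⟩ : ∃ h : ℝ → ℝ, h = fun u => hh (max u U₂) := ⟨_, rfl⟩
  have hUus : U₂ < 9 * b * m / 2 := by
    have : 0 < 9 / 2 * (b * V₂) * (1 - b * V₂) - 1 := by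
      linarith [mul_pos (show 0 < 3 * b * V₂ - 1 by linarith) (show 0 < 2 - 3 * b * V₂ by linarith)]
    have e : V₂ * (1 - b * V₂) * (9 * b * m / 2 - U₂) = m * (9 / 2 * (b * V₂) * (1 - b * V₂) - 1) := by
      linear_combination -r3
    by_contra hc
    push Not at hc
    have h1 : 0 < m * (9 / 2 * (b * V₂) * (1 - b * V₂) - 1) := by positivity
    have h2 : 0 ≤ V₂ * (1 - b * V₂) * (U₂ - 9 * b * m / 2) :=
      mul_nonneg (by positivity) (by linarith)
    linarith
  obtain ⟨X, P, hRF⟩ := RF.exists h L U₂ hL0 (by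
    have : ∀ y z, z ≤ y → |h y - h z| ≤ L * |y - z| := by
      intro y z hzy
      have hm1 : max z U₂ ≤ max y U₂ := max_le_max hzy le_rfl
      obtain ⟨k1, k2⟩ := hinc _ _ (le_max_right z U₂) hm1
      rw [hhdef]; simp only
      rw [abs_of_nonneg (by linarith), abs_of_nonneg (by linarith : 0 ≤ y - z)]
      have : max y U₂ - max z U₂ ≤ y - z := by
        rcases le_total y U₂ with h | h <;> rcases le_total z U₂ with h' | h' <;>
          simp [h, h'] <;> linarith
      exact k2.trans (by gcongr)
    intro y z
    rcases le_total z y with h' | h'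
    · exact this y z h'
    · rw [abs_sub_comm, abs_sub_comm y]; exact this z y h')
    (fun z y hz hzy => by
      rw [hhdef]; simp only; rw [max_eq_left hz, max_eq_left (hz.trans hzy)]
      exact (hinc z y hz hzy).1)
    (fun u hu => by rw [hhdef]; simp only; rw [max_eq_right hu, hhU])
  refine ⟨V₂ - 1 / (2 * b), m / (U₂ ^ 2 * s0) + m * (2 / (U₂ ^ 3 * s0) + 2 * m * b / (U₂ ^ 4 * s0 ^ 3)),
    L, V, V1, W2, h, X, P, ha, hm, hb, hU0, hUus, r5, by linarith, by positivity, dV, dV1, ?_, ?_, ?_,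
    ?_, fun u hu => (Vb u hu).2, ?_, ?_, hRF, ?_⟩
  · intro u hu
    obtain ⟨k3, k4, -⟩ := V1pos u hu
    rw [abs_of_pos k3]
    have : 0 < m * (2 / (U₂ ^ 3 * s0) + 2 * m * b / (U₂ ^ 4 * s0 ^ 3)) := by positivity
    linarith
  · intro u hu
    have hu0 : 0 < u := hU0.trans_le hu
    have h2 := (ssq u hu).2.1
    have hsp : 0 < s u := hs0p.trans_le h2
    have e : W2 u = -(m * (2 / (u ^ 3 * s u) + 2 * m * b / (u ^ 4 * s u ^ 3))) := by
      rw [hW2]; field_simp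
    rw [e, abs_neg, abs_of_pos (by positivity)]
    have : 0 < m / (U₂ ^ 2 * s0) := by positivity
    have : m * (2 / (u ^ 3 * s u) + 2 * m * b / (u ^ 4 * s u ^ 3)) ≤
      m * (2 / (U₂ ^ 3 * s0) + 2 * m * b / (U₂ ^ 4 * s0 ^ 3)) := by gcongr
    linarith
  · intro u hu
    have hu0 : 0 < u := hU0.trans_le hu
    have h1 := (ssq u hu).1
    have h2 : u * s u ^ 2 = u - 4 * m * b := by rw [h1]; field_simp
    rw [hV]; field_simp; linear_combination -h2
  · intro u hu
    have := (Vb u hu).1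
    linarith
  · have h1 := (ssq _ hUus.le).1
    have h2 := (ssq _ hUus.le).2.1
    have e : 1 - 4 * m * b / (9 * b * m / 2) = (1 / 3) ^ 2 := by field_simp; norm_num
    rw [e] at h1
    have : s (9 * b * m / 2) = 1 / 3 := by
      rwa [sq_eq_sq₀ (by linarith) (by norm_num)] at h1
    rw [hV]; simp only; rw [this]; field_simp; norm_num
  · intro u hu
    rw [hhdef]; simp only; rw [max_eq_left hu, hhh]
  · have e1 : ∫ s in U₂..(9 * b * m / 2), h s = ∫ x in U₂..(9 * b * m / 2),
        ((x - a) + (x - 2*m*b + √(x^2 - 4*x*m*b))/(2*b^2)) := by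
      apply intervalIntegral.integral_congr
      intro x hx
      rw [uIcc_of_le hUus.le] at hx
      have hx0 : 0 < x := hU0.trans_le hx.1
      rw [hhdef]; simp only; rw [max_eq_left hx.1, hhh]; simp only
      rw [hVsq x hx.1]
      have : √(x^2 - 4*x*m*b) = x * s x := by
        have : x^2 - 4*x*m*b = (x * s x) ^ 2 := by
          rw [mul_pow, (ssq x hx.1).1]; field_simp
        rw [this]; exact sqrt_sq (mul_nonneg hx0.le (hs0p.le.trans (ssq x hx.1).2.1))
      rw [this]; ring
    rw [e1, intervalIntegral.integral_add (Continuous.intervalIntegrable (by fun_prop) _ _)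
      (Continuous.intervalIntegrable (by fun_prop) _ _)]
    have e2 : ∫ x in U₂..(9 * b * m / 2), (x - a) = ((9 * b * m / 2 - a) ^ 2 - (U₂ - a) ^ 2) / 2 := by
      rw [intervalIntegral.integral_sub (Continuous.intervalIntegrable (by fun_prop) _ _)
        (Continuous.intervalIntegrable (by fun_prop) _ _)]
      simp; ring
    rw [e2]; linarith only [hcond, sq_abs (U₂ - a)]


def cl (M x : ℝ) : ℝ := max 0 (min M x)
lemma cl_eq {M x : ℝ} (h0 : 0 ≤ x) (h1 : x ≤ M) : cl M x = x := by
  rw [cl, min_eq_right h1, max_eq_right h0]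

structure Tj (a m b δ : ℝ) (u p v q : ℝ → ℝ) : Prop where
  p0 : p 0 = 0
  q0 : q 0 = 0
  uc : Continuous u
  pc : Continuous p
  vc : Continuous v
  qc : Continuous q
  du : ∀ r, 0 < r → HasDerivAt u (p r) r
  dp : ∀ r, 0 < r → HasDerivAt p (u r - a + cl a (u r) * cl (1 / b) (v r) ^ 2 - p r / r) r
  dv : ∀ r, 0 < r → HasDerivAt v (q r / δ) r
  dq : ∀ r, 0 < r → HasDerivAt q ((m * cl (1 / b) (v r) -
    cl a (u r) * cl (1 / b) (v r) ^ 2 * (1 - b * cl (1 / b) (v r))) / δ - q r / r) r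

noncomputable def Gf (m b v u : ℝ) : ℝ := m * v ^ 2 / 2 - u * v ^ 3 / 3 + b * u * v ^ 4 / 4

lemma sinh_le_mul_cosh' {x : ℝ} (hx : 0 ≤ x) : sinh x ≤ x * cosh x := by
  have hm := mono_of_d (f := fun x => x * cosh x - sinh x) (f' := fun x => x * sinh x)
    (s := 0) (t := x) (by fun_prop) (fun r hr => by
      convert! ((hasDerivAt_id r).mul (Real.hasDerivAt_cosh r)).sub (Real.hasDerivAt_sinh r) using 1
      simp) (fun r hr => mul_nonneg hr.1.le (Real.sinh_nonneg_iff.2 hr.1.le))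
  have := hm (left_mem_Icc.2 hx) (right_mem_Icc.2 hx) hx
  simp at this; linarith

section
variable {a m b U cV CV L : ℝ} {V V1 V2 h : ℝ → ℝ} {X P : ℝ → ℝ → ℝ}

/-- comparison with the cosh barrier -/
lemma barrier {c1 C A B k δ T : ℝ} {e ep f cc : ℝ → ℝ} (hc1 : 0 < c1) (hC : 0 < C)
    (hA : A = C / c1) (hk : 0 < k) (hk2 : 2 * k ^ 2 = c1) (hδ : 0 < δ) (hB : 0 ≤ B)
    (he : Rad e ep (fun r => cc r * e r / δ ^ 2 + f r) 0 T)
    (hcc : ∀ r ∈ Icc 0 T, c1 ≤ cc r) (hf : ∀ r ∈ Icc 0 T, |f r| ≤ C) (heT : e T ≤ B) :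
    ∀ r ∈ Icc 0 T, e r ≤ A * δ ^ 2 + B * cosh (k * r / δ) / cosh (k * T / δ) := by
  have hA0 : 0 < A := by rw [hA]; positivity
  obtain ⟨D, hD⟩ : ∃ D, D = cosh (k * T / δ) := ⟨_, rfl⟩
  have hD0 : 0 < D := by rw [hD]; exact cosh_pos _
  rw [← hD]
  have hR : Rad (fun r => e r - (A * δ ^ 2 + B * cosh (k * r / δ) / D))
      (fun r => ep r - B * (k / δ * sinh (k * r / δ)) / D)
      (fun r => (cc r * e r / δ ^ 2 + f r) - B / D * ((k / δ) ^ 2 * cosh (k * r / δ) +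
        k / δ * sinh (k * r / δ) / r)) 0 T := by
    refine ⟨he.1.sub (by fun_prop), he.2.1.sub (by fun_prop), fun r hr => ⟨?_, ?_⟩⟩
    · have h1 : HasDerivAt (fun r => k * r / δ) (k / δ) r := by
        convert! ((hasDerivAt_id r).const_mul k).div_const δ using 1; simp
      convert! (he.2.2 r hr).1.sub (((h1.cosh.const_mul B).div_const D).const_add (A * δ ^ 2)) using 1
      ring
    · have h1 : HasDerivAt (fun r => k * r / δ) (k / δ) r := by
        convert! ((hasDerivAt_id r).const_mul k).div_const δ using 1; simp
      convert! (he.2.2 r hr).2.sub (((h1.sinh.const_mul (k / δ)).const_mul B).div_const D) using 1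
      ring
  intro r hr
  have := hR.max_principle le_rfl (fun r hr hx => by
    have hx' : A * δ ^ 2 + B * cosh (k * r / δ) / D < e r := by linarith
    have h1 := sinh_le_mul_cosh' (x := k * r / δ) (by have := hr.1; positivity)
    have h2 : k / δ * sinh (k * r / δ) / r ≤ (k / δ) ^ 2 * cosh (k * r / δ) := by
      have hr0 := hr.1
      rw [div_le_iff₀ hr0]
      calc k / δ * sinh (k * r / δ) ≤ k / δ * (k * r / δ * cosh (k * r / δ)) := by gcongr
        _ = _ := by ring
    have h3 : B / D * ((k / δ) ^ 2 * cosh (k * r / δ) + k / δ * sinh (k * r / δ) / r) ≤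
        B / D * (2 * ((k / δ) ^ 2 * cosh (k * r / δ))) := by
      apply mul_le_mul_of_nonneg_left _ (by positivity); linarith
    have h4 : B / D * (2 * ((k / δ) ^ 2 * cosh (k * r / δ))) =
        c1 * (B * cosh (k * r / δ) / D) / δ ^ 2 := by rw [← hk2]; field_simp
    have h5 := hcc r (Ioo_subset_Icc_self hr)
    have h6 := abs_le.1 (hf r (Ioo_subset_Icc_self hr))
    have hcp := cosh_pos (k * r / δ)
    have he0 : 0 < e r := lt_of_le_of_lt (by positivity) hx'
    have h7 : c1 * e r / δ ^ 2 ≤ cc r * e r / δ ^ 2 := by gcongr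
    have h8 : c1 * (A * δ ^ 2 + B * cosh (k * r / δ) / D) / δ ^ 2 < c1 * e r / δ ^ 2 := by gcongr
    have h9 : c1 * (A * δ ^ 2 + B * cosh (k * r / δ) / D) / δ ^ 2 =
        C + c1 * (B * cosh (k * r / δ) / D) / δ ^ 2 := by rw [hA]; field_simp
    linarith [h6.1]) (by
      have : B * cosh (k * T / δ) / D = B := by rw [← hD]; field_simp
      rw [this]
      have : 0 < A * δ ^ 2 := by positivity
      linarith) (Or.inr (by simp)) r hr
  linarith

structure Ph1 (a m b δ U Tm T : ℝ) (u p v q : ℝ → ℝ) : Prop where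
  tj : Tj a m b δ u p v q
  d0 : 0 < δ
  T0 : 0 ≤ T
  TTm : T ≤ Tm
  vlo : ∀ r ∈ Icc 0 T, 1 / (2 * b) ≤ v r
  vhi : ∀ r ∈ Icc 0 T, v r ≤ 1 / b
  ulo : ∀ r ∈ Icc 0 T, U ≤ u r
  uhi : ∀ r ∈ Icc 0 T, u r ≤ a

lemma Ph1.rad (H : Par a m b U cV CV L V V1 V2 h X P) {δ Tm T : ℝ} {u p v q : ℝ → ℝ}
    (J : Ph1 a m b δ U Tm T u p v q) : Rad u p (fun r => u r - a + u r * v r ^ 2) 0 T := by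
  refine ⟨J.tj.uc.continuousOn, J.tj.pc.continuousOn, fun r hr => ⟨J.tj.du r hr.1, ?_⟩⟩
  have hr' := Ioo_subset_Icc_self hr
  have hb := H.b0
  have hθ : 0 < 1 / (2 * b) := by positivity
  convert! J.tj.dp r hr.1 using 1
  rw [cl_eq (H.U0.le.trans (J.ulo r hr')) (J.uhi r hr'),
    cl_eq (hθ.le.trans (J.vlo r hr')) (J.vhi r hr')]

lemma Ph1.dq (H : Par a m b U cV CV L V V1 V2 h X P) {δ Tm T : ℝ} {u p v q : ℝ → ℝ}
    (J : Ph1 a m b δ U Tm T u p v q) : ∀ r ∈ Ioo 0 T, HasDerivAt q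
      ((m * v r - u r * v r ^ 2 * (1 - b * v r)) / δ - q r / r) r := by
  intro r hr
  have hr' := Ioo_subset_Icc_self hr
  have hb := H.b0
  have hθ : 0 < 1 / (2 * b) := by positivity
  convert! J.tj.dq r hr.1 using 1
  rw [cl_eq (H.U0.le.trans (J.ulo r hr')) (J.uhi r hr'),
    cl_eq (hθ.le.trans (J.vlo r hr')) (J.vhi r hr')]

lemma Ph1.pb (H : Par a m b U cV CV L V V1 V2 h X P) {δ Tm T : ℝ} {u p v q : ℝ → ℝ}
    (J : Ph1 a m b δ U Tm T u p v q) :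
    ∀ r ∈ Icc 0 T, |u r - a + u r * v r ^ 2| ≤ a + a * (1 / b) ^ 2 ∧
      |p r| ≤ (a + a * (1 / b) ^ 2) * Tm := by
  have hb := H.b0
  have hθ : 0 < 1 / (2 * b) := by positivity
  have k : ∀ r ∈ Icc 0 T, |u r - a + u r * v r ^ 2| ≤ a + a * (1 / b) ^ 2 := by
    intro r hr
    have h1 := J.ulo r hr
    have h2 := J.uhi r hr
    have h3 := J.vlo r hr
    have h4 := J.vhi r hr
    have h0 := H.U0
    have u0 : 0 ≤ u r := h0.le.trans h1
    have v0 : 0 ≤ v r := hθ.le.trans h3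
    have ha := H.a0
    have k1 : u r * v r ^ 2 ≤ a * (1 / b) ^ 2 := by gcongr
    have k2 : 0 ≤ u r * v r ^ 2 := by positivity
    rw [abs_le]; constructor <;> linarith [H.a0]
  intro r hr
  refine ⟨k r hr, ?_⟩
  have k1 := (J.rad H).p_ge J.tj.p0 (fun r hr => (abs_le.1 (k r (Ioo_subset_Icc_self hr))).1) r hr
  have k2 := (J.rad H).p_le J.tj.p0 (fun r hr => (abs_le.1 (k r (Ioo_subset_Icc_self hr))).2) r hr
  have : (a + a * (1 / b) ^ 2) * r ≤ (a + a * (1 / b) ^ 2) * Tm := by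
    have := H.a0
    have := hr.2.trans J.TTm
    gcongr
  have h3 : 0 ≤ (a + a * (1 / b) ^ 2) * r := by have := H.a0; have := hr.1; positivity
  rw [abs_le]; constructor <;> linarith

lemma Ph1.ebound (H : Par a m b U cV CV L V V1 V2 h X P) (Tm : ℝ) :
    ∃ A k, 0 < A ∧ 0 < k ∧ ∀ {δ T : ℝ} {u p v q : ℝ → ℝ},
    Ph1 a m b δ U Tm T u p v q → ∀ r ∈ Icc 0 T,
      |v r - V (u r)| ≤ A * δ ^ 2 + 1 / b * cosh (k * r / δ) / cosh (k * T / δ) := by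
  have hb := H.b0
  have hU := H.U0
  have hcV := H.cV0
  have hCV := H.CV0
  have ha := H.a0
  obtain ⟨c1, hc1⟩ : ∃ c1, c1 = U * (1 / (2 * b)) * (b * cV) := ⟨_, rfl⟩
  have hc1p : 0 < c1 := by rw [hc1]; positivity
  obtain ⟨Cf, hCf⟩ : ∃ C, C = a + a * (1 / b) ^ 2 := ⟨_, rfl⟩
  have hCfp : 0 < Cf := by rw [hCf]; positivity
  obtain ⟨C, hC⟩ : ∃ C, C = CV * Cf + CV * (Cf * Tm) ^ 2 + 1 := ⟨_, rfl⟩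
  have hCp : 0 < C := by rw [hC]; positivity
  refine ⟨C / c1, √(c1 / 2), by positivity, by positivity, ?_⟩
  intro δ T u p v q J
  have hδ := J.d0
  have hsq : 2 * √(c1 / 2) ^ 2 = c1 := by rw [sq_sqrt (by positivity)]; ring
  have hVc : ContinuousOn (fun r => V (u r)) (Icc 0 T) := fun r hr =>
    ((H.dV _ (J.ulo r hr)).continuousAt.comp (f := u) J.tj.uc.continuousAt).continuousWithinAt
  have hV1c : ContinuousOn (fun r => V1 (u r)) (Icc 0 T) := fun r hr =>
    ((H.dV1 _ (J.ulo r hr)).continuousAt.comp (f := u) J.tj.uc.continuousAt).continuousWithinAt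
  have hR : Rad (fun r => v r - V (u r)) (fun r => q r / δ - V1 (u r) * p r)
      (fun r => (u r * v r * (b * (v r + V (u r)) - 1)) * (v r - V (u r)) / δ ^ 2 +
        (-(V1 (u r) * (u r - a + u r * v r ^ 2) + V2 (u r) * p r ^ 2))) 0 T := by
    refine ⟨J.tj.vc.continuousOn.sub hVc, (J.tj.qc.div_const δ).continuousOn.sub
      (hV1c.mul J.tj.pc.continuousOn), fun r hr => ⟨?_, ?_⟩⟩
    · have hr' := Ioo_subset_Icc_self hr
      exact (J.tj.dv r hr.1).sub ((H.dV _ (J.ulo r hr')).comp r (J.tj.du r hr.1))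
    · have hr' := Ioo_subset_Icc_self hr
      convert! ((J.dq H r hr).div_const δ).sub (((H.dV1 _ (J.ulo r hr')).comp r
        (J.tj.du r hr.1)).mul ((J.rad H).2.2 r hr).2) using 1
      have hr0 := hr.1
      have := H.Veq _ (J.ulo r hr')
      simp only [Function.comp]
      rw [← this]
      field_simp; ring
  have hcc : ∀ r ∈ Icc 0 T, c1 ≤ u r * v r * (b * (v r + V (u r)) - 1) := by
    intro r hr
    have h1 := J.ulo r hr
    have h2 := J.vlo r hr
    have h3 := H.Vlo _ h1
    have h4 : b * cV ≤ b * (v r + V (u r)) - 1 := by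
      have : b * (1 / (2 * b) + (1 / (2 * b) + cV)) ≤ b * (v r + V (u r)) := by gcongr
      have e : b * (1 / (2 * b) + (1 / (2 * b) + cV)) = 1 + b * cV := by field_simp; ring
      linarith
    rw [hc1]
    have : 0 ≤ u r := hU.le.trans h1
    have : 0 ≤ v r := le_trans (by positivity) h2
    gcongr
  have hf : ∀ r ∈ Icc 0 T, |-(V1 (u r) * (u r - a + u r * v r ^ 2) + V2 (u r) * p r ^ 2)| ≤ C := by
    intro r hr
    obtain ⟨k1, k2⟩ := J.pb H r hr
    rw [← hCf] at k1 k2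
    rw [abs_neg]
    have h1 := J.ulo r hr
    calc _ ≤ |V1 (u r) * (u r - a + u r * v r ^ 2)| + |V2 (u r) * p r ^ 2| := abs_add_le _ _
      _ = |V1 (u r)| * |(u r - a + u r * v r ^ 2)| + |V2 (u r)| * |p r| ^ 2 := by
        rw [abs_mul, abs_mul, abs_pow]
      _ ≤ CV * Cf + CV * (Cf * Tm) ^ 2 := by
        have := H.V1b _ h1
        have := H.V2b _ h1
        gcongr
      _ ≤ C := by rw [hC]; linarith
  have hTT : T ∈ Icc 0 T := ⟨J.T0, le_rfl⟩
  have hv1 := J.vlo T hTT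
  have hv2 := J.vhi T hTT
  have hV1 := H.Vlo _ (J.ulo T hTT)
  have hV2 := H.Vhi _ (J.ulo T hTT)
  have hθ : 0 < 1 / (2 * b) := by positivity
  intro r hr
  rw [abs_le']
  constructor
  · exact barrier hc1p hCp rfl (by positivity) hsq hδ (by positivity) hR hcc hf (by linarith) r hr
  · have hR' : Rad (fun r => -(v r - V (u r))) (fun r => -(q r / δ - V1 (u r) * p r))
      (fun r => (u r * v r * (b * (v r + V (u r)) - 1)) * (-(v r - V (u r))) / δ ^ 2 +
        (V1 (u r) * (u r - a + u r * v r ^ 2) + V2 (u r) * p r ^ 2)) 0 T := by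
      convert hR.neg using 2; ring
    exact barrier hc1p hCp rfl (by positivity) hsq hδ (by positivity) hR' hcc
      (fun r hr => by rw [← abs_neg]; exact hf r hr) (by linarith) r hr
end

section
variable {a m b U cV CV L : ℝ} {V V1 V2 h : ℝ → ℝ} {X P : ℝ → ℝ → ℝ}

lemma Gf_cont {f g : ℝ → ℝ} {s : Set ℝ} (hf : ContinuousOn f s) (hg : ContinuousOn g s) :
    ContinuousOn (fun r => Gf m b (f r) (g r)) s := by
  simp only [Gf]; fun_prop

/-- integrated form of the barrier -/
lemma Ph1.eint (H : Par a m b U cV CV L V V1 V2 h X P) (Tm : ℝ) (hTm : 0 < Tm) :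
    ∃ C, 0 < C ∧ ∀ {δ T : ℝ} {u p v q : ℝ → ℝ}, Ph1 a m b δ U Tm T u p v q → δ ≤ 1 →
    T * |v 0 - V (u 0)| ≤ C * δ ∧ ∃ F E : ℝ → ℝ, Continuous F ∧ (∀ r, HasDerivAt F (E r) r) ∧
      (∀ r, 0 ≤ E r) ∧ (∀ r ∈ Icc 0 T, |v r - V (u r)| ≤ E r) ∧
      (∀ r ∈ Icc 0 T, F r - F 0 ≤ C * δ) := by
  obtain ⟨A, k, hA, hk, hAk⟩ := Ph1.ebound H Tm
  have hb := H.b0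
  refine ⟨A * Tm + 1 / (b * k), by positivity, ?_⟩
  intro δ T u p v q J hδ1
  have hδ := J.d0
  have hT := J.T0
  have hTm := J.TTm
  have e := hAk J
  obtain ⟨D, hD⟩ : ∃ D, D = cosh (k * T / δ) := ⟨_, rfl⟩
  have hD0 : 0 < D := by rw [hD]; exact cosh_pos _
  have hA1 : A * δ ^ 2 * T ≤ A * Tm * δ := by
    have : δ ^ 2 ≤ δ := by nlinarith
    calc A * δ ^ 2 * T ≤ A * δ * Tm := by gcongr
      _ = _ := by ring
  refine ⟨?_, fun r => A * δ ^ 2 * r + 1 / b * (δ / k) * sinh (k * r / δ) / D,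
    fun r => A * δ ^ 2 + 1 / b * cosh (k * r / δ) / D, by fun_prop, ?_, ?_, ?_, ?_⟩
  · have h0 := e 0 ⟨le_rfl, hT⟩
    rw [← hD] at h0
    simp only [mul_zero, zero_div, cosh_zero, mul_one] at h0
    have h1 : k * T / δ ≤ D := by
      rw [hD]
      exact (self_le_sinh_iff.2 (by positivity)).trans (sinh_lt_cosh _).le
    have h2 : T * (1 / b / D) ≤ 1 / (b * k) * δ := by
      rw [div_le_iff₀ hδ] at h1
      have : T ≤ D * δ / k := by rw [le_div_iff₀ hk]; linarith
      calc T * (1 / b / D) ≤ (D * δ / k) * (1 / b / D) := by gcongr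
        _ = _ := by field_simp
    calc T * |v 0 - V (u 0)| ≤ T * (A * δ ^ 2 + 1 / b / D) := by gcongr
      _ = A * δ ^ 2 * T + T * (1 / b / D) := by ring
      _ ≤ _ := by linarith
  · intro r
    have h1 : HasDerivAt (fun r => k * r / δ) (k / δ) r := by
      convert! ((hasDerivAt_id r).const_mul k).div_const δ using 1; simp
    convert! ((hasDerivAt_id r).const_mul (A * δ ^ 2)).add
      ((h1.sinh.const_mul (1 / b * (δ / k))).div_const D) using 1
    field_simp
  · intro r
    have := cosh_pos (k * r / δ)
    positivity
  · intro r hr; rw [hD]; exact e r hr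
  · intro r hr
    simp only [mul_zero, zero_div, sinh_zero, add_zero, sub_zero]
    have h1 : sinh (k * r / δ) ≤ D := by
      rw [hD]
      refine (sinh_lt_cosh _).le.trans (cosh_le_cosh.2 ?_)
      have := hr.1
      rw [abs_of_nonneg (by positivity), abs_of_nonneg (by positivity)]
      have := hr.2
      gcongr
    have h2 : 1 / b * (δ / k) * sinh (k * r / δ) / D ≤ 1 / (b * k) * δ := by
      rw [div_le_iff₀ hD0]
      calc 1 / b * (δ / k) * sinh (k * r / δ) ≤ 1 / b * (δ / k) * D := by gcongr
        _ = _ := by field_simp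
    have h3 : A * δ ^ 2 * r ≤ A * δ ^ 2 * T := by have := hr.2; gcongr
    linarith

/-- polynomial facts about the excess energy -/
lemma Ghat (H : Par a m b U cV CV L V V1 V2 h X P) {u v : ℝ} (hu : U ≤ u) (hua : u ≤ a)
    (hv1 : 1 / (2 * b) ≤ v) (hv2 : v ≤ 1 / b) :
    0 ≤ Gf m b v u - Gf m b (V u) u ∧
    Gf m b v u - Gf m b (V u) u ≤ 4 * a / b ^ 2 * |v - V u| ∧
    |(-v ^ 3 / 3 + b * v ^ 4 / 4) - (-V u ^ 3 / 3 + b * V u ^ 4 / 4)| ≤ 4 / b ^ 2 * |v - V u| := by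
  have hb := H.b0
  have hU := H.U0
  have ha := H.a0
  have hu0 : 0 < u := hU.trans_le hu
  have hcV := H.cV0
  obtain ⟨W, hW⟩ : ∃ W, W = b * V u := ⟨_, rfl⟩
  obtain ⟨w, hw⟩ : ∃ w, w = b * v := ⟨_, rfl⟩
  have eV : V u = W / b := by rw [hW]; field_simp
  have ev : v = w / b := by rw [hw]; field_simp
  have w1 : 1 / 2 ≤ w := by
    have : b * (1 / (2 * b)) ≤ b * v := by gcongr
    rw [hw]; convert this using 1; field_simp
  have w2 : w ≤ 1 := by
    have : b * v ≤ b * (1 / b) := by gcongr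
    rw [hw]; convert this using 1; field_simp
  have W1 : 1 / 2 ≤ W := by
    have h1 := H.Vlo _ hu
    have : b * (1 / (2 * b)) ≤ b * V u := by apply mul_le_mul_of_nonneg_left _ hb.le; linarith
    rw [hW]; convert this using 1; field_simp
  have W2 : W ≤ 1 := by
    have h1 := H.Vhi _ hu
    have : b * V u ≤ b * (1 / b) := by gcongr
    rw [hW]; convert this using 1; field_simp
  have hm := H.Veq _ hu
  rw [eV] at hm
  have hm' : m = u * (W / b) * (1 - W) := by rw [← hm]; field_simp
  have e1 : Gf m b v u - Gf m b (V u) u = u / b ^ 3 * ((w - W) ^ 2 *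
      (W * (2 * W - 1) / 2 + (3 * W - 1) * (w - W) / 3 + (w - W) ^ 2 / 4)) := by
    rw [Gf, Gf, eV, ev, hm']; field_simp; ring
  have hbr : 0 ≤ W * (2 * W - 1) / 2 + (3 * W - 1) * (w - W) / 3 + (w - W) ^ 2 / 4 := by
    nlinarith [mul_nonneg (sub_nonneg.2 w1) (sub_nonneg.2 W1), mul_nonneg (sub_nonneg.2 w1) (sub_nonneg.2 w1),
      mul_nonneg (sub_nonneg.2 W1) (sub_nonneg.2 W1), mul_nonneg (sub_nonneg.2 W2) (sub_nonneg.2 W1),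
      mul_nonneg (sub_nonneg.2 w2) (sub_nonneg.2 w1)]
  have hbr2 : W * (2 * W - 1) / 2 + (3 * W - 1) * (w - W) / 3 + (w - W) ^ 2 / 4 ≤ 4 := by
    nlinarith [mul_nonneg (sub_nonneg.2 w1) (sub_nonneg.2 W1), mul_nonneg (sub_nonneg.2 w1) (sub_nonneg.2 w1),
      mul_nonneg (sub_nonneg.2 W1) (sub_nonneg.2 W1), mul_nonneg (sub_nonneg.2 W2) (sub_nonneg.2 W1),
      mul_nonneg (sub_nonneg.2 w2) (sub_nonneg.2 w1)]
  have eabs : |v - V u| = |w - W| / b := by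
    rw [eV, ev, ← sub_div, abs_div, abs_of_pos hb]
  have hwW : |w - W| ≤ 1 := by rw [abs_le]; constructor <;> linarith
  refine ⟨?_, ?_, ?_⟩
  · rw [e1]; positivity
  · rw [e1, eabs, ← sq_abs (w - W)]
    have hn := abs_nonneg (w - W)
    have hn2 : |w - W| ^ 2 ≤ |w - W| := by nlinarith
    rw [sq_abs (w - W)] at hn2 ⊢
    calc u / b ^ 3 * ((w - W) ^ 2 * (W * (2 * W - 1) / 2 + (3 * W - 1) * (w - W) / 3 + (w - W) ^ 2 / 4))
        ≤ a / b ^ 3 * (|w - W| * 4) := by gcongr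
      _ ≤ _ := le_of_eq (by field_simp)
  · have e2 : (-v ^ 3 / 3 + b * v ^ 4 / 4) - (-V u ^ 3 / 3 + b * V u ^ 4 / 4) =
        (w - W) / b * (1 / b ^ 2 * (-(w ^ 2 + w * W + W ^ 2) / 3 +
          (w ^ 3 + w ^ 2 * W + w * W ^ 2 + W ^ 3) / 4)) := by
      rw [eV, ev]; field_simp; ring
    rw [e2, abs_mul, abs_div, abs_of_pos hb, eabs, mul_comm (4 / b ^ 2)]
    gcongr
    rw [abs_mul, abs_of_pos (by positivity : 0 < 1 / b ^ 2)]
    have w0 : 0 ≤ w := by linarith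
    have W0 : 0 ≤ W := by linarith
    have a1 : w ^ 2 ≤ 1 := pow_le_one₀ w0 w2
    have a2 : W ^ 2 ≤ 1 := pow_le_one₀ W0 W2
    have a3 : w * W ≤ 1 := mul_le_one₀ w2 W0 W2
    have a5 : w ^ 3 ≤ 1 := pow_le_one₀ w0 w2
    have a6 : W ^ 3 ≤ 1 := pow_le_one₀ W0 W2
    have a7 : w ^ 2 * W ≤ 1 := mul_le_one₀ a1 W0 W2
    have a8 : w * W ^ 2 ≤ 1 := mul_le_one₀ w2 (by positivity) a2
    have : |-(w ^ 2 + w * W + W ^ 2) / 3 + (w ^ 3 + w ^ 2 * W + w * W ^ 2 + W ^ 3) / 4| ≤ 4 := by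
      rw [abs_le]
      have : 0 ≤ w ^ 3 + w ^ 2 * W + w * W ^ 2 + W ^ 3 := by positivity
      have : 0 ≤ w ^ 2 + w * W + W ^ 2 := by positivity
      constructor <;> linarith
    calc 1 / b ^ 2 * _ ≤ 1 / b ^ 2 * 4 := by gcongr
      _ = _ := by ring

lemma Ph1.concl (H : Par a m b U cV CV L V V1 V2 h X P) (Tm : ℝ) (hTm : 0 < Tm) :
    ∃ C, 0 < C ∧ ∀ {δ T : ℝ} {u p v q : ℝ → ℝ}, Ph1 a m b δ U Tm T u p v q → δ ≤ 1 →
    T * |v 0 - V (u 0)| ≤ C * δ ∧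
    (∀ r ∈ Icc 0 T, |u r - X (u 0) r| ≤ C * δ ∧ |p r - P (u 0) r| ≤ C * δ) ∧
    (0 < T → q T ^ 2 / 2 ≤ Gf m b (v T) (u T) - Gf m b (V (u T)) (u T) + C * δ) ∧
    T ^ 2 * (Gf m b (v T) (u T) - Gf m b (V (u T)) (u T) - q T ^ 2 / 2) ≤ C * δ := by
  obtain ⟨C, hC, hmain⟩ := Ph1.eint H Tm hTm
  have hb := H.b0
  have ha := H.a0
  have hU := H.U0
  have hL := H.rf.L0
  obtain ⟨Cp, hCp⟩ : ∃ Cp, Cp = (a + a * (1 / b) ^ 2) * Tm := ⟨_, rfl⟩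
  have hCp0 : 0 < Cp := by rw [hCp]; positivity
  obtain ⟨C1, hC1⟩ : ∃ C1, C1 = a * (2 / b) * C * exp ((1 + L) * Tm) := ⟨_, rfl⟩
  have hC10 : 0 < C1 := by rw [hC1]; positivity
  obtain ⟨C2, hC2⟩ : ∃ C2, C2 = 4 / b ^ 2 * Cp := ⟨_, rfl⟩
  have hC20 : 0 < C2 := by rw [hC2]; positivity
  obtain ⟨C3, hC3⟩ : ∃ C3, C3 = 2 * Tm * (4 * a / b ^ 2) + Tm ^ 2 * C2 := ⟨_, rfl⟩
  have hC30 : 0 < C3 := by rw [hC3]; positivity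
  refine ⟨C + C1 + C2 * C + C3 * C, by positivity, ?_⟩
  intro δ T u p v q J hδ1
  obtain ⟨m1, F, E, hFc, hFd, hE0, hE, hF⟩ := hmain J hδ1
  have hδ := J.d0
  have hT := J.T0
  have hTTm := J.TTm
  have ex : (C + C1 + C2 * C + C3 * C) * δ = C * δ + C1 * δ + C2 * (C * δ) + C3 * (C * δ) := by ring
  have q1 : 0 < C * δ := by positivity
  have q2 : 0 < C1 * δ := by positivity
  have q3 : 0 < C2 * (C * δ) := by positivity
  have q4 : 0 < C3 * (C * δ) := by positivity
  have hθ : 0 < 1 / (2 * b) := by positivity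
  rw [ex]
  have hVc : ContinuousOn (fun r => V (u r)) (Icc 0 T) := fun r hr =>
    ((H.dV _ (J.ulo r hr)).continuousAt.comp (f := u) J.tj.uc.continuousAt).continuousWithinAt
  -- energy
  obtain ⟨W, hW⟩ : ∃ W : ℝ → ℝ, W = fun r => (r * q r) ^ 2 / 2 -
    r ^ 2 * (Gf m b (v r) (u r) - Gf m b (V (u r)) (u r)) := ⟨_, rfl⟩
  obtain ⟨W', hW'⟩ : ∃ W : ℝ → ℝ, W = fun r =>
    - 2 * r * (Gf m b (v r) (u r) - Gf m b (V (u r)) (u r)) - r ^ 2 * (p r *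
    ((-v r ^ 3 / 3 + b * v r ^ 4 / 4) - (-V (u r) ^ 3 / 3 + b * V (u r) ^ 4 / 4))) := ⟨_, rfl⟩
  have hWc : ContinuousOn W (Icc 0 T) := by
    rw [hW]
    have h2 := J.tj.qc
    exact (Continuous.continuousOn (by fun_prop)).sub ((Continuous.continuousOn (by fun_prop)).mul
      ((Gf_cont J.tj.vc.continuousOn J.tj.uc.continuousOn).sub
        (Gf_cont hVc J.tj.uc.continuousOn)))
  have hWd : ∀ r ∈ Ioo 0 T, HasDerivAt W (W' r) r := by
    intro r hr
    have hr' := Ioo_subset_Icc_self hr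
    have hr0 := hr.1
    have dq := (hasDerivAt_id r).mul (J.dq H r hr)
    have dv := J.tj.dv r hr.1
    have du := J.tj.du r hr.1
    have dV := (H.dV _ (J.ulo r hr')).comp r du
    rw [hW, hW']
    simp only [Gf]
    convert! ((dq.pow 2).div_const 2).sub (((hasDerivAt_id r).pow 2).mul
      (((((dv.pow 2).const_mul m).div_const 2).sub ((du.mul (dv.pow 3)).div_const 3)).add
        (((du.const_mul b).mul (dv.pow 4)).div_const 4) |>.sub
      (((((dV.pow 2).const_mul m).div_const 2).sub ((du.mul (dV.pow 3)).div_const 3)).add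
        (((du.const_mul b).mul (dV.pow 4)).div_const 4)))) using 1
    have := H.Veq _ (J.ulo r hr')
    simp only [Function.comp, id, Pi.mul_apply, Pi.pow_apply]
    have e : m * V (u r) - u r * V (u r) ^ 2 + b * u r * V (u r) ^ 3 = 0 := by
      rw [← this]; ring
    field_simp
    norm_num
    linear_combination (-24 * V1 (u r) * p r * r ^ 2 * δ) * e
  have hW0 : W 0 = 0 := by rw [hW]; simp
  have hWb : ∀ r ∈ Icc 0 T, |p r * ((-v r ^ 3 / 3 + b * v r ^ 4 / 4) -
      (-V (u r) ^ 3 / 3 + b * V (u r) ^ 4 / 4))| ≤ C2 * E r := by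
    intro r hr
    obtain ⟨g1, g2, g3⟩ := Ghat H (J.ulo r hr) (J.uhi r hr) (J.vlo r hr) (J.vhi r hr)
    rw [abs_mul]
    have h1 := (J.pb H r hr).2
    rw [← hCp] at h1
    have h2 := hE r hr
    calc _ ≤ Cp * (4 / b ^ 2 * E r) := by
          have : 4 / b ^ 2 * |v r - V (u r)| ≤ 4 / b ^ 2 * E r := by gcongr
          have h3 := g3.trans this
          gcongr
      _ = _ := by rw [hC2]; ring
  have hFT := hF T ⟨hT, le_rfl⟩
  refine ⟨by linarith, ?_, ?_, ?_⟩
  · have hR : Rad (fun r => u r - X (u 0) r) (fun r => p r - P (u 0) r)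
        (fun r => (u r - a + u r * v r ^ 2) - h (X (u 0) r)) 0 T := by
      have h1 := J.rad H
      have h2 := H.rf.rad (u 0) T
      refine ⟨h1.1.sub h2.1, h1.2.1.sub h2.2.1, fun r hr =>
        ⟨(h1.2.2 r hr).1.sub (h2.2.2 r hr).1, ?_⟩⟩
      convert! (h1.2.2 r hr).2.sub (h2.2.2 r hr).2 using 1; ring
    have hg := hR.gronwall (e := fun r => a * (2 / b) * F r) (e' := fun r => a * (2 / b) * E r) hL
      (by simp [J.tj.p0, H.rf.P0]) (by fun_prop) (fun r _ => (hFd r).const_mul _)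
      (fun r _ => mul_nonneg (by positivity) (hE0 r)) (fun r hr => by
        have hr' := Ioo_subset_Icc_self hr
        have e1 : (u r - a + u r * v r ^ 2) - h (X (u 0) r) = (h (u r) - h (X (u 0) r)) +
            u r * ((v r + V (u r)) * (v r - V (u r))) := by
          rw [H.hU _ (J.ulo r hr')]; ring
        rw [e1]
        refine (abs_add_le _ _).trans (add_le_add (H.rf.lip _ _) ?_)
        have h1 := J.ulo r hr'
        have h2 := J.uhi r hr'
        have h3 := J.vlo r hr'
        have h4 := J.vhi r hr'
        have h5 := H.Vlo _ h1
        have h6 := H.Vhi _ h1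
        have h7 := hE r hr'
        have := H.cV0
        have u0 : 0 ≤ u r := hU.le.trans h1
        have v0 : 0 ≤ v r + V (u r) := by linarith
        have v1 : v r + V (u r) ≤ 2 / b := by
          have : 2 / b = 1 / b + 1 / b := by ring
          linarith
        rw [abs_mul, abs_mul, abs_of_nonneg u0, abs_of_nonneg v0]
        calc u r * ((v r + V (u r)) * |v r - V (u r)|) ≤ a * (2 / b * E r) := by gcongr
          _ = _ := by ring)
    intro r hr
    have hx := hg r hr
    have h1 : (|u 0 - X (u 0) 0| + (a * (2 / b) * F r - a * (2 / b) * F 0)) * exp ((1 + L) * r) ≤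
        C1 * δ := by
      rw [H.rf.X0, sub_self, abs_zero, zero_add, ← mul_sub]
      have := hF r hr
      have h3 : exp ((1 + L) * r) ≤ exp ((1 + L) * Tm) := by
        have := hr.2.trans hTTm
        gcongr
      calc a * (2 / b) * (F r - F 0) * exp ((1 + L) * r)
          ≤ a * (2 / b) * (C * δ) * exp ((1 + L) * r) := by gcongr
        _ ≤ a * (2 / b) * (C * δ) * exp ((1 + L) * Tm) := by gcongr
        _ = _ := by rw [hC1]; ring
    constructor <;> linarith [hx.1, hx.2]
  · intro hT0
    have hm := anti_of_d (f := fun r => W r - T ^ 2 * (C2 * F r))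
      (f' := fun r => W' r - T ^ 2 * (C2 * E r)) (s := 0) (t := T)
      (hWc.sub (by fun_prop)) (fun r hr => (hWd r hr).sub (((hFd r).const_mul C2).const_mul _))
      (fun r hr => by
        have hr' := Ioo_subset_Icc_self hr
        obtain ⟨g1, g2, g3⟩ := Ghat H (J.ulo r hr') (J.uhi r hr') (J.vlo r hr') (J.vhi r hr')
        have h1 := (abs_le.1 (hWb r hr')).1
        have h2 : r ^ 2 * -(p r * ((-v r ^ 3 / 3 + b * v r ^ 4 / 4) -
            (-V (u r) ^ 3 / 3 + b * V (u r) ^ 4 / 4))) ≤ T ^ 2 * (C2 * E r) := by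
          have := hr.1.le
          have := hr.2.le
          have := hE0 r
          calc _ ≤ r ^ 2 * (C2 * E r) := by gcongr; linarith
            _ ≤ _ := by gcongr
        have h3 := mul_nonneg hr.1.le g1
        rw [hW']; simp only; linarith)
    have := hm (left_mem_Icc.2 hT) (right_mem_Icc.2 hT) hT
    simp only [hW0] at this
    have h4 : T ^ 2 * (C2 * (F T - F 0)) ≤ T ^ 2 * (C2 * (C * δ)) := by gcongr
    have h5 : T ^ 2 * (q T ^ 2 / 2) ≤ T ^ 2 * (Gf m b (v T) (u T) - Gf m b (V (u T)) (u T) +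
        C2 * (C * δ)) := by
      rw [hW] at this; simp only at this; linarith
    have := le_of_mul_le_mul_left h5 (by positivity)
    linarith
  · have hm := mono_of_d (f := fun r => W r + C3 * F r)
      (f' := fun r => W' r + C3 * E r) (s := 0) (t := T)
      (hWc.add (by fun_prop)) (fun r hr => (hWd r hr).add ((hFd r).const_mul C3))
      (fun r hr => by
        have hr' := Ioo_subset_Icc_self hr
        obtain ⟨g1, g2, g3⟩ := Ghat H (J.ulo r hr') (J.uhi r hr') (J.vlo r hr') (J.vhi r hr')
        have h1 := (abs_le.1 (hWb r hr')).2
        have r0 := hr.1.le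
        have r1 := hr.2.le.trans hTTm
        have e0 := hE0 r
        have h2 : r ^ 2 * (p r * ((-v r ^ 3 / 3 + b * v r ^ 4 / 4) -
            (-V (u r) ^ 3 / 3 + b * V (u r) ^ 4 / 4))) ≤ Tm ^ 2 * (C2 * E r) := by
          calc _ ≤ r ^ 2 * (C2 * E r) := by gcongr
            _ ≤ _ := by gcongr
        have h3 : 2 * r * (Gf m b (v r) (u r) - Gf m b (V (u r)) (u r)) ≤
            2 * Tm * (4 * a / b ^ 2 * E r) := by
          have h5 := hE r hr'
          have h4 : 4 * a / b ^ 2 * |v r - V (u r)| ≤ 4 * a / b ^ 2 * E r := by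
            gcongr
          calc _ ≤ 2 * r * (4 * a / b ^ 2 * E r) := by
                apply mul_le_mul_of_nonneg_left _ (by positivity); linarith
            _ ≤ _ := by gcongr
        rw [hW', hC3]; simp only; linarith)
    have := hm (left_mem_Icc.2 hT) (right_mem_Icc.2 hT) hT
    simp only [hW0] at this
    have h4 : C3 * (F T - F 0) ≤ C3 * (C * δ) := by gcongr
    rw [hW] at this; simp only at this
    linarith
end


noncomputable def Lf (m b w v : ℝ) : ℝ := 49 / 50 * m * v ^ 2 / 2 - w * v ^ 3 / 3 + b * w * v ^ 4 / 4

def SA (m b w uh : ℝ) (u v q : ℝ → ℝ) : Prop :=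
  ∃ r, 0 < r ∧ v r < 1 / (2 * b) ∧ 0 < Lf m b w (v r) - q r ^ 2 / 2 ∧ (∀ s ∈ Icc 0 r, 0 < v s) ∧
    ∀ s ∈ Icc 0 r, v s < 1 / (2 * b) ∨ (u s < uh ∧ v s < 1 / b)
def SB1 (b uh : ℝ) (u v : ℝ → ℝ) : Prop :=
  ∃ r, 0 ≤ r ∧ (∀ s ∈ Icc 0 r, 1 / (2 * b) < v s) ∧ (uh < u r ∨ 1 / b < v r)
def SB2 (m b w : ℝ) (v q : ℝ → ℝ) : Prop :=
  ∃ r, 0 ≤ r ∧ v r < 0 ∧ ∀ s ∈ Icc 0 r, v s < 0 ∨ 1 / (2 * b) < v s ∨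
    Lf m b w (v s) - q s ^ 2 / 2 < 0

lemma SA_SB1 {m b w uh : ℝ} {u v q : ℝ → ℝ} (hA : SA m b w uh u v q) (hB : SB1 b uh u v) : False := by
  obtain ⟨r, r0, h1, h2, h3, h4⟩ := hA
  obtain ⟨s, s0, k1, k2⟩ := hB
  rcases le_or_gt s r with h | h
  · have := k1 s ⟨s0, le_rfl⟩
    rcases h4 s ⟨s0, h⟩ with h | h
    · linarith
    · rcases k2 with k | k <;> linarith [h.1, h.2]
  · have := k1 r ⟨r0.le, h.le⟩
    linarith
lemma SA_SB2 {m b w uh : ℝ} {u v q : ℝ → ℝ} (hA : SA m b w uh u v q) (hB : SB2 m b w v q) : False := by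
  obtain ⟨r, r0, h1, h2, h3, h4⟩ := hA
  obtain ⟨s, s0, k1, k2⟩ := hB
  have : r < s := by
    by_contra h
    have := h3 s ⟨s0, not_lt.1 h⟩
    linarith
  have h5 := h3 r ⟨r0.le, le_rfl⟩
  rcases k2 r ⟨r0.le, this.le⟩ with h | h | h <;> linarith

lemma Lf_lower {m b w v : ℝ} (hm : 0 < m) (hb : 0 < b) (hw : w ≤ 51 / 50 * (9 * b * m / 2))
    (h0 : 0 ≤ v) (h1 : v ≤ 1 / (2 * b)) : m / 100 * v ^ 2 ≤ Lf m b w v := by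
  obtain ⟨y, hy⟩ : ∃ y, y = b * v := ⟨_, rfl⟩
  have y0 : 0 ≤ y := by rw [hy]; positivity
  have y1 : y ≤ 1 / 2 := by
    have : b * v ≤ b * (1 / (2 * b)) := by gcongr
    rw [hy]; refine this.trans (le_of_eq (by field_simp))
  have e : Lf m b w v - m / 100 * v ^ 2 = v ^ 2 * (m * (48 / 100) - w * (v * (1 / 3 - y / 4))) := by
    rw [Lf, hy]; ring
  have h3 : w * (v * (1 / 3 - y / 4)) ≤ 51 / 50 * (9 * b * m / 2) * (v * (1 / 3 - y / 4)) := by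
    have : 0 ≤ v * (1 / 3 - y / 4) := mul_nonneg h0 (by linarith)
    gcongr
  have h4 : 51 / 50 * (9 * b * m / 2) * (v * (1 / 3 - y / 4)) =
      m * (51 / 50 * (9 / 2) * (y * (1 / 3 - y / 4))) := by rw [hy]; ring
  have h5 : 51 / 50 * (9 / 2) * (y * (1 / 3 - y / 4)) ≤ 48 / 100 := by nlinarith
  have h6 : m * (51 / 50 * (9 / 2) * (y * (1 / 3 - y / 4))) ≤ m * (48 / 100) := by gcongr
  have : 0 ≤ v ^ 2 * (m * (48 / 100) - w * (v * (1 / 3 - y / 4))) :=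
    mul_nonneg (sq_nonneg v) (by linarith)
  linarith

lemma Lf_der (m b w v : ℝ) : HasDerivAt (Lf m b w) (49 / 50 * m * v - w * v ^ 2 + b * w * v ^ 3) v := by
  have hx := hasDerivAt_id v
  have : Lf m b w = fun v => 49 / 50 * m * v ^ 2 / 2 - w * v ^ 3 / 3 + b * w * v ^ 4 / 4 := rfl
  rw [this]
  convert! ((((hx.pow 2).const_mul (49 / 50 * m)).div_const 2).sub
    (((hx.pow 3).const_mul w).div_const 3)).add (((hx.pow 4).const_mul (b * w)).div_const 4) using 1
  simp; ring
lemma Lf_cont (m b w : ℝ) : Continuous (Lf m b w) := by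
  have : Lf m b w = fun v => 49 / 50 * m * v ^ 2 / 2 - w * v ^ 3 / 3 + b * w * v ^ 4 / 4 := rfl
  rw [this]; fun_prop

lemma cl_bd {M x : ℝ} (hM : 0 ≤ M) : 0 ≤ cl M x ∧ cl M x ≤ M :=
  ⟨le_max_left _ _, max_le hM (min_le_left _ _)⟩
lemma cl_le {M x y : ℝ} (hy : 0 ≤ y) (h : x ≤ y) : cl M x ≤ y :=
  max_le hy ((min_le_right _ _).trans h)
lemma cl_cont (M : ℝ) : Continuous (cl M) := by unfold cl; fun_prop

noncomputable def gc (a m b : ℝ) (u v : ℝ) : ℝ := m * cl (1 / b) v -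
    cl a u * cl (1 / b) v ^ 2 * (1 - b * cl (1 / b) v)
lemma gc_cont (a m b : ℝ) {u v : ℝ → ℝ} (hu : Continuous u) (hv : Continuous v) :
    Continuous (fun r => gc a m b (u r) (v r)) := by
  have h1 := (cl_cont a).comp hu
  have h2 := (cl_cont (1 / b)).comp hv
  unfold gc
  simp only [Function.comp_def] at h1 h2
  fun_prop

section
variable {a m b δ : ℝ} {u p v q : ℝ → ℝ}

lemma Tj.dq' (J : Tj a m b δ u p v q) (r : ℝ) (hr : 0 < r) :
    HasDerivAt q (gc a m b (u r) (v r) / δ - q r / r) r := J.dq r hr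

lemma Tj.kick (J : Tj a m b δ u p v q) (hδ : 0 < δ) {s : ℝ} (hs : 0 ≤ s) (hq : q s = 0)
    (hg : 0 < gc a m b (u s) (v s)) {ε : ℝ} (hε : 0 < ε) :
    ∃ t, s < t ∧ t < s + ε ∧ ∀ r ∈ Ioc s t, v s < v r := by
  have hc := (gc_cont a m b J.uc J.vc).continuousAt (x := s) |>.eventually (lt_mem_nhds hg)
  obtain ⟨d, hd, hball⟩ := Metric.eventually_nhds_iff.1 hc
  obtain ⟨t, ht⟩ : ∃ t, t = s + min d ε / 2 := ⟨_, rfl⟩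
  have hmin : 0 < min d ε := lt_min hd hε
  have hst : s < t := by rw [ht]; linarith
  have htd : t < s + d := by have := min_le_left d ε; linarith
  refine ⟨t, hst, by have := min_le_right d ε; linarith, ?_⟩
  have hg' : ∀ r ∈ Icc s t, 0 < gc a m b (u r) (v r) := fun r hr => by
    apply hball; rw [Real.dist_eq, abs_of_nonneg (by linarith [hr.1])]; linarith [hr.2]
  have hm := smono_of_d (f := fun r => r * q r) (f' := fun r => r * (gc a m b (u r) (v r) / δ))
    (s := s) (t := t) (continuous_id.mul J.qc).continuousOn (fun r hr => by
      have hr0 : 0 < r := hs.trans_lt hr.1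
      convert! (hasDerivAt_id r).mul (J.dq' r hr0) using 1
      simp only [id]; field_simp; ring) (fun r hr => by
      have hr0 : 0 < r := hs.trans_lt hr.1
      have := hg' r (Ioo_subset_Icc_self hr)
      positivity)
  have hqp : ∀ r ∈ Ioc s t, 0 < q r := fun r hr => by
    have h1 := hm (left_mem_Icc.2 hst.le) (Ioc_subset_Icc_self hr) hr.1
    simp only [hq, mul_zero] at h1
    exact (pos_iff_pos_of_mul_pos h1).1 (hs.trans_lt hr.1)
  have hv := smono_of_d (f := v) (f' := fun r => q r / δ) (s := s) (t := t) J.vc.continuousOn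
    (fun r hr => J.dv r (hs.trans_lt hr.1)) (fun r hr => div_pos (hqp r (Ioo_subset_Ioc_self hr)) hδ)
  intro r hr
  exact hv (left_mem_Icc.2 hst.le) (Ioc_subset_Icc_self hr) hr.1

lemma Tj.kick_down (J : Tj a m b δ u p v q) (hδ : 0 < δ) {s : ℝ} (hs : 0 ≤ s) (hq : q s = 0)
    (hg : gc a m b (u s) (v s) < 0) {ε : ℝ} (hε : 0 < ε) :
    ∃ t, s < t ∧ t < s + ε ∧ ∀ r ∈ Ioc s t, v r < v s := by
  have hc := (gc_cont a m b J.uc J.vc).continuousAt (x := s) |>.eventually (gt_mem_nhds hg)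
  obtain ⟨d, hd, hball⟩ := Metric.eventually_nhds_iff.1 hc
  obtain ⟨t, ht⟩ : ∃ t, t = s + min d ε / 2 := ⟨_, rfl⟩
  have hmin : 0 < min d ε := lt_min hd hε
  have hst : s < t := by rw [ht]; linarith
  have htd : t < s + d := by have := min_le_left d ε; linarith
  refine ⟨t, hst, by have := min_le_right d ε; linarith, ?_⟩
  have hg' : ∀ r ∈ Icc s t, gc a m b (u r) (v r) < 0 := fun r hr => by
    apply hball; rw [Real.dist_eq, abs_of_nonneg (by linarith [hr.1])]; linarith [hr.2]
  have hm := santi_of_d (f := fun r => r * q r) (f' := fun r => r * (gc a m b (u r) (v r) / δ))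
    (s := s) (t := t) (continuous_id.mul J.qc).continuousOn (fun r hr => by
      have hr0 : 0 < r := hs.trans_lt hr.1
      convert! (hasDerivAt_id r).mul (J.dq' r hr0) using 1
      simp only [id]; field_simp; ring) (fun r hr => by
      have hr0 : 0 < r := hs.trans_lt hr.1
      have := hg' r (Ioo_subset_Icc_self hr)
      exact mul_neg_of_pos_of_neg hr0 (div_neg_of_neg_of_pos this hδ))
  have hqp : ∀ r ∈ Ioc s t, q r < 0 := fun r hr => by
    have h1 := hm (left_mem_Icc.2 hst.le) (Ioc_subset_Icc_self hr) hr.1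
    simp only [hq, mul_zero] at h1
    by_contra hcon
    have := mul_nonneg (hs.trans hr.1.le) (not_lt.1 hcon)
    linarith
  have hv := santi_of_d (f := v) (f' := fun r => q r / δ) (s := s) (t := t) J.vc.continuousOn
    (fun r hr => J.dv r (hs.trans_lt hr.1))
    (fun r hr => div_neg_of_neg_of_pos (hqp r (Ioo_subset_Ioc_self hr)) hδ)
  intro r hr
  exact hv (left_mem_Icc.2 hst.le) (Ioc_subset_Icc_self hr) hr.1

/-- a priori bound -/
lemma Tj.ub (J : Tj a m b δ u p v q) (ha : 0 < a) (hb : 0 < b) {R : ℝ} :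
    ∀ r ∈ Icc 0 R, |u r| ≤ (|u 0| + (a + a * (1 / b) ^ 2) * R) * exp (2 * R) ∧
      |p r| ≤ (|u 0| + (a + a * (1 / b) ^ 2) * R) * exp (2 * R) := by
  have hR : Rad u p (fun r => u r - a + cl a (u r) * cl (1 / b) (v r) ^ 2) 0 R :=
    ⟨J.uc.continuousOn, J.pc.continuousOn, fun r hr => ⟨J.du r hr.1, J.dp r hr.1⟩⟩
  have hg := hR.gronwall (L := 1) (e := fun r => (a + a * (1 / b) ^ 2) * r)
    (e' := fun _ => a + a * (1 / b) ^ 2) zero_le_one J.p0 (by fun_prop)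
    (fun r _ => by convert! (hasDerivAt_id r).const_mul (a + a * (1 / b) ^ 2) using 1; ring)
    (fun r _ => by positivity) (fun r _ => by
      have h1 := cl_bd (M := a) (x := u r) ha.le
      have h2 := cl_bd (M := 1 / b) (x := v r) (by positivity)
      obtain ⟨c1, c2⟩ := h1
      obtain ⟨c3, c4⟩ := h2
      have k1 : cl a (u r) * cl (1 / b) (v r) ^ 2 ≤ a * (1 / b) ^ 2 := by gcongr
      have k2 : 0 ≤ cl a (u r) * cl (1 / b) (v r) ^ 2 := by positivity
      have k3 := neg_abs_le (u r)
      have k4 := le_abs_self (u r)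
      rw [abs_le]; constructor <;> linarith)
  intro r hr
  have h0 := hg r hr
  have : (|u 0| + ((a + a * (1 / b) ^ 2) * r - (a + a * (1 / b) ^ 2) * 0)) * exp ((1 + 1) * r) ≤
      (|u 0| + (a + a * (1 / b) ^ 2) * R) * exp (2 * R) := by
    have := hr.1
    have := hr.2
    have : 0 ≤ R := by linarith
    have : 0 ≤ |u 0| + (a + a * (1 / b) ^ 2) * R := by positivity
    rw [mul_zero, sub_zero, show (1 + 1 : ℝ) = 2 by norm_num]
    gcongr
  exact ⟨h0.1.trans this, h0.2.trans this⟩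
end

section
variable {a m b U cV CV L : ℝ} {V V1 V2 h : ℝ → ℝ} {X P : ℝ → ℝ → ℝ}

lemma Tlow (H : Par a m b U cV CV L V V1 V2 h X P) {αl αh : ℝ} (hl : U < αl)
    (hh : αh < 9 * b * m / 2) :
    ∃ Tn cp, 0 < Tn ∧ 0 < cp ∧ ∀ α ∈ Icc αl αh, ∀ s, 0 ≤ s → (αh + 9 * b * m / 2) / 2 ≤ X α s →
      X α s ≤ a → Tn ≤ s ∧ cp ≤ P α s := by
  have hl0 := H.rf.hpos hl
  have ha0 := H.rf.hpos (H.Uus.trans H.usa)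
  have hd : 0 < 9 * b * m / 2 - αh := by linarith
  obtain ⟨Tn, hTn⟩ : ∃ T, T = √(2 * (9 * b * m / 2 - αh) / h a) := ⟨_, rfl⟩
  have hTn0 : 0 < Tn := by rw [hTn]; positivity
  refine ⟨Tn, h αl * Tn / 2, hTn0, by positivity, ?_⟩
  intro α hα s hs h1 h2
  have h3 := H.rf.Xle2 α hs
  have h4 := H.rf.hmono h2
  have h5 : h (X α s) * s ^ 2 ≤ h a * s ^ 2 := by gcongr
  have h6 : Tn ≤ s := by
    rw [hTn, ← sqrt_sq hs]
    apply sqrt_le_sqrt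
    rw [div_le_iff₀ ha0]
    have := hα.2
    linarith
  refine ⟨h6, ?_⟩
  have h7 := H.rf.Pge α hs
  have h8 := H.rf.hmono hα.1
  have h9 := H.rf.hnn α
  have : h αl * Tn ≤ h α * s := by gcongr
  linarith

/-- g at the middle value is negative -/
lemma gc_neg (H : Par a m b U cV CV L V V1 V2 h X P) {u : ℝ} (hu : U ≤ u) (hua : u ≤ a) :
    gc a m b u (1 / (2 * b)) < 0 := by
  have hb := H.b0
  have hu0 := H.U0.trans_le hu
  rw [gc, cl_eq hu0.le hua, cl_eq (by positivity) (by gcongr; linarith), ← H.Veq u hu]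
  have h1 := H.Vlo u hu
  have h2 := H.Vhi u hu
  have := H.cV0
  have e : u * V u * (1 - b * V u) * (1 / (2 * b)) - u * (1 / (2 * b)) ^ 2 * (1 - b * (1 / (2 * b)))
    = - (u / 2 * (V u - 1 / (2 * b)) ^ 2) := by field_simp; ring
  rw [e]
  have : 0 < V u - 1 / (2 * b) := by linarith
  have : 0 < u / 2 * (V u - 1 / (2 * b)) ^ 2 := by positivity
  linarith

lemma gc_pos {a m b u v : ℝ} (hm : 0 < m) (hb : 0 < b) (hv : 1 / b ≤ v) : 0 < gc a m b u v := by
  have : cl (1 / b) v = 1 / b := by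
    rw [cl, min_eq_left hv, max_eq_right (by positivity)]
  rw [gc, this]
  have : m * (1 / b) - cl a u * (1 / b) ^ 2 * (1 - b * (1 / b)) = m / b := by field_simp; ring
  rw [this]; positivity

lemma bottom_SA (H : Par a m b U cV CV L V V1 V2 h X P) {w uh δ : ℝ} {u p v q : ℝ → ℝ}
    (hw : w ≤ 51 / 50 * (9 * b * m / 2)) (hδ : 0 < δ) (J : Tj a m b δ u p v q) (hu : U ≤ u 0)
    (huh : u 0 < uh) (hua : uh ≤ a)
    (hv : v 0 = 1 / (2 * b)) : SA m b w uh u v q := by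
  have hb := H.b0
  have hm := H.m0
  have hθ : 0 < 1 / (2 * b) := by positivity
  have hθ2 : 1 / (2 * b) < 1 / b := by gcongr; linarith
  have c1 : ∀ᶠ r in nhds (0:ℝ), u r < uh := J.uc.continuousAt.eventually (gt_mem_nhds huh)
  have c2 : ∀ᶠ r in nhds (0:ℝ), v r < 1 / b :=
    J.vc.continuousAt.eventually (gt_mem_nhds (by rw [hv]; exact hθ2))
  have c3 : ∀ᶠ r in nhds (0:ℝ), 0 < v r :=
    J.vc.continuousAt.eventually (lt_mem_nhds (by rw [hv]; exact hθ))
  have hLc : Continuous (fun r => Lf m b w (v r) - q r ^ 2 / 2) :=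
    ((Lf_cont m b w).comp J.vc).sub ((J.qc.pow 2).div_const 2)
  have c4 : ∀ᶠ r in nhds (0:ℝ), 0 < Lf m b w (v r) - q r ^ 2 / 2 := by
    refine hLc.continuousAt.eventually (lt_mem_nhds ?_)
    have := Lf_lower hm hb hw hθ.le le_rfl
    show 0 < Lf m b w (v 0) - q 0 ^ 2 / 2
    rw [hv, J.q0]
    have : 0 < m / 100 * (1 / (2 * b)) ^ 2 := by positivity
    linarith
  obtain ⟨d, hd, hball⟩ := Metric.eventually_nhds_iff.1 (c1.and (c2.and (c3.and c4)))
  obtain ⟨t, t1, t2, t3⟩ := J.kick_down hδ le_rfl J.q0 (by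
    rw [hv]; exact gc_neg H hu (huh.le.trans hua)) hd
  rw [zero_add] at t2
  have hin : ∀ s ∈ Icc 0 t, dist s 0 < d := fun s hs => by
    rw [Real.dist_eq, sub_zero, abs_of_nonneg hs.1]; linarith [hs.2]
  refine ⟨t, t1, ?_, (hball (hin t ⟨t1.le, le_rfl⟩)).2.2.2, fun s hs => (hball (hin s hs)).2.2.1,
    fun s hs => Or.inr ⟨(hball (hin s hs)).1, (hball (hin s hs)).2.1⟩⟩
  rw [← hv]; exact t3 t ⟨t1, le_rfl⟩

lemma top_SB1 {a m b uh δ : ℝ} {u p v q : ℝ → ℝ} (hm : 0 < m) (hb : 0 < b)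
    (hδ : 0 < δ) (J : Tj a m b δ u p v q) {s : ℝ} (hs : 0 ≤ s) (hq : q s = 0)
    (hlo : ∀ r ∈ Icc 0 s, 1 / (2 * b) < v r)
    (hv : v s = 1 / b) : SB1 b uh u v := by
  have hθ2 : 1 / (2 * b) < 1 / b := by gcongr; linarith
  obtain ⟨t, t1, -, t3⟩ := J.kick hδ hs hq (gc_pos hm hb hv.ge) one_pos
  refine ⟨t, hs.trans t1.le, fun r hr => ?_, Or.inr (by rw [← hv]; exact t3 t ⟨t1, le_rfl⟩)⟩
  rcases le_or_gt r s with h | h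
  · exact hlo r ⟨hr.1, h⟩
  · have := t3 r ⟨h, hr.2⟩
    rw [hv] at this; linarith

structure P1N (a m b δ U Tm uh T : ℝ) (u p v q : ℝ → ℝ) : Prop where
  ph : Ph1 a m b δ U Tm T u p v q
  T0 : 0 < T
  vT : v T = 1 / (2 * b)
  vgt : ∀ s ∈ Ico 0 T, 1 / (2 * b) < v s
  vlt : ∀ s ∈ Ico 0 T, v s < 1 / b
  ult : ∀ s ∈ Ico 0 T, u s < uh
  uT : u T ≤ uh

lemma phase1N (H : Par a m b U cV CV L V V1 V2 h X P) {αl αh uh w Tm : ℝ} (hl : U < αl)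
    (hh : αh < 9 * b * m / 2) (huh : 9 * b * m / 2 < uh) (hua : uh < a)
    (hw : w ≤ 51 / 50 * (9 * b * m / 2)) (hTm : 0 < Tm)
    (hTm2 : a ≤ h αl * Tm ^ 2 / 4) :
    ∃ δ0, 0 < δ0 ∧ ∀ {δ : ℝ} {u p v q : ℝ → ℝ}, 0 < δ → δ < δ0 → Tj a m b δ u p v q →
      u 0 ∈ Icc αl αh → v 0 ∈ Icc (1 / (2 * b)) (1 / b) → ¬ SA m b w uh u v q → ¬ SB1 b uh u v →
      ∃ T, P1N a m b δ U Tm uh T u p v q := by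
  obtain ⟨C, hC, hcon⟩ := Ph1.concl H Tm hTm
  obtain ⟨Tn, cp, hTn, hcp, hlow⟩ := Tlow H hl hh
  have hU := H.U0
  have hb := H.b0
  have hm := H.m0
  have hUus := H.Uus
  have hθ : 0 < 1 / (2 * b) := by positivity
  have hθ2 : 1 / (2 * b) < 1 / b := by gcongr; linarith
  obtain ⟨d1, hd1⟩ : ∃ d, d = min (min (αl - U) U) (min (min cp (a - uh)) (uh - 9 * b * m / 2)) := ⟨_, rfl⟩
  have hd10 : 0 < d1 := by
    rw [hd1]; refine lt_min (lt_min ?_ hU) (lt_min (lt_min hcp ?_) ?_) <;> linarith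
  refine ⟨min 1 (d1 / (2 * C)), by positivity, ?_⟩
  intro δ u p v q hδ hδ0 J hu0 hv0 hA hB
  have hδ1 : δ ≤ 1 := hδ0.le.trans (min_le_left _ _)
  have hCδ : C * δ < d1 := by
    have := hδ0.trans_le (min_le_right _ _)
    rw [lt_div_iff₀ (by positivity)] at this
    nlinarith
  have e1 : C * δ < αl - U := hCδ.trans_le (by
    rw [hd1]; exact (min_le_left _ _).trans (min_le_left _ _))
  have e2 : C * δ < U := hCδ.trans_le (by
    rw [hd1]; exact (min_le_left _ _).trans (min_le_right _ _))
  have e3 : C * δ < cp := hCδ.trans_le (by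
    rw [hd1]; exact (min_le_right _ _).trans ((min_le_left _ _).trans (min_le_left _ _)))
  have e4 : C * δ < a - uh := hCδ.trans_le (by
    rw [hd1]; exact (min_le_right _ _).trans ((min_le_left _ _).trans (min_le_right _ _)))
  have e5 : C * δ < uh - 9 * b * m / 2 := hCδ.trans_le (by
    rw [hd1]; exact (min_le_right _ _).trans (min_le_right _ _))
  have hne : v 0 ≠ 1 / (2 * b) := fun e => hA (bottom_SA H hw hδ J (hl.le.trans hu0.1)
    (hu0.2.trans_lt (hh.trans huh)) hua.le e)
  have hv0' : 1 / (2 * b) < v 0 := lt_of_le_of_ne hv0.1 (Ne.symm hne)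
  -- consequence of not B1
  have hnB : ∀ r, 0 ≤ r → (∀ s ∈ Icc 0 r, 1 / (2 * b) < v s) → u r ≤ uh ∧ v r ≤ 1 / b := by
    intro r hr hs
    by_contra hcn
    apply hB
    refine ⟨r, hr, hs, ?_⟩
    by_contra hcn2
    push Not at hcn2
    exact hcn hcn2
  -- lower bound on u
  have hmk : ∀ T, 0 ≤ T → T ≤ Tm → (∀ r ∈ Icc 0 T, 1 / (2 * b) ≤ v r ∧ v r ≤ 1 / b ∧ u r ≤ uh) →
      Ph1 a m b δ U Tm T u p v q := by
    intro T hT hTT hall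
    have hbt := boot (x := fun r => u r - U) (s := 0) (t := T) (J.uc.sub continuous_const).continuousOn
      (by show 0 < u 0 - U; linarith [hu0.1]) (fun r hr hlt => by
        have hcl : ∀ y ∈ Icc 0 r, U ≤ u y := by
          intro y hy
          have hcl : IsClosed {y | U ≤ u y} := isClosed_le continuous_const J.uc
          have hsub : Ico 0 r ⊆ {y | U ≤ u y} := fun y hy => by
            have := hlt y hy; show U ≤ u y; linarith
          have := closure_minimal hsub hcl
          rw [closure_Ico hr.1.ne] at this
          exact this hy
        have hP : Ph1 a m b δ U Tm r u p v q := ⟨J, hδ, hr.1.le, hr.2.trans hTT,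
          fun y hy => (hall y ⟨hy.1, hy.2.trans hr.2⟩).1,
          fun y hy => (hall y ⟨hy.1, hy.2.trans hr.2⟩).2.1, hcl,
          fun y hy => (hall y ⟨hy.1, hy.2.trans hr.2⟩).2.2.trans hua.le⟩
        have h1 := ((hcon hP hδ1).2.1 r ⟨hr.1.le, le_rfl⟩).1
        have h2 := H.rf.Xge (u 0) hr.1.le
        have h3 := (abs_le.1 h1).1
        have := hu0.1
        linarith)
    exact ⟨J, hδ, hT, hTT, fun y hy => (hall y hy).1, fun y hy => (hall y hy).2.1,
      fun y hy => by have := hbt y hy; linarith, fun y hy => (hall y hy).2.2.trans hua.le⟩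
  have hhit : ∃ r ∈ Icc 0 Tm, v r ≤ 1 / (2 * b) := by
    by_contra hcn
    push Not at hcn
    have hP := hmk Tm hTm.le le_rfl (fun r hr => ⟨(hcn r hr).le,
      (hnB r hr.1 (fun s hs => hcn s ⟨hs.1, hs.2.trans hr.2⟩)).symm⟩)
    have h1 := (abs_le.1 ((hcon hP hδ1).2.1 Tm ⟨hTm.le, le_rfl⟩).1).1
    have h2 := H.rf.Xge2 (u 0) hTm.le
    have h3 := H.rf.hmono hu0.1
    have h4 : h αl * Tm ^ 2 ≤ h (u 0) * Tm ^ 2 := by gcongr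
    have h5 := (hnB Tm hTm.le (fun s hs => hcn s hs)).1
    have := hu0.1
    linarith
  obtain ⟨r0, hr0, hvr0⟩ := hhit
  have hcl : IsCompact (Icc 0 Tm ∩ v ⁻¹' Iic (1 / (2 * b))) :=
    isCompact_Icc.inter_right (isClosed_Iic.preimage J.vc)
  obtain ⟨T, ⟨hT1, hT2⟩, hmin⟩ := hcl.exists_isLeast ⟨r0, hr0, hvr0⟩
  have hT2' : v T ≤ 1 / (2 * b) := hT2
  have hgt : ∀ s ∈ Ico 0 T, 1 / (2 * b) < v s := fun s hs => by
    by_contra hc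
    exact absurd (hmin ⟨⟨hs.1, hs.2.le.trans hT1.2⟩, not_lt.1 hc⟩) (not_le.2 hs.2)
  have hT0 : 0 < T := lt_of_le_of_ne hT1.1 (fun e => by rw [← e] at hT2'; linarith)
  have hvT : v T = 1 / (2 * b) := by
    refine le_antisymm hT2' ?_
    have hcl : IsClosed {y | 1 / (2 * b) ≤ v y} := isClosed_le continuous_const J.vc
    have hsub : Ico 0 T ⊆ {y | 1 / (2 * b) ≤ v y} := fun y hy => (hgt y hy).le
    have := closure_minimal hsub hcl
    rw [closure_Ico hT0.ne] at this
    exact this ⟨hT0.le, le_rfl⟩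
  have hub : ∀ s ∈ Ico 0 T, u s ≤ uh ∧ v s ≤ 1 / b := fun s hs =>
    hnB s hs.1 (fun y hy => hgt y ⟨hy.1, hy.2.trans_lt hs.2⟩)
  have huT : u T ≤ uh := by
    have hcl : IsClosed {y | u y ≤ uh} := isClosed_le J.uc continuous_const
    have hsub : Ico 0 T ⊆ {y | u y ≤ uh} := fun y hy => (hub y hy).1
    have := closure_minimal hsub hcl
    rw [closure_Ico hT0.ne] at this
    exact this ⟨hT0.le, le_rfl⟩
  have hP := hmk T hT0.le hT1.2 (fun r hr => by
    rcases hr.2.eq_or_lt with e | e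
    · rw [e, hvT]; exact ⟨le_rfl, hθ2.le, huT⟩
    · exact ⟨(hgt r ⟨hr.1, e⟩).le, (hub r ⟨hr.1, e⟩).2, (hub r ⟨hr.1, e⟩).1⟩)
  refine ⟨T, hP, hT0, hvT, hgt, fun s hs => ?_, fun s hs => ?_, huT⟩
  · refine lt_of_le_of_ne (hub s hs).2 (fun e => ?_)
    apply hB
    refine top_SB1 hm hb hδ J hs.1 ?_ (fun y hy => hgt y ⟨hy.1, hy.2.trans_lt hs.2⟩) e
    rcases hs.1.eq_or_lt with e0 | e0
    · rw [← e0, J.q0]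
    · have hmax : IsLocalMax v s := by
        filter_upwards [Ioo_mem_nhds e0 hs.2] with y hy
        rw [e]; exact (hub y ⟨hy.1.le, hy.2⟩).2
      have := hmax.hasDerivAt_eq_zero (J.dv s e0)
      field_simp at this; simpa using this
  · refine lt_of_le_of_ne (hub s hs).1 (fun e => ?_)
    have e0 : 0 < s := lt_of_le_of_ne hs.1 (fun e0 => by
      rw [← e0] at e; linarith [hu0.2])
    have hmax : IsLocalMax u s := by
      filter_upwards [Ioo_mem_nhds e0 hs.2] with y hy
      rw [e]; exact (hub y ⟨hy.1.le, hy.2⟩).1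
    have hp := hmax.hasDerivAt_eq_zero (J.du s e0)
    obtain ⟨k1, k2⟩ := (hcon hP hδ1).2.1 s ⟨hs.1, hs.2.le⟩
    rw [abs_le] at k1 k2
    obtain ⟨-, k3⟩ := hlow (u 0) hu0 s hs.1 (by linarith) (by linarith)
    linarith
end


noncomputable def Gu (b v : ℝ) : ℝ := -(v ^ 3 / 3) + b * v ^ 4 / 4

lemma Gu_bd {b v : ℝ} (hb : 0 < b) (h0 : 0 ≤ v) (h1 : v ≤ 1 / (2 * b)) :
    Gu b v ≤ 0 ∧ -(v / (12 * b ^ 2)) ≤ Gu b v := by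
  have h2 : b * v ≤ 1 / 2 := by
    have := mul_le_mul_of_nonneg_left h1 hb.le
    rwa [show b * (1 / (2 * b)) = 1 / 2 by field_simp] at this
  have h3 : v ^ 2 ≤ (1 / (2 * b)) ^ 2 := by gcongr
  have e : Gu b v = -(v ^ 3 * (1 / 3 - b * v / 4)) := by unfold Gu; ring
  have h5 : 0 ≤ v ^ 3 * (1 / 3 - b * v / 4) := mul_nonneg (by positivity) (by linarith)
  refine ⟨by linarith, ?_⟩
  have : v ^ 2 * v ≤ (1 / (2 * b)) ^ 2 * v := by gcongr
  have e2 : v / (12 * b ^ 2) = (1 / (2 * b)) ^ 2 * v / 3 := by field_simp; ring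
  have : 0 ≤ b * v ^ 4 := by positivity
  unfold Gu
  nlinarith

lemma Gf_Lf {m b u w v : ℝ} (hm : 0 < m) (hb : 0 < b) (h0 : 0 ≤ v) (h1 : v ≤ 1 / (2 * b)) (hu : u ≤ w) :
    Lf m b w v ≤ Gf m b v u := by
  have h2 := (Gu_bd hb h0 h1).1
  have e : Gf m b v u - Lf m b w v = m * v ^ 2 / 100 + (w - u) * (-Gu b v) := by
    unfold Gf Lf Gu; ring
  have : 0 ≤ (w - u) * (-Gu b v) := mul_nonneg (by linarith) (by linarith)
  have : 0 ≤ m * v ^ 2 := by positivity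
  linarith

lemma Gf_up {m b u v : ℝ} (hm : 0 < m) (hb : 0 < b) (h0 : 0 ≤ v) (h1 : v ≤ 1 / (2 * b)) (hu : 0 ≤ u) :
    Gf m b v u ≤ m / (4 * b) * v := by
  have h2 := (Gu_bd hb h0 h1).1
  have e : Gf m b v u = m * v / 2 * v + u * Gu b v := by unfold Gf Gu; ring
  have : u * Gu b v ≤ 0 := mul_nonpos_of_nonneg_of_nonpos hu h2
  have : m * v / 2 * v ≤ m * v / 2 * (1 / (2 * b)) := by gcongr
  have e2 : m / (4 * b) * v = m * v / 2 * (1 / (2 * b)) := by field_simp; ring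
  linarith

lemma gc_eq {a m b u v : ℝ} (hu : 0 ≤ u) (hua : u ≤ a) (h0 : 0 ≤ v) (h1 : v ≤ 1 / b) :
    gc a m b u v = m * v - u * v ^ 2 * (1 - b * v) := by
  rw [gc, cl_eq hu hua, cl_eq h0 h1]

section
variable {a m b δ : ℝ} {u p v q : ℝ → ℝ}

lemma Tj.dY (J : Tj a m b δ u p v q) {r : ℝ} (hr : 0 < r) (hu : 0 ≤ u r) (hua : u r ≤ a)
    (h0 : 0 ≤ v r) (h1 : v r ≤ 1 / b) :
    HasDerivAt (fun r => q r ^ 2 / 2 - Gf m b (v r) (u r)) (-(q r ^ 2 / r) - Gu b (v r) * p r) r := by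
  have hq := J.dq' r hr
  rw [gc_eq hu hua h0 h1] at hq
  have hv := J.dv r hr
  have hu' := J.du r hr
  unfold Gf
  convert! ((hq.pow 2).div_const 2).sub ((((hv.pow 2).const_mul m).div_const 2).sub
    ((hu'.mul (hv.pow 3)).div_const 3) |>.add (((hu'.const_mul b).mul (hv.pow 4)).div_const 4)) using 1
  simp only [Pi.pow_apply, Pi.mul_apply]
  unfold Gu
  push_cast
  ring

lemma Tj.dr2Y (J : Tj a m b δ u p v q) {r : ℝ} (hr : 0 < r) (hu : 0 ≤ u r) (hua : u r ≤ a)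
    (h0 : 0 ≤ v r) (h1 : v r ≤ 1 / b) :
    HasDerivAt (fun r => r ^ 2 * (q r ^ 2 / 2 - Gf m b (v r) (u r)))
      (-(2 * r * Gf m b (v r) (u r)) - r ^ 2 * (Gu b (v r) * p r)) r := by
  convert! ((hasDerivAt_id r).pow 2).mul (J.dY hr hu hua h0 h1) using 1
  simp
  field_simp
  ring

lemma Tj.Yc (J : Tj a m b δ u p v q) : Continuous (fun r => q r ^ 2 / 2 - Gf m b (v r) (u r)) := by
  have := J.uc; have := J.vc; have := J.qc
  unfold Gf; fun_prop

end

section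
variable {a m b U cV CV L : ℝ} {V V1 V2 h : ℝ → ℝ} {X P : ℝ → ℝ → ℝ}

/-- the function Γ(u) = -G(V(u),u) -/
lemma Gam (H : Par a m b U cV CV L V V1 V2 h X P) {x y : ℝ} (hx : U ≤ x) (hxy : x ≤ y) :
    (y - x) / (96 * b ^ 3) ≤ Gf m b (V x) x - Gf m b (V y) y ∧
    Gf m b (V x) x - Gf m b (V y) y ≤ (y - x) / (3 * b ^ 3) := by
  have hb := H.b0
  have hd : ∀ z, U ≤ z → HasDerivAt (fun z => Gf m b (V z) z) (Gu b (V z)) z := by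
    intro z hz
    have hV := H.dV z hz
    unfold Gf
    convert! ((((hV.pow 2).const_mul m).div_const 2).sub
      (((hasDerivAt_id z).mul (hV.pow 3)).div_const 3) |>.add
      ((((hasDerivAt_id z).const_mul b).mul (hV.pow 4)).div_const 4)) using 1
    simp only [Pi.pow_apply, Pi.mul_apply, id]
    rw [← H.Veq z hz]
    unfold Gu
    push_cast
    ring
  have hG : ∀ z, U ≤ z → -(1 / (3 * b ^ 3)) ≤ Gu b (V z) ∧ Gu b (V z) ≤ -(1 / (96 * b ^ 3)) := by
    intro z hz
    have h1 := H.Vlo z hz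
    have h2 := H.Vhi z hz
    have hc := H.cV0
    have h3 : 1 / (2 * b) ≤ V z := by linarith
    have h0 : 0 < V z := lt_of_lt_of_le (by positivity) h3
    have k1 : (1 / (2 * b)) ^ 3 ≤ V z ^ 3 := by gcongr
    have k2 : V z ^ 3 ≤ (1 / b) ^ 3 := by gcongr
    have k3 : b * V z ≤ 1 := by
      have := mul_le_mul_of_nonneg_left h2 hb.le
      rwa [mul_one_div_cancel hb.ne'] at this
    have e : Gu b (V z) = -(V z ^ 3 * (1 / 3 - b * V z / 4)) := by unfold Gu; ring
    have e1 : 1 / (96 * b ^ 3) = (1 / (2 * b)) ^ 3 / 12 := by field_simp; ring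
    have e2 : 1 / (3 * b ^ 3) = (1 / b) ^ 3 / 3 := by field_simp
    have k4 : 0 < V z ^ 3 := by positivity
    have k5 : 0 < b * V z := by positivity
    rw [e, e1, e2]
    constructor <;> nlinarith
  have hc : ContinuousOn (fun z => Gf m b (V z) z) (Icc x y) := fun z hz =>
    (hd z (hx.trans hz.1)).continuousAt.continuousWithinAt
  have g1 := incr_ge hxy hc (fun r hr => hd r (hx.trans hr.1.le)) (fun r hr => (hG r (hx.trans hr.1.le)).1)
  have g2 := incr_le hxy hc (fun r hr => hd r (hx.trans hr.1.le)) (fun r hr => (hG r (hx.trans hr.1.le)).2)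
  have e3 : (y - x) / (96 * b ^ 3) = 1 / (96 * b ^ 3) * (y - x) := by ring
  have e4 : (y - x) / (3 * b ^ 3) = 1 / (3 * b ^ 3) * (y - x) := by ring
  rw [e3, e4]
  constructor <;> linarith

lemma Gam0 (H : Par a m b U cV CV L V V1 V2 h X P) : Gf m b (V (9 * b * m / 2)) (9 * b * m / 2) = 0 := by
  have hb := H.b0
  rw [H.Vus]; unfold Gf; field_simp; ring

noncomputable def Cpf (a b Tm : ℝ) : ℝ := (a + (a + a * (1 / b) ^ 2) * (Tm + 1)) * exp (2 * (Tm + 1))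

lemma Cpf_pos {a b Tm : ℝ} (ha : 0 < a) (hT : 0 < Tm) : 0 < Cpf a b Tm := by
  unfold Cpf; positivity

/-- constants of the windows -/
structure Wc (a b U Tm uh w τ : ℝ) : Prop where
  t0 : 0 < τ
  t1 : τ ≤ 1
  t2 : Cpf a b Tm * τ ≤ U / 2
  t3 : Cpf a b Tm * τ ≤ w - uh
  wa : w ≤ a
  Tm0 : 0 < Tm
  ua : uh < a

lemma P1N.win (H : Par a m b U cV CV L V V1 V2 h X P) {δ Tm uh T w τ : ℝ} {u p v q : ℝ → ℝ}
    (N : P1N a m b δ U Tm uh T u p v q) (W : Wc a b U Tm uh w τ) :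
    ∀ r ∈ Icc T (T + τ), U / 2 ≤ u r ∧ u r ≤ w ∧ |p r| ≤ Cpf a b Tm := by
  have J := N.ph.tj
  have hT := N.T0
  have ha := H.a0
  have hb := H.b0
  have hu0 : |u 0| ≤ a := by
    rw [abs_le]
    have := N.ph.ulo 0 ⟨le_rfl, hT.le⟩
    have := N.ph.uhi 0 ⟨le_rfl, hT.le⟩
    have := H.U0
    constructor <;> linarith
  have hp : ∀ r ∈ Icc T (T + τ), |p r| ≤ Cpf a b Tm := fun r hr => by
    have := (J.ub ha hb (R := Tm + 1) r ⟨hT.le.trans hr.1, by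
      have := N.ph.TTm; have := hr.2; have := W.t1; linarith⟩).2
    have hTm := W.Tm0
    refine this.trans ?_
    unfold Cpf
    gcongr
  have hC := Cpf_pos (b := b) ha W.Tm0
  intro r hr
  have sub : ∀ s ∈ Ioo T r, s ∈ Icc T (T + τ) := fun s hs => ⟨hs.1.le, hs.2.le.trans hr.2⟩
  have g1 := incr_ge hr.1 J.uc.continuousOn (fun s hs => J.du s (hT.trans hs.1))
    (fun s hs => (abs_le.1 (hp s (sub s hs))).1)
  have g2 := incr_le hr.1 J.uc.continuousOn (fun s hs => J.du s (hT.trans hs.1))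
    (fun s hs => (abs_le.1 (hp s (sub s hs))).2)
  have g3 : Cpf a b Tm * (r - T) ≤ Cpf a b Tm * τ := by
    have := hr.2
    gcongr; linarith
  have := W.t2; have := W.t3; have := N.uT
  have := N.ph.ulo T ⟨hT.le, le_rfl⟩
  exact ⟨by linarith, by linarith, hp r hr⟩

lemma P1N.qT {δ Tm uh T : ℝ} {u p v q : ℝ → ℝ} (N : P1N a m b δ U Tm uh T u p v q) : q T ≤ 0 := by
  have J := N.ph.tj
  have hδ := N.ph.d0
  by_contra hc
  have h1 := J.qc.continuousAt (x := T) |>.eventually (lt_mem_nhds (not_le.1 hc))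
  obtain ⟨l, hl, hl2⟩ := (mem_nhdsLE_iff_exists_Ioc_subset' N.T0).1 (mem_nhdsWithin_of_mem_nhds h1)
  obtain ⟨s, hs1, hs2⟩ := exists_between (max_lt hl N.T0)
  have hs0 := (le_max_right _ _).trans_lt hs1
  have := smono_of_d (s := s) (t := T) J.vc.continuousOn (fun r hr => J.dv r (hs0.trans hr.1))
    (fun r hr => div_pos (hl2 ⟨(le_max_left _ _).trans_lt (hs1.trans hr.1), hr.2.le⟩) hδ)
    ⟨le_rfl, hs2.le⟩ ⟨hs2.le, le_rfl⟩ hs2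
  have h2 := N.vgt s ⟨hs0.le, hs2⟩
  rw [N.vT] at this
  linarith

lemma P1N.SB2_zero {δ Tm uh T w : ℝ} {u p v q : ℝ → ℝ} (N : P1N a m b δ U Tm uh T u p v q) {r1 : ℝ}
    (hr1 : T ≤ r1) (hv : v r1 = 0) (hq : q r1 < 0)
    (hL : ∀ s ∈ Icc T r1, Lf m b w (v s) - q s ^ 2 / 2 < 0) : SB2 m b w v q := by
  have J := N.ph.tj
  have hδ := N.ph.d0
  have hr0 := N.T0.trans_le hr1
  have h1 := J.qc.continuousAt (x := r1) |>.eventually (gt_mem_nhds hq)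
  obtain ⟨l, hl, hl2⟩ := mem_nhdsGE_iff_exists_Icc_subset.1
    (mem_nhdsWithin_of_mem_nhds h1)
  have han := santi_of_d (s := r1) (t := l) J.vc.continuousOn (fun r hr => J.dv r (hr0.trans hr.1))
    (fun r hr => div_neg_of_neg_of_pos (hl2 ⟨hr.1.le, hr.2.le⟩) hδ)
  have hlt : ∀ s ∈ Ioc r1 l, v s < 0 := fun s hs => by
    have := han ⟨le_rfl, hs.1.le.trans hs.2⟩ ⟨hs.1.le, hs.2⟩ hs.1
    rwa [hv] at this
  refine ⟨l, (hr0.trans hl).le, hlt l ⟨hl, le_rfl⟩, fun s hs => ?_⟩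
  rcases lt_or_ge s T with h | h
  · exact Or.inr (Or.inl (N.vgt s ⟨hs.1, h⟩))
  · rcases le_or_gt s r1 with h' | h'
    · exact Or.inr (Or.inr (hL s ⟨h, h'⟩))
    · exact Or.inl (hlt s ⟨h', hs.2⟩)

end


section
variable {a m b U cV CV L : ℝ} {V V1 V2 h : ℝ → ℝ} {X P : ℝ → ℝ → ℝ}

set_option maxHeartbeats 1000000 in
lemma P1N.ult' (H : Par a m b U cV CV L V V1 V2 h X P) {αl αh uh w Tm τ : ℝ} (hl : U < αl)
    (hh : αh < 9 * b * m / 2) (huh : 9 * b * m / 2 < uh)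
    (hw : w ≤ 51 / 50 * (9 * b * m / 2)) (W : Wc a b U Tm uh w τ) :
    ∃ δ0, 0 < δ0 ∧ ∀ {δ T : ℝ} {u p v q : ℝ → ℝ}, δ < δ0 → P1N a m b δ U Tm uh T u p v q →
      u 0 ∈ Icc αl αh → ¬ SB2 m b w v q → u T < uh := by
  have hTm := W.Tm0
  obtain ⟨C, hC, hcon⟩ := Ph1.concl H Tm hTm
  obtain ⟨Tn, cp, hTn, hcp, hlow⟩ := Tlow H hl hh
  have ha := H.a0
  have hb := H.b0
  have hm := H.m0
  have hU := H.U0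
  obtain ⟨κ, hκ⟩ : ∃ κ, κ = (uh - 9 * b * m / 2) / (192 * b ^ 3) := ⟨_, rfl⟩
  have hκ0 : 0 < κ := by rw [hκ]; have := sub_pos.2 huh; positivity
  obtain ⟨Cp, hCp⟩ : ∃ C, C = Cpf a b Tm := ⟨_, rfl⟩
  have hCp0 : 0 < Cp := hCp ▸ Cpf_pos ha hTm
  -- derivative bound for r^2 Y
  obtain ⟨C1, hC1⟩ : ∃ C, C = 2 * (Tm + 1) * (m / (4 * b) * (1 / (2 * b))) +
    (Tm + 1) ^ 2 * ((1 / (2 * b)) / (12 * b ^ 2) * Cp) := ⟨_, rfl⟩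
  have hC10 : 0 < C1 := by rw [hC1]; positivity
  obtain ⟨σ, hσ⟩ : ∃ σ, σ = min τ (Tn ^ 2 * κ / (2 * C1)) := ⟨_, rfl⟩
  have hσ0 : 0 < σ := by rw [hσ]; exact lt_min W.t0 (by positivity)
  have hστ : σ ≤ τ := hσ ▸ min_le_left _ _
  have hσC : C1 * σ ≤ Tn ^ 2 * κ / 2 := by
    have : σ ≤ Tn ^ 2 * κ / (2 * C1) := hσ ▸ min_le_right _ _
    rw [le_div_iff₀ (by positivity)] at this
    linarith
  obtain ⟨k, hk⟩ : ∃ k, k = Tn ^ 2 * κ / (2 * (Tm + 1) ^ 2) := ⟨_, rfl⟩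
  have hk0 : 0 < k := by rw [hk]; positivity
  obtain ⟨c, hc⟩ : ∃ c, c = √(2 * k) := ⟨_, rfl⟩
  have hc0 : 0 < c := by rw [hc]; positivity
  have hc2 : c ^ 2 = 2 * k := by rw [hc, sq_sqrt (by positivity)]
  refine ⟨min (min 1 (κ * Tn ^ 2 / C)) (min ((uh - 9 * b * m / 2) / C) (σ * c / (1 / (2 * b)))), by
    have := sub_pos.2 huh
    positivity, ?_⟩
  intro δ T u p v q hδ0 N hu0 hB
  have hδ1 : δ ≤ 1 := hδ0.le.trans ((min_le_left _ _).trans (min_le_left _ _))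
  have hδ2 : δ * C < κ * Tn ^ 2 := by
    have := hδ0.trans_le ((min_le_left _ _).trans (min_le_right _ _))
    rwa [lt_div_iff₀ hC] at this
  have hδ3 : δ * C < uh - 9 * b * m / 2 := by
    have := hδ0.trans_le ((min_le_right _ _).trans (min_le_left _ _))
    rwa [lt_div_iff₀ hC] at this
  have hδ4 : δ * (1 / (2 * b)) < σ * c := by
    have := hδ0.trans_le ((min_le_right _ _).trans (min_le_right _ _))
    rwa [lt_div_iff₀ (by positivity)] at this
  have J := N.ph.tj
  have hδ := N.ph.d0
  have hT0 := N.T0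
  have hwin := N.win H W
  by_contra hcn
  have huT : u T = uh := le_antisymm N.uT (not_lt.1 hcn)
  obtain ⟨-, k2, -, k4⟩ := hcon N.ph hδ1
  have hUus := H.Uus
  have hTnT : Tn ≤ T := by
    have h1 := (k2 T ⟨hT0.le, le_rfl⟩).1
    rw [abs_le] at h1
    rcases le_or_gt (X (u 0) T) a with hX | hX
    · exact (hlow (u 0) hu0 T hT0.le (by linarith) hX).1
    · obtain ⟨s, hs, hs2⟩ := intermediate_value_Icc hT0.le
        (f := X (u 0)) (H.rf.Xc' (u 0)).continuousOn (show a ∈ Icc _ _ from ⟨by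
          rw [H.rf.X0]; linarith [hu0.2, H.usa], hX.le⟩)
      exact (hlow (u 0) hu0 s hs.1 (by rw [hs2]; linarith [H.usa]) hs2.le).1.trans hs.2
  have hY : T ^ 2 * κ ≤ T ^ 2 * (q T ^ 2 / 2 - Gf m b (v T) (u T)) := by
    have g1 := (Gam H hUus.le huh.le).1
    rw [Gam0 H] at g1
    rw [huT] at k4 ⊢
    have e : (uh - 9 * b * m / 2) / (96 * b ^ 3) = 2 * κ := by rw [hκ]; field_simp; ring
    rw [e] at g1
    have g2 : T ^ 2 * (2 * κ) ≤ T ^ 2 * (0 - Gf m b (V uh) uh) := by gcongr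
    have g3 : κ * Tn ^ 2 ≤ κ * T ^ 2 := by gcongr
    linarith
  have hqT : q T < 0 := by
    refine lt_of_le_of_ne N.qT (fun e => ?_)
    rw [e, N.vT] at hY
    have h1 := Gf_Lf hm hb (by positivity) le_rfl (hwin T ⟨le_rfl, by linarith [W.t0]⟩).2.1
    have h2 := Lf_lower hm hb hw (v := 1 / (2 * b)) (by positivity) le_rfl
    have h3 := le_of_mul_le_mul_left hY (by positivity)
    have : 0 < m / 100 * (1 / (2 * b)) ^ 2 := by positivity
    linarith
  -- main claim
  have main : ∀ r1 ∈ Icc T (T + σ), (∀ s ∈ Icc T r1, 0 ≤ v s) →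
      ∀ s ∈ Icc T r1, q s ≤ -c ∧ Lf m b w (v s) - q s ^ 2 / 2 < 0 := by
    intro r1 hr1 hv0
    have step : ∀ r ∈ Icc T r1, (∀ y ∈ Ico T r, 0 < -q y) → q r ≤ -c ∧
        Lf m b w (v r) - q r ^ 2 / 2 < 0 := by
      intro r hr hq
      have han := anti_of_d (s := T) (t := r) J.vc.continuousOn (fun s hs => J.dv s (hT0.trans hs.1))
        (fun s hs => div_nonpos_of_nonpos_of_nonneg (by linarith [hq s ⟨hs.1.le, hs.2⟩]) hδ.le)
      have hvθ : ∀ s ∈ Icc T r, v s ≤ 1 / (2 * b) := fun s hs => by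
        rw [← N.vT]; exact han ⟨le_rfl, hr.1⟩ hs hs.1
      have hin : ∀ s ∈ Icc T r, s ∈ Icc T (T + τ) := fun s hs =>
        ⟨hs.1, hs.2.trans (hr.2.trans (hr1.2.trans (by linarith)))⟩
      have hθ2 : 1 / (2 * b) ≤ 1 / b := by gcongr; linarith
      have hmono := incr_ge (c := -C1) hr.1 ((continuous_pow 2).mul J.Yc).continuousOn
        (fun s hs => by
          have hs' : s ∈ Icc T r := ⟨hs.1.le, hs.2.le⟩
          have w1 := hwin s (hin s hs')
          exact J.dr2Y (hT0.trans hs.1) (by linarith [w1.1]) (w1.2.1.trans W.wa)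
            (hv0 s ⟨hs'.1, hs'.2.trans hr.2⟩) ((hvθ s hs').trans hθ2))
        (fun s hs => by
          have hs' : s ∈ Icc T r := ⟨hs.1.le, hs.2.le⟩
          have w1 := hwin s (hin s hs')
          have v0 := hv0 s ⟨hs'.1, hs'.2.trans hr.2⟩
          have v1 := hvθ s hs'
          have hs0 := hT0.trans hs.1
          have hsT : s ≤ Tm + 1 := by
            have := (hin s hs').2; have := W.t1; have := N.ph.TTm; linarith
          have g1 := Gf_up hm hb v0 v1 (u := u s) (by linarith [w1.1])
          have g2 : m / (4 * b) * v s ≤ m / (4 * b) * (1 / (2 * b)) := by gcongr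
          have g3 : 2 * s * Gf m b (v s) (u s) ≤ 2 * (Tm + 1) * (m / (4 * b) * (1 / (2 * b))) := by
            refine (mul_le_mul_of_nonneg_left (g1.trans g2) (by positivity)).trans ?_
            gcongr
          have g4 := Gu_bd hb v0 v1
          have g5 : |Gu b (v s) * p s| ≤ (1 / (2 * b)) / (12 * b ^ 2) * Cp := by
            rw [abs_mul, abs_of_nonpos g4.1, hCp]
            have : v s / (12 * b ^ 2) ≤ (1 / (2 * b)) / (12 * b ^ 2) := by gcongr
            have : -Gu b (v s) ≤ (1 / (2 * b)) / (12 * b ^ 2) := by linarith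
            have h3 := w1.2.2
            gcongr
          have g6 : s ^ 2 * (Gu b (v s) * p s) ≤ (Tm + 1) ^ 2 * ((1 / (2 * b)) / (12 * b ^ 2) * Cp) := by
            refine (mul_le_mul_of_nonneg_left ((le_abs_self _).trans g5) (by positivity)).trans ?_
            gcongr
          rw [hC1]; linarith)
      have h1 : C1 * (r - T) ≤ C1 * σ := by
        have := hr.2.trans hr1.2
        gcongr; linarith
      have h2 : κ * Tn ^ 2 ≤ κ * T ^ 2 := by gcongr
      have h3 : Tn ^ 2 * κ / 2 ≤ r ^ 2 * (q r ^ 2 / 2 - Gf m b (v r) (u r)) := by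
        simp only [Pi.mul_apply] at hmono; linarith
      have hr0 := hT0.trans_le hr.1
      have hrT : r ≤ Tm + 1 := by
        have := hr.2.trans hr1.2; have := W.t1; have := N.ph.TTm; linarith
      have h4 : k ≤ q r ^ 2 / 2 - Gf m b (v r) (u r) := by
        by_contra hcn
        have h5 : r ^ 2 * (q r ^ 2 / 2 - Gf m b (v r) (u r)) < r ^ 2 * k :=
          mul_lt_mul_of_pos_left (not_le.1 hcn) (by positivity)
        have h6 : r ^ 2 * k ≤ (Tm + 1) ^ 2 * k := by gcongr
        have h7 : (Tm + 1) ^ 2 * k = Tn ^ 2 * κ / 2 := by rw [hk]; field_simp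
        linarith
      have hv1 := hv0 r hr
      have hv2 := hvθ r ⟨hr.1, le_rfl⟩
      have h8 := Gf_Lf hm hb hv1 hv2 (hwin r (hin r ⟨hr.1, le_rfl⟩)).2.1
      have h9 := Lf_lower hm hb hw hv1 hv2
      have : 0 ≤ m / 100 * v r ^ 2 := by positivity
      refine ⟨?_, by linarith⟩
      have hq0 : q r ≤ 0 := by
        rcases hr.1.eq_or_lt with e | e
        · rw [← e]; exact hqT.le
        · have hcl : IsClosed {y | q y ≤ 0} := isClosed_le J.qc continuous_const
          have hsub : Ico T r ⊆ {y | q y ≤ 0} := fun y hy => by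
            have := hq y hy; show q y ≤ 0; linarith
          have := closure_minimal hsub hcl
          rw [closure_Ico e.ne] at this
          exact this ⟨hr.1, le_rfl⟩
      have h10 : c ^ 2 ≤ (-q r) ^ 2 := by rw [hc2, neg_sq]; linarith
      have := (sq_le_sq₀ hc0.le (by linarith)).1 h10
      linarith
    have hbt := boot (x := fun r => -q r) (s := T) (t := r1) J.qc.neg.continuousOn
      (by show 0 < -q T; linarith) (fun r hr hy => by
        have := (step r ⟨hr.1.le, hr.2⟩ hy).1
        show 0 < -q r; linarith)
    intro s hs
    exact step s hs (fun y hy => hbt y ⟨hy.1, hy.2.le.trans hs.2⟩)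
  -- v hits zero
  have hex : ∃ r ∈ Icc T (T + σ), v r ≤ 0 := by
    by_contra hcn2
    push Not at hcn2
    have hm1 := main (T + σ) ⟨by linarith, le_rfl⟩ (fun s hs => (hcn2 s hs).le)
    have := incr_le (s := T) (t := T + σ) (c := -c / δ) (by linarith) J.vc.continuousOn
      (fun s hs => J.dv s (hT0.trans hs.1)) (fun s hs => by
        have := (hm1 s ⟨hs.1.le, hs.2.le⟩).1
        gcongr)
    have h1 := hcn2 (T + σ) ⟨by linarith, le_rfl⟩
    rw [N.vT] at this
    have e : -c / δ * (T + σ - T) = -(σ * c / δ) := by ring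
    rw [e] at this
    have : 1 / (2 * b) < σ * c / δ := by rw [lt_div_iff₀ hδ]; linarith
    linarith
  obtain ⟨r0, hr0, hvr0⟩ := hex
  have hcl : IsCompact (Icc T (T + σ) ∩ v ⁻¹' Iic 0) :=
    isCompact_Icc.inter_right (isClosed_Iic.preimage J.vc)
  obtain ⟨r1, ⟨hr1, hv1⟩, hmin⟩ := hcl.exists_isLeast ⟨r0, hr0, hvr0⟩
  have hv1' : v r1 ≤ 0 := hv1
  have hpos : ∀ s ∈ Ico T r1, 0 < v s := fun s hs => by
    by_contra hc
    exact absurd (hmin ⟨⟨hs.1, hs.2.le.trans hr1.2⟩, not_lt.1 hc⟩) (not_le.2 hs.2)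
  have hTr : T < r1 := lt_of_le_of_ne hr1.1 (fun e => by
    rw [← e, N.vT] at hv1'
    have : 0 < 1 / (2 * b) := by positivity
    linarith)
  have hnn : ∀ s ∈ Icc T r1, 0 ≤ v s := by
    have hcl : IsClosed {y | 0 ≤ v y} := isClosed_le continuous_const J.vc
    have hsub : Ico T r1 ⊆ {y | 0 ≤ v y} := fun y hy => (hpos y hy).le
    have := closure_minimal hsub hcl
    rw [closure_Ico hTr.ne] at this
    exact this
  have hmain := main r1 hr1 hnn
  exact hB (N.SB2_zero hr1.1 (le_antisymm hv1' (hnn r1 ⟨hr1.1, le_rfl⟩))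
    (by have := (hmain r1 ⟨hr1.1, le_rfl⟩).1; linarith) (fun s hs => (hmain s hs).2))
end


section
variable {a m b δ : ℝ} {u p v q : ℝ → ℝ}

lemma Tj.dec (J : Tj a m b δ u p v q) (hδ : 0 < δ) {s : ℝ} (hs : 0 < s) (hq : q s < 0) {ε : ℝ}
    (hε : 0 < ε) : ∃ t, s < t ∧ t < s + ε ∧ ∀ r ∈ Ioc s t, v r < v s := by
  have h1 := J.qc.continuousAt (x := s) |>.eventually (gt_mem_nhds hq)
  obtain ⟨l, hl, hl2⟩ := mem_nhdsGE_iff_exists_Icc_subset.1 (mem_nhdsWithin_of_mem_nhds h1)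
  have han := santi_of_d (s := s) (t := l) J.vc.continuousOn (fun r hr => J.dv r (hs.trans hr.1))
    (fun r hr => div_neg_of_neg_of_pos (hl2 ⟨hr.1.le, hr.2.le⟩) hδ)
  have hl' : s < l := hl
  refine ⟨min l (s + ε / 2), lt_min hl' (by linarith), (min_le_right _ _).trans_lt (by linarith), ?_⟩
  intro r hr
  exact han ⟨le_rfl, hl'.le⟩ ⟨hr.1.le, hr.2.trans (min_le_left _ _)⟩ hr.1

lemma Tj.decay (J : Tj a m b δ u p v q) (hδ : 0 < δ) {c T r : ℝ} (hT : 0 < T) (hr : T ≤ r)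
    (h : ∀ s ∈ Ioo T r, q s ≤ -(c * v s)) : v r ≤ v T * exp (-(c * (r - T) / δ)) := by
  have := anti_of_d (f := fun s => v s * exp (c * (s - T) / δ))
    (f' := fun s => (q s + c * v s) / δ * exp (c * (s - T) / δ)) (s := T) (t := r)
    (by have := J.vc; fun_prop) (fun s hs => by
      have h1 : HasDerivAt (fun s => c * (s - T) / δ) (c / δ) s := by
        convert! (((hasDerivAt_id s).sub_const T).const_mul c).div_const δ using 1; simp
      convert! (J.dv s (hT.trans hs.1)).mul h1.exp using 1
      ring) (fun s hs => mul_nonpos_of_nonpos_of_nonneg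
        (div_nonpos_of_nonpos_of_nonneg (by linarith [h s hs]) hδ.le) (exp_pos _).le)
    ⟨le_rfl, hr⟩ ⟨hr, le_rfl⟩ hr
  simp only [sub_self, mul_zero, zero_div, exp_zero, mul_one] at this
  rw [exp_neg, ← div_eq_mul_inv, le_div_iff₀ (exp_pos _)]
  exact this

lemma Tj.dPsi (J : Tj a m b δ u p v q) (w : ℝ) {r : ℝ} (hr : 0 < r) :
    HasDerivAt (fun r => Lf m b w (v r) - q r ^ 2 / 2)
      (q r / δ * (49 / 50 * m * v r - w * v r ^ 2 + b * w * v r ^ 3 - gc a m b (u r) (v r)) + q r ^ 2 / r) r := by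
  convert! ((Lf_der m b w (v r)).comp r (J.dv r hr)).sub (((J.dq' r hr).pow 2).div_const 2) using 1
  push_cast
  ring

lemma Tj.Psic (J : Tj a m b δ u p v q) (w : ℝ) : Continuous (fun r => Lf m b w (v r) - q r ^ 2 / 2) :=
  ((Lf_cont m b w).comp J.vc).sub ((J.qc.pow 2).div_const 2)

/-- v and q cannot vanish simultaneously -/
lemma Tj.nz (J : Tj a m b δ u p v q) (ha : 0 < a) (hm : 0 < m) (hb : 0 < b) (hδ : 0 < δ) {T r : ℝ}
    (hT : 0 < T) (hr : T ≤ r)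
    (hv : ∀ s ∈ Icc T r, 0 ≤ v s ∧ v s ≤ 1 / b) (h0 : 0 < v T) : 0 < v r ^ 2 + q r ^ 2 := by
  obtain ⟨K, hK⟩ : ∃ K, K = (1 + (m + a / b)) / δ + 2 / T := ⟨_, rfl⟩
  have := mono_of_d (f := fun s => (v s ^ 2 + q s ^ 2) * exp (K * s))
    (f' := fun s => (2 * v s * (q s / δ) + 2 * q s * (gc a m b (u s) (v s) / δ - q s / s) +
      K * (v s ^ 2 + q s ^ 2)) * exp (K * s)) (s := T) (t := r)
    (by have := J.vc; have := J.qc; fun_prop) (fun s hs => by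
      have hs0 := hT.trans hs.1
      have h1 : HasDerivAt (fun s => K * s) K s := by
        convert! (hasDerivAt_id s).const_mul K using 1; simp
      convert! (((J.dv s hs0).pow 2).add ((J.dq' s hs0).pow 2)).mul h1.exp using 1
      simp only [Pi.pow_apply, Pi.add_apply]
      push_cast
      ring) (fun s hs => by
      refine mul_nonneg ?_ (exp_pos _).le
      have hs0 := hT.trans hs.1
      obtain ⟨v0, v1⟩ := hv s ⟨hs.1.le, hs.2.le⟩
      have hbv : b * v s ≤ 1 := by
        have := mul_le_mul_of_nonneg_left v1 hb.le
        rwa [mul_one_div_cancel hb.ne'] at this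
      have hg : |gc a m b (u s) (v s)| ≤ (m + a / b) * v s := by
        rw [gc, cl_eq v0 v1]
        obtain ⟨c0, c1⟩ := cl_bd (x := u s) ha.le
        have k1 : cl a (u s) * v s ^ 2 * (1 - b * v s) ≤ a * (v s * (1 / b)) * 1 := by
          have : v s ^ 2 ≤ v s * (1 / b) := by rw [sq]; gcongr
          have : 0 ≤ b * v s := by positivity
          gcongr
          · linarith
        have k2 : 0 ≤ cl a (u s) * v s ^ 2 * (1 - b * v s) := mul_nonneg (by positivity) (by linarith)
        have k3 : 0 ≤ m * v s := by positivity
        have e : a * (v s * (1 / b)) * 1 = a / b * v s := by ring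
        have k4 : 0 ≤ a / b * v s := by positivity
        rw [abs_le]
        constructor <;> linarith
      have h2 : |v s * q s| ≤ (v s ^ 2 + q s ^ 2) / 2 := by
        rw [abs_le]; constructor <;> nlinarith [sq_nonneg (v s + q s), sq_nonneg (v s - q s)]
      have h3 : |q s * gc a m b (u s) (v s)| ≤ (m + a / b) * ((v s ^ 2 + q s ^ 2) / 2) := by
        calc |q s * gc a m b (u s) (v s)| ≤ |q s| * ((m + a / b) * v s) := by rw [abs_mul]; gcongr
          _ = (m + a / b) * |v s * q s| := by rw [abs_mul, abs_of_nonneg v0]; ring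
          _ ≤ _ := by gcongr
      have h4 : q s ^ 2 / s ≤ (v s ^ 2 + q s ^ 2) / T := by
        have := hs.1.le
        gcongr
        nlinarith [sq_nonneg (v s)]
      have h5 := (abs_le.1 h2).1
      have h6 := (abs_le.1 h3).1
      have e : 2 * v s * (q s / δ) + 2 * q s * (gc a m b (u s) (v s) / δ - q s / s) +
        K * (v s ^ 2 + q s ^ 2) = 2 * ((v s * q s + q s * gc a m b (u s) (v s) +
          (v s ^ 2 + q s ^ 2) / 2 + (m + a / b) * ((v s ^ 2 + q s ^ 2) / 2)) / δ) +
          2 * ((v s ^ 2 + q s ^ 2) / T - q s ^ 2 / s) := by rw [hK]; ring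
      rw [e]
      have : 0 ≤ (v s * q s + q s * gc a m b (u s) (v s) +
          (v s ^ 2 + q s ^ 2) / 2 + (m + a / b) * ((v s ^ 2 + q s ^ 2) / 2)) / δ :=
        div_nonneg (by linarith) hδ.le
      linarith)
    ⟨le_rfl, hr⟩ ⟨hr, le_rfl⟩ hr
  have h1 : 0 < (v T ^ 2 + q T ^ 2) * exp (K * T) := by positivity
  exact pos_of_mul_pos_left (h1.trans_le this) (exp_pos _).le
end

section
variable {a m b U cV CV L : ℝ} {V V1 V2 h : ℝ → ℝ} {X P : ℝ → ℝ → ℝ}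

lemma P1N.SA_mk (hb : 0 < b) {δ Tm uh T w : ℝ} {u p v q : ℝ → ℝ}
    (N : P1N a m b δ U Tm uh T u p v q) (huT : u T < uh) {r0 : ℝ} (hr0 : T ≤ r0)
    (hv : ∀ s ∈ Ioc T r0, 0 < v s ∧ v s < 1 / (2 * b))
    (hdec : ∀ ε, 0 < ε → ∃ t, r0 < t ∧ t < r0 + ε ∧ ∀ r ∈ Ioc r0 t, v r < v r0)
    (hP : ∀ᶠ r in nhdsWithin r0 (Ioi r0), 0 < Lf m b w (v r) - q r ^ 2 / 2) : SA m b w uh u v q := by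
  have J := N.ph.tj
  have hθ : 0 < 1 / (2 * b) := by positivity
  have hθ2 : 1 / (2 * b) < 1 / b := by gcongr; linarith
  have hv0 : 0 < v r0 ∧ v r0 ≤ 1 / (2 * b) := by
    rcases hr0.eq_or_lt with e | e
    · rw [← e, N.vT]; exact ⟨hθ, le_rfl⟩
    · exact ⟨(hv r0 ⟨e, le_rfl⟩).1, (hv r0 ⟨e, le_rfl⟩).2.le⟩
  have h1 := J.vc.continuousAt (x := r0) |>.eventually (lt_mem_nhds hv0.1)
  obtain ⟨l, hl, hl2⟩ := mem_nhdsGT_iff_exists_Ioo_subset.1 (hP.and (h1.filter_mono nhdsWithin_le_nhds))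
  have hl' : r0 < l := hl
  obtain ⟨t, t1, t2, t3⟩ := hdec (l - r0) (by linarith)
  have hT0 := N.T0
  refine ⟨t, by linarith, (t3 t ⟨t1, le_rfl⟩).trans_le hv0.2, (hl2 ⟨t1, by linarith⟩).1, ?_, ?_⟩
  · intro s hs
    rcases lt_or_ge s T with h | h
    · exact hθ.trans (N.vgt s ⟨hs.1, h⟩)
    rcases h.eq_or_lt with h | h
    · rw [← h, N.vT]; exact hθ
    rcases le_or_gt s r0 with h' | h'
    · exact (hv s ⟨h, h'⟩).1
    · exact (hl2 ⟨h', by linarith [hs.2]⟩).2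
  · intro s hs
    rcases lt_or_ge s T with h | h
    · exact Or.inr ⟨N.ult s ⟨hs.1, h⟩, N.vlt s ⟨hs.1, h⟩⟩
    rcases h.eq_or_lt with h | h
    · rw [← h, N.vT]; exact Or.inr ⟨huT, hθ2⟩
    left
    rcases le_or_gt s r0 with h' | h'
    · exact (hv s ⟨h, h'⟩).2
    · exact (t3 s ⟨h', hs.2⟩).trans_le hv0.2

lemma P1N.E (H : Par a m b U cV CV L V V1 V2 h X P) {δ Tm uh T w : ℝ} {u p v q : ℝ → ℝ}
    (hw0 : 0 ≤ w) (N : P1N a m b δ U Tm uh T u p v q) (huT : u T < uh) {r0 : ℝ} (hr0 : T ≤ r0)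
    (hv : ∀ s ∈ Icc T r0, 0 < v s) (hq : ∀ s ∈ Icc T r0, q s < 0)
    (hP : Lf m b w (v r0) - q r0 ^ 2 / 2 = 0) (hor : u r0 ≤ w ∨ a * v r0 < m / 50) :
    SA m b w uh u v q := by
  have J := N.ph.tj
  have hb := H.b0
  have hm := H.m0
  have hδ := N.ph.d0
  have hT0 := N.T0
  have hr00 := hT0.trans_le hr0
  have han := santi_of_d (s := T) (t := r0) J.vc.continuousOn (fun r hr => J.dv r (hT0.trans hr.1))
    (fun r hr => div_neg_of_neg_of_pos (hq r ⟨hr.1.le, hr.2.le⟩) hδ)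
  have hvθ : ∀ s ∈ Ioc T r0, v s < 1 / (2 * b) := fun s hs => by
    rw [← N.vT]; exact han ⟨le_rfl, hr0⟩ ⟨hs.1.le, hs.2⟩ hs.1
  have hq0 := hq r0 ⟨hr0, le_rfl⟩
  refine N.SA_mk hb huT hr0 (fun s hs => ⟨hv s ⟨hs.1.le, hs.2⟩, hvθ s hs⟩)
    (fun ε hε => J.dec hδ hr00 hq0 hε) ?_
  have v0 := hv r0 ⟨hr0, le_rfl⟩
  have v1 : v r0 ≤ 1 / (2 * b) := by
    rcases hr0.eq_or_lt with e | e
    · rw [← e, N.vT]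
    · exact (hvθ r0 ⟨e, le_rfl⟩).le
  have hbv : b * v r0 ≤ 1 / 2 := by
    have := mul_le_mul_of_nonneg_left v1 hb.le
    rwa [show b * (1 / (2 * b)) = 1 / 2 by field_simp] at this
  have hθ2 : 1 / (2 * b) ≤ 1 / b := by gcongr; linarith
  have hneg : 49 / 50 * m * v r0 - w * v r0 ^ 2 + b * w * v r0 ^ 3 - gc a m b (u r0) (v r0) < 0 := by
    rw [gc, cl_eq v0.le (v1.trans hθ2)]
    have c1 := (cl_bd (x := u r0) H.a0.le).2
    have e : 49 / 50 * m * v r0 - w * v r0 ^ 2 + b * w * v r0 ^ 3 - (m * v r0 -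
      cl a (u r0) * v r0 ^ 2 * (1 - b * v r0)) = -(m / 50 * v r0) + (cl a (u r0) - w) * (v r0 ^ 2 * (1 - b * v r0)) := by
      ring
    rw [e]
    have k1 : 0 ≤ v r0 ^ 2 * (1 - b * v r0) := mul_nonneg (by positivity) (by linarith)
    have k0 : 0 < m / 50 * v r0 := by positivity
    rcases hor with ho | ho
    · have := mul_nonneg (sub_nonneg.2 (cl_le (M := a) hw0 ho)) k1
      linarith
    · have k2 : (cl a (u r0) - w) * (v r0 ^ 2 * (1 - b * v r0)) ≤ a * (v r0 ^ 2 * (1 - b * v r0)) := by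
        gcongr; linarith
      have k3 : v r0 ^ 2 * (1 - b * v r0) ≤ v r0 ^ 2 * 1 := by
        have : 0 ≤ b * v r0 := by positivity
        gcongr; linarith
      have k4 : a * (v r0 ^ 2 * (1 - b * v r0)) ≤ a * (v r0 ^ 2 * 1) := by
        have := H.a0
        gcongr
      have k5 : a * v r0 * v r0 < m / 50 * v r0 := by gcongr
      linarith
  have hd := J.dPsi w hr00
  have hpos : 0 < q r0 / δ * (49 / 50 * m * v r0 - w * v r0 ^ 2 + b * w * v r0 ^ 3 -
      gc a m b (u r0) (v r0)) + q r0 ^ 2 / r0 := by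
    have := mul_pos_of_neg_of_neg (div_neg_of_neg_of_pos hq0 hδ) hneg
    positivity
  have hsl := (hasDerivWithinAt_iff_tendsto_slope' (lt_irrefl r0 : r0 ∉ Ioi r0)).1 hd.hasDerivWithinAt
  filter_upwards [hsl.eventually (lt_mem_nhds hpos), self_mem_nhdsWithin] with r h1 h2
  have h2' : r0 < r := h2
  rw [slope_def_field, hP, sub_zero] at h1
  exact (div_pos_iff_of_pos_right (by linarith)).1 h1

lemma P1N.PsiT (H : Par a m b U cV CV L V V1 V2 h X P) {δ Tm uh T w : ℝ} {u p v q : ℝ → ℝ}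
    (hw0 : 0 ≤ w) (hw : w ≤ 51 / 50 * (9 * b * m / 2)) (huw : uh ≤ w) (hua : uh ≤ a)
    (N : P1N a m b δ U Tm uh T u p v q) (huT : u T < uh) (hA : ¬ SA m b w uh u v q) :
    q T < 0 ∧ Lf m b w (v T) - q T ^ 2 / 2 < 0 := by
  have J := N.ph.tj
  have hb := H.b0
  have hm := H.m0
  have hδ := N.ph.d0
  have hT0 := N.T0
  have hL : 0 < Lf m b w (v T) := by
    have := Lf_lower hm hb hw (v := v T) (by rw [N.vT]; positivity) N.vT.le
    have : 0 < m / 100 * v T ^ 2 := by rw [N.vT]; positivity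
    linarith
  have hP : ¬ 0 < Lf m b w (v T) - q T ^ 2 / 2 := fun hP => by
    refine hA (N.SA_mk hb huT le_rfl (fun s hs => absurd hs.2 (not_le.2 hs.1)) (fun ε hε => ?_) ?_)
    · rcases N.qT.eq_or_lt with e | e
      · exact J.kick_down hδ hT0.le e (by
          rw [N.vT]; exact gc_neg H (N.ph.ulo T ⟨hT0.le, le_rfl⟩) (huT.le.trans hua)) hε
      · exact J.dec hδ hT0 e hε
    · exact ((J.Psic w).continuousAt (x := T) |>.eventually (lt_mem_nhds hP)).filter_mono nhdsWithin_le_nhds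
  have hq : q T < 0 := lt_of_le_of_ne N.qT (fun e => hP (by rw [e]; simpa using hL))
  refine ⟨hq, lt_of_le_of_ne (not_lt.1 hP) (fun e => hA ?_)⟩
  have h1 : ∀ s ∈ Icc T T, s = T := fun s hs => le_antisymm hs.2 hs.1
  exact N.E H hw0 huT le_rfl (fun s hs => by rw [h1 s hs, N.vT]; positivity)
    (fun s hs => by rw [h1 s hs]; exact hq) e (Or.inl (huT.le.trans huw))

lemma P1N.phase2 (H : Par a m b U cV CV L V V1 V2 h X P) {δ Tm uh T w τ c : ℝ} {u p v q : ℝ → ℝ}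
    (hw0 : 0 ≤ w) (hw : w ≤ 51 / 50 * (9 * b * m / 2)) (huw : uh ≤ w) (W : Wc a b U Tm uh w τ)
    (hc : c = √(m / 50)) (hδs : a * (1 / (2 * b)) * δ < m / 50 * (c * τ))
    (N : P1N a m b δ U Tm uh T u p v q) (huT : u T < uh) (hA : ¬ SA m b w uh u v q)
    (hB : ¬ SB2 m b w v q) :
    ∀ r, T ≤ r → 0 < v r ∧ q r ≤ -(c * v r) ∧ v r ≤ 1 / (2 * b) * exp (-(c * (r - T) / δ)) := by
  have J := N.ph.tj
  have hb := H.b0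
  have hm := H.m0
  have ha := H.a0
  have hδ := N.ph.d0
  have hT0 := N.T0
  have hτ := W.t0
  have hc0 : 0 < c := by rw [hc]; positivity
  have hc2 : c ^ 2 = m / 50 := by rw [hc, sq_sqrt (by positivity)]
  obtain ⟨hqT, hPT⟩ := N.PsiT H hw0 hw huw W.ua.le huT hA
  have hθ : 0 < 1 / (2 * b) := by positivity
  have hθ2 : 1 / (2 * b) ≤ 1 / b := by gcongr; linarith
  -- consequences on a closed interval
  have cons : ∀ r, T ≤ r → (∀ y ∈ Ico T r, 0 < min (v y) (min (-q y) (-(Lf m b w (v y) - q y ^ 2 / 2)))) →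
      ∀ s ∈ Icc T r, 0 ≤ v s ∧ v s ≤ 1 / (2 * b) ∧ q s ≤ -(c * v s) := by
    intro r hr hy
    have han := anti_of_d (s := T) (t := r) J.vc.continuousOn (fun s hs => J.dv s (hT0.trans hs.1))
      (fun s hs => div_nonpos_of_nonpos_of_nonneg (by
        have := (lt_min_iff.1 (lt_min_iff.1 (hy s ⟨hs.1.le, hs.2⟩)).2).1
        linarith) hδ.le)
    have hvθ : ∀ s ∈ Icc T r, v s ≤ 1 / (2 * b) := fun s hs => by
      rw [← N.vT]; exact han ⟨le_rfl, hr⟩ hs hs.1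
    have hnn : ∀ s ∈ Icc T r, 0 ≤ v s ∧ q s ≤ 0 ∧ Lf m b w (v s) - q s ^ 2 / 2 ≤ 0 := by
      rcases hr.eq_or_lt with e | e
      · intro s hs
        have : s = T := le_antisymm (by rw [e]; exact hs.2) hs.1
        rw [this, N.vT]
        rw [N.vT] at hPT
        exact ⟨hθ.le, hqT.le, hPT.le⟩
      · have hcl : IsClosed {y | 0 ≤ v y ∧ q y ≤ 0 ∧ Lf m b w (v y) - q y ^ 2 / 2 ≤ 0} :=
          (isClosed_le continuous_const J.vc).inter ((isClosed_le J.qc continuous_const).inter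
            (isClosed_le (J.Psic w) continuous_const))
        have hsub : Ico T r ⊆ {y | 0 ≤ v y ∧ q y ≤ 0 ∧ Lf m b w (v y) - q y ^ 2 / 2 ≤ 0} := fun y hy' => by
          have h1 := lt_min_iff.1 (hy y hy')
          have h2 := lt_min_iff.1 h1.2
          exact ⟨h1.1.le, by linarith [h2.1], by linarith [h2.2]⟩
        have := closure_minimal hsub hcl
        rw [closure_Ico e.ne] at this
        exact this
    intro s hs
    obtain ⟨h1, h2, h3⟩ := hnn s hs
    refine ⟨h1, hvθ s hs, ?_⟩
    have h4 := Lf_lower hm hb hw h1 (hvθ s hs)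
    have h5 : (c * v s) ^ 2 ≤ (-q s) ^ 2 := by rw [mul_pow, hc2, neg_sq]; linarith
    have := (sq_le_sq₀ (by positivity) (by linarith)).1 h5
    linarith
  have key : ∀ R, T ≤ R → ∀ r ∈ Icc T R, 0 < min (v r) (min (-q r) (-(Lf m b w (v r) - q r ^ 2 / 2))) := by
    intro R hR
    have hΨc := J.Psic w
    apply boot (x := fun r => min (v r) (min (-q r) (-(Lf m b w (v r) - q r ^ 2 / 2))))
      (J.vc.min (J.qc.neg.min hΨc.neg)).continuousOn
      (lt_min (by rw [N.vT]; exact hθ) (lt_min (by linarith) (by linarith)))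
    intro r hr hy
    have hcn := cons r hr.1.le hy
    obtain ⟨v0, v1, hqv⟩ := hcn r ⟨hr.1.le, le_rfl⟩
    have hq0 : q r ≤ 0 := hqv.trans (by have : 0 ≤ c * v r := by positivity
                                        linarith)
    have hbef : ∀ s ∈ Ico T r, 0 < v s ∧ q s < 0 ∧ Lf m b w (v s) - q s ^ 2 / 2 < 0 := fun s hs => by
      have h1 := lt_min_iff.1 (hy s hs)
      have h2 := lt_min_iff.1 h1.2
      exact ⟨h1.1, by linarith [h2.1], by linarith [h2.2]⟩
    have hcase : ∀ s ∈ Icc T r, s = r ∨ s ∈ Ico T r := fun s hs => by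
      rcases hs.2.eq_or_lt with e | e
      · exact Or.inl e
      · exact Or.inr ⟨hs.1, e⟩
    have hvpos : 0 < v r := by
      refine lt_of_le_of_ne v0 (fun e => ?_)
      have hnz := J.nz ha hm hb hδ hT0 hr.1.le (fun s hs =>
        ⟨(hcn s hs).1, (hcn s hs).2.1.trans hθ2⟩) (by rw [N.vT]; exact hθ)
      have hqr : q r < 0 := lt_of_le_of_ne hq0 (fun e2 => by rw [← e, e2] at hnz; simp at hnz)
      refine hB (N.SB2_zero hr.1.le e.symm hqr (fun s hs => ?_))
      rcases hcase s hs with e' | e'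
      · rw [e', ← e]
        have : Lf m b w 0 = 0 := by unfold Lf; ring
        rw [this]
        have := pow_pos (neg_pos.2 hqr) 2
        nlinarith
      · exact (hbef s e').2.2
    have hqr : q r < 0 := hqv.trans_lt (by have : 0 < c * v r := by positivity
                                           linarith)
    have h3 : Lf m b w (v r) - q r ^ 2 / 2 ≤ 0 := by
      have hcl : IsClosed {y | Lf m b w (v y) - q y ^ 2 / 2 ≤ 0} := isClosed_le (J.Psic w) continuous_const
      have hsub : Ico T r ⊆ {y | Lf m b w (v y) - q y ^ 2 / 2 ≤ 0} := fun y hy' => (hbef y hy').2.2.le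
      have := closure_minimal hsub hcl
      rw [closure_Ico hr.1.ne] at this
      exact this ⟨hr.1.le, le_rfl⟩
    refine lt_min hvpos (lt_min (by linarith) ?_)
    refine neg_pos.2 (lt_of_le_of_ne h3 (fun e => hA ?_))
    refine N.E H hw0 huT hr.1.le (fun s hs => ?_) (fun s hs => ?_) e ?_
    · rcases hcase s hs with e' | e'
      · rwa [e']
      · exact (hbef s e').1
    · rcases hcase s hs with e' | e'
      · rwa [e']
      · exact (hbef s e').2.1
    · rcases le_or_gt r (T + τ) with h' | h'
      · exact Or.inl (N.win H W r ⟨hr.1.le, h'⟩).2.1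
      · right
        have hd := J.decay hδ hT0 hr.1.le (fun s hs => (hcn s ⟨hs.1.le, hs.2.le⟩).2.2)
        rw [N.vT] at hd
        have hx : 0 < c * τ / δ := by positivity
        have h5 : exp (-(c * (r - T) / δ)) ≤ (c * τ / δ)⁻¹ := by
          rw [exp_neg]
          gcongr
          have : c * τ / δ ≤ c * (r - T) / δ := by gcongr; linarith
          linarith [add_one_le_exp (c * (r - T) / δ)]
        have h6 : a * v r ≤ a * (1 / (2 * b) * (c * τ / δ)⁻¹) := by
          gcongr
          exact hd.trans (by gcongr)
        refine h6.trans_lt ?_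
        rw [show a * (1 / (2 * b) * (c * τ / δ)⁻¹) = a * (1 / (2 * b)) * δ / (c * τ) by field_simp,
          div_lt_iff₀ (by positivity)]
        exact hδs
  intro r hr
  have hk := key r hr
  have hcn := cons r hr (fun y hy => hk y ⟨hy.1, hy.2.le⟩)
  refine ⟨(lt_min_iff.1 (hk r ⟨hr, le_rfl⟩)).1, (hcn r ⟨hr, le_rfl⟩).2.2, ?_⟩
  have hd := J.decay hδ hT0 hr (fun s hs => (hcn s ⟨hs.1.le, hs.2.le⟩).2.2)
  rwa [N.vT] at hd
end


section
variable {a m b U cV CV L : ℝ} {V V1 V2 h : ℝ → ℝ} {X P : ℝ → ℝ → ℝ}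

def Ph2 (b δ c T : ℝ) (v q : ℝ → ℝ) : Prop :=
  ∀ r, T ≤ r → 0 < v r ∧ q r ≤ -(c * v r) ∧ v r ≤ 1 / (2 * b) * exp (-(c * (r - T) / δ))

lemma Ph2.vle {b δ c T : ℝ} {v q : ℝ → ℝ} (Q : Ph2 b δ c T v q) (hb : 0 < b) (hδ : 0 < δ) (hc : 0 < c)
    {r : ℝ} (hr : T ≤ r) : v r ≤ 1 / (2 * b) := by
  refine (Q r hr).2.2.trans (mul_le_of_le_one_right (by positivity) (exp_le_one_iff.2 ?_))
  have : 0 ≤ c * (r - T) / δ := div_nonneg (mul_nonneg hc.le (by linarith)) hδ.le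
  linarith

lemma Ph2.vle2 {b δ c T τ : ℝ} {v q : ℝ → ℝ} (Q : Ph2 b δ c T v q) (hb : 0 < b) (hδ : 0 < δ) (hc : 0 < c)
    (hτ : 0 < τ) : v (T + τ) ≤ 1 / (2 * b) * (δ / (c * τ)) := by
  refine (Q (T + τ) (by linarith)).2.2.trans ?_
  have hx : 0 < c * τ / δ := by positivity
  rw [add_sub_cancel_left, exp_neg, show δ / (c * τ) = (c * τ / δ)⁻¹ by field_simp]
  gcongr
  linarith [add_one_le_exp (c * τ / δ)]

set_option maxHeartbeats 1000000 in
lemma P1N.trans (H : Par a m b U cV CV L V V1 V2 h X P) {αl αh uh w Tm τ c Tn : ℝ}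
    (hh : αh < 9 * b * m / 2) (hw : w ≤ 51 / 50 * (9 * b * m / 2)) (W : Wc a b U Tm uh w τ) (hc : 0 < c)
    (hTn : 0 < Tn)
    (hlow : ∀ α ∈ Icc αl αh, ∀ s, 0 ≤ s → (αh + 9 * b * m / 2) / 2 ≤ X α s → Tn ≤ s) :
    ∃ C δ0, 0 < C ∧ 0 < δ0 ∧ ∀ {δ T : ℝ} {u p v q : ℝ → ℝ}, δ < δ0 → P1N a m b δ U Tm uh T u p v q →
      u 0 ∈ Icc αl αh → Ph2 b δ c T v q → Tn ≤ T ∧ |u T - 9 * b * m / 2| ≤ C * δ := by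
  have hTm := W.Tm0
  obtain ⟨C, hC, hcon⟩ := Ph1.concl H Tm hTm
  have ha := H.a0
  have hb := H.b0
  have hm := H.m0
  have hU := H.U0
  have hτ := W.t0
  obtain ⟨Cp, hCp⟩ : ∃ C, C = Cpf a b Tm := ⟨_, rfl⟩
  have hCp0 : 0 < Cp := hCp ▸ Cpf_pos ha hTm
  obtain ⟨θ, hθ⟩ : ∃ θ, θ = 1 / (2 * b) := ⟨_, rfl⟩
  have hθ0 : 0 < θ := by rw [hθ]; positivity
  obtain ⟨A, hA⟩ : ∃ A, A = Cp / (12 * b ^ 2) / c := ⟨_, rfl⟩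
  have hA0 : 0 < A := by rw [hA]; positivity
  obtain ⟨C1, hC1⟩ : ∃ C, C = A * θ + m / (4 * b) * (θ / (c * τ)) := ⟨_, rfl⟩
  have hC10 : 0 < C1 := by rw [hC1]; positivity
  obtain ⟨A2, hA2⟩ : ∃ A, A = (2 * (Tm + 1) * (m / (4 * b)) + (Tm + 1) ^ 2 * (Cp / (12 * b ^ 2))) / c := ⟨_, rfl⟩
  have hA20 : 0 < A2 := by rw [hA2]; positivity
  obtain ⟨C2, hC2⟩ : ∃ C, C = A2 * θ + (Tm + 1) ^ 2 * ((θ / τ) ^ 2 / 2) := ⟨_, rfl⟩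
  have hC20 : 0 < C2 := by rw [hC2]; positivity
  obtain ⟨D1, hD1⟩ : ∃ D, D = 96 * b ^ 3 * (C + C1) := ⟨_, rfl⟩
  obtain ⟨D2, hD2⟩ : ∃ D, D = 96 * b ^ 3 * ((C + C2) / Tn ^ 2) := ⟨_, rfl⟩
  have hD10 : 0 < D1 := by rw [hD1]; positivity
  have hD20 : 0 < D2 := by rw [hD2]; positivity
  refine ⟨D1 + D2, min 1 ((9 * b * m / 2 - αh) / (2 * (D1 + C))), by positivity, by
    have := sub_pos.2 hh; positivity, ?_⟩
  intro δ T u p v q hδ0 N hu0 Q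
  have hδ1 : δ ≤ 1 := hδ0.le.trans (min_le_left _ _)
  have hδ2 : (D1 + C) * δ < (9 * b * m / 2 - αh) / 2 := by
    have := hδ0.trans_le (min_le_right _ _)
    rw [lt_div_iff₀ (by positivity)] at this
    linarith
  have J := N.ph.tj
  have hδ := N.ph.d0
  have hT0 := N.T0
  have hTTm := N.ph.TTm
  have hwin := N.win H W
  obtain ⟨-, k2, k3, k4⟩ := hcon N.ph hδ1
  have hθ2 : θ ≤ 1 / b := by rw [hθ]; gcongr; linarith
  have hQ : ∀ r, T ≤ r → 0 < v r ∧ q r ≤ -(c * v r) ∧ v r ≤ θ := fun r hr =>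
    ⟨(Q r hr).1, (Q r hr).2.1, by rw [hθ]; exact Q.vle hb hδ hc hr⟩
  have hGup : ∀ r ∈ Icc T (T + τ), |Gu b (v r) * p r| ≤ Cp / (12 * b ^ 2) * v r := fun r hr => by
    obtain ⟨h1, h2, h3⟩ := hQ r hr.1
    have g4 := Gu_bd hb h1.le (by rw [← hθ]; exact h3)
    rw [abs_mul, abs_of_nonpos g4.1]
    have h4 := (hwin r hr).2.2
    rw [← hCp] at h4
    have : -Gu b (v r) * |p r| ≤ v r / (12 * b ^ 2) * Cp := by
      have : -Gu b (v r) ≤ v r / (12 * b ^ 2) := by linarith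
      gcongr
    calc _ ≤ _ := this
      _ = _ := by ring
  have hYd : ∀ r ∈ Ioo T (T + τ), _ := fun r hr => J.dY (hT0.trans hr.1)
    (by linarith [(hwin r ⟨hr.1.le, hr.2.le⟩).1]) ((hwin r ⟨hr.1.le, hr.2.le⟩).2.1.trans W.wa)
    (hQ r hr.1.le).1.le ((hQ r hr.1.le).2.2.trans hθ2)
  have hrYd : ∀ r ∈ Ioo T (T + τ), _ := fun r hr => J.dr2Y (hT0.trans hr.1)
    (by linarith [(hwin r ⟨hr.1.le, hr.2.le⟩).1]) ((hwin r ⟨hr.1.le, hr.2.le⟩).2.1.trans W.wa)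
    (hQ r hr.1.le).1.le ((hQ r hr.1.le).2.2.trans hθ2)
  have hYc := J.Yc
  have hvc := J.vc
  -- lower bound on Y(T)
  have hYlow : -(C1 * δ) ≤ q T ^ 2 / 2 - Gf m b (v T) (u T) := by
    have := anti_of_d (f := fun r => (q r ^ 2 / 2 - Gf m b (v r) (u r)) + A * δ * v r)
      (s := T) (t := T + τ) (by fun_prop)
      (fun r hr => (hYd r hr).add ((J.dv r (hT0.trans hr.1)).const_mul (A * δ)))
      (fun r hr => by
        have hr0 := hT0.trans hr.1
        have h1 := (abs_le.1 (hGup r ⟨hr.1.le, hr.2.le⟩)).1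
        have h2 : A * δ * (q r / δ) = A * q r := by field_simp
        have h3 : A * q r ≤ A * -(c * v r) := by have := (hQ r hr.1.le).2.1; gcongr
        have h4 : A * (c * v r) = Cp / (12 * b ^ 2) * v r := by rw [hA]; field_simp
        have h5 : 0 ≤ q r ^ 2 / r := by positivity
        rw [h2]; linarith)
      ⟨le_rfl, by linarith⟩ ⟨by linarith, le_rfl⟩ (by linarith)
    have e := N.vT
    rw [← hθ] at e
    simp only [e] at this ⊢
    have h1 := hQ (T + τ) (by linarith)
    have h2 := Gf_up hm hb h1.1.le (by rw [← hθ]; exact h1.2.2) (u := u (T + τ))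
      (by linarith [(hwin (T + τ) ⟨by linarith, le_rfl⟩).1])
    have h3 := Q.vle2 hb hδ hc hτ
    rw [← hθ] at h3
    have h4 : m / (4 * b) * v (T + τ) ≤ m / (4 * b) * (θ * (δ / (c * τ))) := by gcongr
    have h5 : 0 ≤ A * δ * v (T + τ) := by have := h1.1; positivity
    have h6 : 0 ≤ q (T + τ) ^ 2 / 2 := by positivity
    have e1 : C1 * δ = A * δ * θ + m / (4 * b) * (θ * (δ / (c * τ))) := by rw [hC1]; ring
    rw [e1]; linarith
  -- upper bound on T^2 Y(T)
  have hYup : T ^ 2 * (q T ^ 2 / 2 - Gf m b (v T) (u T)) ≤ C2 * δ := by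
    obtain ⟨r, hr, hrq⟩ := exists_hasDerivAt_eq_slope v (fun r => q r / δ) (a := T) (b := T + τ)
      (by linarith) hvc.continuousOn (fun r hr => J.dv r (hT0.trans hr.1))
    have hr0 := hT0.trans hr.1
    have := mono_of_d (f := fun r => r ^ 2 * (q r ^ 2 / 2 - Gf m b (v r) (u r)) - A2 * δ * v r)
      (s := T) (t := r) (by fun_prop)
      (fun s hs => (hrYd s ⟨hs.1, hs.2.trans hr.2⟩).sub ((J.dv s (hT0.trans hs.1)).const_mul (A2 * δ)))
      (fun s hs => by
        have hs' : s ∈ Icc T (T + τ) := ⟨hs.1.le, hs.2.le.trans hr.2.le⟩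
        have hs0 := hT0.trans hs.1
        have hsT : s ≤ Tm + 1 := by have := hs'.2; have := W.t1; linarith
        have h1 := (abs_le.1 (hGup s hs')).2
        have v1 := hQ s hs'.1
        have v0 := v1.1
        have h2 : A2 * δ * (q s / δ) = A2 * q s := by field_simp
        have h3 : A2 * q s ≤ A2 * -(c * v s) := by have := v1.2.1; gcongr
        have h4 : A2 * (c * v s) = 2 * (Tm + 1) * (m / (4 * b)) * v s + (Tm + 1) ^ 2 * (Cp / (12 * b ^ 2)) * v s := by
          rw [hA2]; field_simp
        have h5 := Gf_up hm hb v0.le (by rw [← hθ]; exact v1.2.2) (u := u s)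
          (by linarith [(hwin s hs').1])
        have h6 : 2 * s * Gf m b (v s) (u s) ≤ 2 * (Tm + 1) * (m / (4 * b) * v s) := by
          refine (mul_le_mul_of_nonneg_left h5 (by positivity)).trans ?_
          gcongr
        have h7 : s ^ 2 * (Gu b (v s) * p s) ≤ (Tm + 1) ^ 2 * (Cp / (12 * b ^ 2) * v s) := by
          refine (mul_le_mul_of_nonneg_left h1 (by positivity)).trans ?_
          gcongr
        rw [h2]; linarith)
      ⟨le_rfl, hr.1.le⟩ ⟨hr.1.le, le_rfl⟩ hr.1.le
    have e := N.vT
    rw [← hθ] at e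
    simp only [e] at this hrq ⊢
    have v1 := hQ r hr.1.le
    have v2 := hQ (T + τ) (by linarith)
    have g1 := Gf_Lf hm hb v1.1.le (by rw [← hθ]; exact v1.2.2) (hwin r ⟨hr.1.le, hr.2.le⟩).2.1
    have g2 := Lf_lower hm hb hw v1.1.le (by rw [← hθ]; exact v1.2.2)
    have g3 : 0 ≤ m / 100 * v r ^ 2 := by positivity
    have hq1 : -q r ≤ δ * (θ / τ) := by
      rw [add_sub_cancel_left, div_eq_iff hδ.ne'] at hrq
      have : -q r = (θ - v (T + τ)) / τ * δ := by rw [hrq]; ring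
      rw [this, mul_comm δ]
      have := v2.1
      gcongr; linarith
    have hq0 : 0 ≤ -q r := by have := v1.2.1; have := mul_pos hc v1.1; linarith
    have hq2 : q r ^ 2 ≤ δ * (θ / τ) ^ 2 := by
      calc q r ^ 2 = (-q r) ^ 2 := by ring
        _ ≤ (δ * (θ / τ)) ^ 2 := by gcongr
        _ = δ * δ * (θ / τ) ^ 2 := by ring
        _ ≤ δ * 1 * (θ / τ) ^ 2 := by gcongr
        _ = _ := by ring
    have hrT : r ≤ Tm + 1 := by have := hr.2; have := W.t1; linarith
    have g4 : r ^ 2 * (q r ^ 2 / 2 - Gf m b (v r) (u r)) ≤ (Tm + 1) ^ 2 * (δ * (θ / τ) ^ 2 / 2) := by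
      calc _ ≤ r ^ 2 * (δ * (θ / τ) ^ 2 / 2) := by gcongr; linarith
        _ ≤ _ := by gcongr
    have h5 : 0 ≤ A2 * δ * v r := by have := v1.1; positivity
    have e1 : C2 * δ = A2 * δ * θ + (Tm + 1) ^ 2 * (δ * (θ / τ) ^ 2 / 2) := by rw [hC2]; ring
    rw [e1]; linarith
  have hUT := N.ph.ulo T ⟨hT0.le, le_rfl⟩
  have k3 := k3 hT0
  have low : 9 * b * m / 2 - u T ≤ D1 * δ := by
    rcases le_total (9 * b * m / 2) (u T) with hle | hle
    · have : 0 ≤ D1 * δ := by positivity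
      linarith
    · have g := (Gam H hUT hle).1
      rw [Gam0 H, sub_zero, div_le_iff₀ (by positivity)] at g
      have g2 : Gf m b (V (u T)) (u T) ≤ (C + C1) * δ := by linarith
      have : Gf m b (V (u T)) (u T) * (96 * b ^ 3) ≤ (C + C1) * δ * (96 * b ^ 3) := by gcongr
      have e : D1 * δ = (C + C1) * δ * (96 * b ^ 3) := by rw [hD1]; ring
      linarith
  have hTnT : Tn ≤ T := by
    have h1 := (abs_le.1 (k2 T ⟨hT0.le, le_rfl⟩).1).2
    exact hlow (u 0) hu0 T hT0.le (by linarith)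
  refine ⟨hTnT, ?_⟩
  have hD1δ : 0 ≤ D1 * δ := by positivity
  have hD2δ : 0 ≤ D2 * δ := by positivity
  rw [abs_le]
  refine ⟨by linarith, ?_⟩
  rcases le_total (u T) (9 * b * m / 2) with hle | hle
  · linarith
  · have g := (Gam H H.Uus.le hle).1
    rw [Gam0 H, zero_sub] at g
    have g0 : 0 ≤ (u T - 9 * b * m / 2) / (96 * b ^ 3) := div_nonneg (by linarith) (by positivity)
    have g2 : Tn ^ 2 * ((u T - 9 * b * m / 2) / (96 * b ^ 3)) ≤ (C + C2) * δ := by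
      calc _ ≤ T ^ 2 * ((u T - 9 * b * m / 2) / (96 * b ^ 3)) := by gcongr
        _ ≤ T ^ 2 * (-Gf m b (V (u T)) (u T)) := by gcongr
        _ ≤ _ := by linarith
    have e : D2 * δ = (C + C2) * δ * (96 * b ^ 3) / Tn ^ 2 := by rw [hD2]; ring
    have : u T - 9 * b * m / 2 ≤ D2 * δ := by
      rw [e, le_div_iff₀ (by positivity)]
      calc _ = Tn ^ 2 * ((u T - 9 * b * m / 2) / (96 * b ^ 3)) * (96 * b ^ 3) := by field_simp
        _ ≤ _ := by gcongr
    linarith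

end


lemma lipd {f f' : ℝ → ℝ} {s t C : ℝ} (h : ∀ r ∈ uIcc s t, HasDerivAt f (f' r) r ∧ |f' r| ≤ C) :
    |f t - f s| ≤ C * |t - s| :=
  (convex_uIcc s t).norm_image_sub_le_of_norm_hasDerivWithin_le
    (fun r hr => (h r hr).1.hasDerivWithinAt) (fun r hr => (h r hr).2) left_mem_uIcc right_mem_uIcc

lemma expd {f f' : ℝ → ℝ} {s t c : ℝ} (h : ∀ r ∈ uIcc s t, HasDerivAt f (f' r) r ∧ c ≤ f' r) :
    c * |t - s| ≤ |f t - f s| := by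
  wlog hst : s ≤ t generalizing s t
  · rw [abs_sub_comm, abs_sub_comm (f t)]
    exact this (fun r hr => h r (by rwa [uIcc_comm])) (le_of_not_ge hst)
  rw [uIcc_of_le hst] at h
  have := incr_ge hst (fun r hr => (h r hr).1.continuousAt.continuousWithinAt)
    (fun r hr => (h r ⟨hr.1.le, hr.2.le⟩).1) (fun r hr => (h r ⟨hr.1.le, hr.2.le⟩).2)
  rw [abs_of_nonneg (sub_nonneg.2 hst)]
  exact this.trans (le_abs_self _)

section
variable {a m b U cV CV L : ℝ} {V V1 V2 h : ℝ → ℝ} {X P : ℝ → ℝ → ℝ}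

lemma match1 (H : Par a m b U cV CV L V V1 V2 h X P) {αl αh Tn cp C0 us : ℝ} {κ : ℝ → ℝ}
    (hus : us = 9 * b * m / 2)
    (hh : αh < us) (hTn : 0 < Tn) (hcp : 0 < cp) (hC0 : 0 < C0)
    (hlow : ∀ α ∈ Icc αl αh, ∀ s, 0 ≤ s → (αh + us) / 2 ≤ X α s → X α s ≤ a → Tn ≤ s ∧ cp ≤ P α s)
    (hκ : ∀ r, 0 < r → HasDerivAt κ (κ r ^ 2 - 1 - κ r / r) r ∧ 1 ≤ κ r ∧
      κ r ^ 2 - 1 - κ r / r ≤ 0) :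
    ∃ C δ0, 0 < C ∧ 0 < δ0 ∧ ∀ {δ T R α uT pT : ℝ}, 0 < δ → δ < δ0 → Tn ≤ T → α ∈ Icc αl αh → 0 < R →
      X α R = us → |uT - X α T| ≤ C0 * δ → |pT - P α T| ≤ C0 * δ → |uT - us| ≤ C0 * δ →
      |T - R| ≤ C * δ ∧ |(pT - (a - uT) * κ T) - (P α R - (a - us) * κ R)| ≤ C * δ := by
  have ha := H.a0
  have husa := H.usa
  rw [← hus] at husa
  have hha : 0 < h a := H.rf.hpos (H.Uus.trans H.usa)
  obtain ⟨C1, hC1⟩ : ∃ C, C = 2 * C0 / cp := ⟨_, rfl⟩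
  have hC10 : 0 < C1 := by rw [hC1]; positivity
  obtain ⟨K1, hK1⟩ : ∃ K, K = 1 + 1 / Tn := ⟨_, rfl⟩
  have hK10 : 0 < K1 := by rw [hK1]; positivity
  have hau : 0 < a - us := by linarith
  refine ⟨C1 + (C0 + h a * C1 + C0 * K1 + (a - us) * (K1 / Tn * C1)),
    min ((us - αh) / (4 * C0)) ((a - us) / (4 * C0)), by positivity, by
      have := sub_pos.2 hh; positivity, ?_⟩
  intro δ T R α uT pT hδ hδ0 hT hα hR hXR h1 h2 h3
  have e1 : C0 * δ < (us - αh) / 4 := by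
    have := hδ0.trans_le (min_le_left _ _)
    rw [lt_div_iff₀ (by positivity)] at this; linarith
  have e2 : C0 * δ < (a - us) / 4 := by
    have := hδ0.trans_le (min_le_right _ _)
    rw [lt_div_iff₀ (by positivity)] at this; linarith
  have hXT : |X α T - us| ≤ 2 * C0 * δ := by
    have := abs_sub_le (X α T) uT us
    rw [abs_sub_comm (X α T) uT] at this; linarith
  have hXT' := abs_le.1 hXT
  have hT0 := hTn.trans_le hT
  have hX : ∀ r ∈ uIcc R T, 0 < r ∧ (αh + us) / 2 ≤ X α r ∧ X α r ≤ a := by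
    intro r hr
    rcases le_total R T with hle | hle
    · rw [uIcc_of_le hle] at hr
      have k1 := H.rf.Xmono α hR.le hr.1
      have k2 := H.rf.Xmono α (hR.le.trans hr.1) hr.2
      exact ⟨hR.trans_le hr.1, by linarith, by linarith⟩
    · rw [uIcc_of_ge hle] at hr
      have k1 := H.rf.Xmono α hT0.le hr.1
      have k2 := H.rf.Xmono α (hT0.le.trans hr.1) hr.2
      exact ⟨hT0.trans_le hr.1, by linarith, by linarith⟩
  have hlo : ∀ r ∈ uIcc R T, Tn ≤ r ∧ cp ≤ P α r := fun r hr =>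
    hlow α hα r (hX r hr).1.le (hX r hr).2.1 (hX r hr).2.2
  have d1 : |T - R| ≤ C1 * δ := by
    have := expd (s := R) (t := T) (f := X α) (fun r hr => ⟨H.rf.dX α r (hX r hr).1, (hlo r hr).2⟩)
    rw [hXR] at this
    rw [hC1, div_mul_eq_mul_div, le_div_iff₀ hcp]
    linarith
  have d2 : |P α T - P α R| ≤ h a * (C1 * δ) := by
    refine (lipd (s := R) (t := T) (f := P α) (C := h a) (fun r hr => ⟨H.rf.dP α r (hX r hr).1, ?_⟩)).trans
      (by gcongr)
    have r0 := (hX r hr).1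
    have k1 := H.rf.hmono (hX r hr).2.2
    have k2 := H.rf.hnn (X α r)
    have k3 : P α r / r ≤ h (X α r) / 2 := by
      rw [div_le_iff₀ r0]; linarith [H.rf.Ple α r0.le]
    have k4 : 0 ≤ P α r / r := div_nonneg (H.rf.Pnn α r0.le) r0.le
    rw [abs_le]; constructor <;> linarith
  have hκ1 : ∀ r, Tn ≤ r → κ r ≤ K1 := fun r hr => by
    have := kappa_le (hTn.trans_le hr) (hκ r (hTn.trans_le hr)).2.1 (hκ r (hTn.trans_le hr)).2.2
    have : 1 / r ≤ 1 / Tn := by gcongr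
    rw [hK1]; linarith
  have d3 : |κ T - κ R| ≤ K1 / Tn * (C1 * δ) := by
    refine (lipd (s := R) (t := T) (f := κ) (C := K1 / Tn) (fun r hr => ⟨(hκ r (hX r hr).1).1, ?_⟩)).trans
      (by gcongr)
    have r0 := (hX r hr).1
    obtain ⟨-, k1, k2⟩ := hκ r r0
    rw [abs_of_nonpos k2]
    have k3 : κ r / r ≤ K1 / Tn := by
      have := (hlo r hr).1
      have := hκ1 r this
      gcongr
    nlinarith
  refine ⟨d1.trans (by gcongr; have : 0 ≤ C0 + h a * C1 + C0 * K1 + (a - us) * (K1 / Tn * C1) := by positivity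
                       linarith), ?_⟩
  have hκT := hκ1 T hT
  have hκ0 : 0 ≤ κ T := zero_le_one.trans (hκ T hT0).2.1
  have d4 : |(uT - us) * κ T| ≤ C0 * δ * K1 := by
    rw [abs_mul, abs_of_nonneg hκ0]; gcongr
  have d5 : |(a - us) * (κ T - κ R)| ≤ (a - us) * (K1 / Tn * (C1 * δ)) := by
    rw [abs_mul, abs_of_pos hau]; gcongr
  rw [abs_le] at *
  have hC1δ : 0 ≤ C1 * δ := by positivity
  constructor <;> linarith [d1.1, d1.2]
end


section
variable {a m b U cV CV L : ℝ} {V V1 V2 h : ℝ → ℝ} {X P : ℝ → ℝ → ℝ}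

structure NF (a b δ Tn Tm c T : ℝ) (u v q : ℝ → ℝ) : Prop where
  Tlo : Tn ≤ T
  Thi : T ≤ Tm
  vT : v T = 1 / (2 * b)
  Q : Ph2 b δ c T v q
  box : ∀ r ∈ Icc 0 T, 0 ≤ u r ∧ u r ≤ a ∧ 0 ≤ v r ∧ v r ≤ 1 / b

set_option maxHeartbeats 1000000 in
lemma nfacts (H : Par a m b U cV CV L V V1 V2 h X P) {αl αh : ℝ} (hl : U < αl)
    (hh : αh < 9 * b * m / 2) {κ : ℝ → ℝ}
    (hκ : ∀ r, 0 < r → HasDerivAt κ (κ r ^ 2 - 1 - κ r / r) r ∧ 1 ≤ κ r ∧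
      κ r ^ 2 - 1 - κ r / r ≤ 0) :
    ∃ w uh Tn Tm c C δ0, w ≤ 51 / 50 * (9 * b * m / 2) ∧ 9 * b * m / 2 < uh ∧ uh < a ∧ 0 < Tn ∧ 0 < Tm ∧
      0 < c ∧ 0 < C ∧ 0 < δ0 ∧ ∀ {δ R : ℝ} {u p v q : ℝ → ℝ}, 0 < δ → δ < δ0 → Tj a m b δ u p v q →
      u 0 ∈ Icc αl αh → v 0 ∈ Icc (1 / (2 * b)) (1 / b) → ¬ SA m b w uh u v q → ¬ SB1 b uh u v →
      ¬ SB2 m b w v q → 0 < R → X (u 0) R = 9 * b * m / 2 →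
      ∃ T, NF a b δ Tn Tm c T u v q ∧ |u T - 9 * b * m / 2| ≤ C * δ ∧ |v 0 - V (u 0)| ≤ C * δ ∧
        |T - R| ≤ C * δ ∧
        |(p T - (a - u T) * κ T) - (P (u 0) R - (a - 9 * b * m / 2) * κ R)| ≤ C * δ := by
  have ha := H.a0
  have hb := H.b0
  have hm := H.m0
  have hU := H.U0
  have husa := H.usa
  have hUus := H.Uus
  obtain ⟨us, hus⟩ : ∃ us, us = 9 * b * m / 2 := ⟨_, rfl⟩
  simp only [← hus] at hh husa hUus ⊢
  have hus0 : 0 < us := by rw [hus]; positivity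
  have hau : 0 < a - us := by linarith
  obtain ⟨η, hη⟩ : ∃ η, η = min ((a - us) / 3) (us / 100) := ⟨_, rfl⟩
  have hη0 : 0 < η := by rw [hη]; positivity
  have hη1 : η ≤ (a - us) / 3 := hη ▸ min_le_left _ _
  have hη2 : η ≤ us / 100 := hη ▸ min_le_right _ _
  have hαl : 0 < h αl := H.rf.hpos hl
  obtain ⟨Tm, hTm⟩ : ∃ T, T = √(4 * a / h αl) := ⟨_, rfl⟩
  have hTm0 : 0 < Tm := by rw [hTm]; positivity
  have hTm2 : a ≤ h αl * Tm ^ 2 / 4 := by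
    rw [hTm, Real.sq_sqrt (by positivity)]
    apply le_of_eq; field_simp
  have hCp := Cpf_pos (b := b) ha hTm0
  obtain ⟨τ, hτ⟩ : ∃ τ, τ = min 1 (min (U / 2) η / Cpf a b Tm) := ⟨_, rfl⟩
  have hτ0 : 0 < τ := by rw [hτ]; positivity
  have hτ1 : Cpf a b Tm * τ ≤ min (U / 2) η := by
    have := hτ ▸ min_le_right 1 (min (U / 2) η / Cpf a b Tm)
    rw [le_div_iff₀ hCp] at this; linarith
  obtain ⟨uh, huh⟩ : ∃ x, x = us + η := ⟨_, rfl⟩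
  obtain ⟨w, hw⟩ : ∃ x, x = us + 2 * η := ⟨_, rfl⟩
  have W : Wc a b U Tm uh w τ :=
    { t0 := hτ0, t1 := hτ ▸ min_le_left _ _, t2 := hτ1.trans (min_le_left _ _)
      t3 := by have := hτ1.trans (min_le_right _ _); linarith
      wa := by linarith
      Tm0 := hTm0, ua := by linarith }
  have hw' : w ≤ 51 / 50 * (9 * b * m / 2) := by rw [← hus]; linarith
  have huh' : 9 * b * m / 2 < uh := by rw [← hus]; linarith
  have hh' : αh < 9 * b * m / 2 := by rw [← hus]; linarith
  obtain ⟨c, hc⟩ : ∃ c, c = √(m / 50) := ⟨_, rfl⟩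
  have hc0 : 0 < c := by rw [hc]; positivity
  obtain ⟨Tn, cp, hTn, hcp, hlow⟩ := Tlow H hl hh'
  have hlow' : ∀ α ∈ Icc αl αh, ∀ s, 0 ≤ s → (αh + 9 * b * m / 2) / 2 ≤ X α s → Tn ≤ s := by
    intro α hα s hs h1
    rcases le_or_gt (X α s) a with hX | hX
    · exact (hlow α hα s hs h1 hX).1
    · obtain ⟨s', hs1, hs2⟩ := intermediate_value_Icc hs
        (f := X α) (H.rf.Xc' α).continuousOn (show a ∈ Icc _ _ from ⟨by
          rw [H.rf.X0]; linarith [hα.2], hX.le⟩)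
      exact (hlow α hα s' hs1.1 (by rw [hs2]; linarith) hs2.le).1.trans hs1.2
  obtain ⟨d1, hd1, f1⟩ := phase1N H hl hh' huh' W.ua hw' hTm0 hTm2
  obtain ⟨d2, hd2, f2⟩ := P1N.ult' H hl hh' huh' hw' W
  obtain ⟨C3, d3, hC3, hd3, f3⟩ := P1N.trans H hh' hw' W hc0 hTn hlow'
  obtain ⟨C4, hC4, f4⟩ := Ph1.concl H Tm hTm0
  obtain ⟨C5, d5, hC5, hd5, f5⟩ := match1 H (C0 := C3 + C4) hus hh hTn hcp (by positivity) (by rwa [hus]) hκ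
  obtain ⟨d6, hd6⟩ : ∃ d, d = m / 50 * (c * τ) / (a * (1 / (2 * b))) := ⟨_, rfl⟩
  have hd60 : 0 < d6 := by rw [hd6]; positivity
  refine ⟨w, uh, Tn, Tm, c, C3 + C5 + C4 / Tn, min (min (min d1 d2) (min d3 d5)) (min d6 1), by rwa [hus], by linarith,
    W.ua, hTn, hTm0, hc0, by positivity, by positivity, ?_⟩
  intro δ R u p v q hδ hδ0 J hu hv nA nB1 nB2 hR hXR
  simp only [lt_min_iff] at hδ0
  obtain ⟨⟨⟨e1, e2⟩, e3, e5⟩, e6, e7⟩ := hδ0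
  obtain ⟨T, N⟩ := f1 hδ e1 J hu hv nA nB1
  have huT := f2 e2 N hu nB2
  have Q : Ph2 b δ c T v q := N.phase2 H (by linarith) hw' (by linarith) W hc (by
    rw [hd6, lt_div_iff₀ (by positivity)] at e6; linarith) huT nA nB2
  obtain ⟨hT, g1⟩ := f3 e3 N hu Q
  obtain ⟨k1, k2, -, -⟩ := f4 N.ph e7.le
  have hT0 := N.T0
  obtain ⟨k3, k4⟩ := k2 T ⟨hT0.le, le_rfl⟩
  rw [← hus] at g1
  have i3 : 0 ≤ C3 * δ := by positivity
  have i4 : 0 ≤ C4 * δ := by positivity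
  have i5 : 0 ≤ C5 * δ := by positivity
  have i6 : 0 ≤ C4 / Tn * δ := by positivity
  obtain ⟨g2, g3⟩ := f5 hδ e5 hT hu hR hXR (by linarith) (by linarith) (by linarith)
  have hθ : 0 < 1 / (2 * b) := by positivity
  refine ⟨T, ⟨hT, N.ph.TTm, N.vT, Q, fun r hr => ⟨hU.le.trans (N.ph.ulo r hr), N.ph.uhi r hr,
    hθ.le.trans (N.ph.vlo r hr), N.ph.vhi r hr⟩⟩, by linarith, ?_, by linarith, by linarith⟩
  have : |v 0 - V (u 0)| ≤ C4 / Tn * δ := by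
    rw [div_mul_eq_mul_div, le_div_iff₀ hTn]
    have : Tn * |v 0 - V (u 0)| ≤ T * |v 0 - V (u 0)| := by gcongr
    linarith
  linarith
end


def Qf (a : ℝ) (K κ u p : ℝ → ℝ) (r : ℝ) : ℝ := r * K r * (p r - κ r * (a - u r))

section
variable {a m b δ Tn Tm c T B : ℝ} {u p v q K κ : ℝ → ℝ}

lemma dQf (J : Tj a m b δ u p v q) {r : ℝ} (hr : 0 < r) (hK : HasDerivAt K (-(κ r * K r)) r)
    (hκ : HasDerivAt κ (κ r ^ 2 - 1 - κ r / r) r) :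
    HasDerivAt (Qf a K κ u p) (r * K r * (cl a (u r) * cl (1 / b) (v r) ^ 2)) r := by
  convert! ((hasDerivAt_id r).mul hK).mul ((J.dp r hr).sub (hκ.mul ((J.du r hr).const_sub a))) using 1
  simp only [id]
  change _ = (1 * K r + r * (-(κ r * K r))) * (p r - κ r * (a - u r)) + r * K r * _
  field_simp
  ring

lemma tail1 (ha : 0 < a) (hb : 0 < b) (hc : 0 < c) (hδ : 0 < δ) (hTn : 0 < Tn) (hδ2 : δ ≤ c * Tn / 2)
    (hB : B = a / (b * c) * δ)
    (hK : ∀ r, 0 < r → 0 < K r ∧ HasDerivAt K (-(κ r * K r)) r ∧ HasDerivAt κ (κ r ^ 2 - 1 - κ r / r) r ∧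
      1 ≤ κ r)
    (J : Tj a m b δ u p v q) (N : NF a b δ Tn Tm c T u v q) {s t : ℝ} (hs : T ≤ s) (hst : s ≤ t) :
    Qf a K κ u p s ≤ Qf a K κ u p t ∧
    Qf a K κ u p t + B * (t * K t * v t) ≤ Qf a K κ u p s + B * (s * K s * v s) := by
  have hs0 : 0 < s := hTn.trans_le (N.Tlo.trans hs)
  have hθ : 0 < 1 / (2 * b) := by positivity
  have hθ2 : 1 / (2 * b) ≤ 1 / b := by gcongr; linarith
  have hB0 : 0 < B := by rw [hB]; positivity
  have hp : ∀ r ∈ Icc s t, 0 < r := fun r hr => hs0.trans_le hr.1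
  have dQ : ∀ r ∈ Icc s t, HasDerivAt (Qf a K κ u p) (r * K r * (cl a (u r) * cl (1 / b) (v r) ^ 2)) r :=
    fun r hr => dQf J (hp r hr) (hK r (hp r hr)).2.1 (hK r (hp r hr)).2.2.1
  have dE : ∀ r ∈ Icc s t, HasDerivAt (fun r => Qf a K κ u p r + B * (r * K r * v r))
      (r * K r * (cl a (u r) * cl (1 / b) (v r) ^ 2) +
        B * ((1 * K r + r * (-(κ r * K r))) * v r + r * K r * (q r / δ))) r :=
    fun r hr => (dQ r hr).add ((((hasDerivAt_id r).mul (hK r (hp r hr)).2.1).mul (J.dv r (hp r hr))).const_mul B)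
  constructor
  · refine mono_of_d (fun r hr => (dQ r hr).continuousAt.continuousWithinAt)
      (fun r hr => dQ r (Ioo_subset_Icc_self hr)) (fun r hr => ?_) (left_mem_Icc.2 hst) (right_mem_Icc.2 hst) hst
    have r0 := hp r (Ioo_subset_Icc_self hr)
    have := (hK r r0).1
    have : 0 ≤ cl a (u r) := le_max_left _ _
    positivity
  · refine anti_of_d (fun r hr => (dE r hr).continuousAt.continuousWithinAt)
      (fun r hr => dE r (Ioo_subset_Icc_self hr)) (fun r hr => ?_) (left_mem_Icc.2 hst) (right_mem_Icc.2 hst) hst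
    have r0 := hp r (Ioo_subset_Icc_self hr)
    have rT : T ≤ r := hs.trans hr.1.le
    obtain ⟨hK0, -, -, hκ⟩ := hK r r0
    obtain ⟨v0, q0, -⟩ := N.Q r rT
    have v1 := N.Q.vle hb hδ hc rT
    rw [cl_eq v0.le (v1.trans hθ2)]
    have c1 : cl a (u r) ≤ a := max_le ha.le (min_le_left _ _)
    have i1 : cl a (u r) * v r ^ 2 ≤ a * (1 / (2 * b) * v r) := by rw [sq]; gcongr
    have i2 : r * (q r / δ) ≤ - (c * v r * r / δ) := by
      rw [← mul_div_assoc, ← neg_div]; gcongr; nlinarith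
    have i3 : K r * v r ≤ r * K r * (c * v r / (2 * δ)) := by
      have : 1 ≤ r * c / (2 * δ) := by
        rw [le_div_iff₀ (by positivity)]
        have : c * Tn ≤ c * r := by have := N.Tlo.trans rT; gcongr
        linarith
      calc K r * v r = K r * v r * 1 := by ring
        _ ≤ K r * v r * (r * c / (2 * δ)) := by gcongr
        _ = _ := by ring
    have i4 : 0 ≤ r * (κ r * K r) * v r := by positivity
    have i5 : B * (r * K r * (c * v r / (2 * δ))) = r * K r * (a * (1 / (2 * b) * v r)) := by
      rw [hB]; field_simp
    have i6 : r * K r * (cl a (u r) * v r ^ 2) ≤ r * K r * (a * (1 / (2 * b) * v r)) := by gcongr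
    have i7 : r * K r * (q r / δ) ≤ -(2 * (r * K r * (c * v r / (2 * δ)))) := by
      calc r * K r * (q r / δ) = K r * (r * (q r / δ)) := by ring
        _ ≤ K r * (- (c * v r * r / δ)) := by gcongr
        _ = _ := by field_simp
    have i8 : B * ((1 * K r + r * (-(κ r * K r))) * v r + r * K r * (q r / δ)) ≤
        B * (-(r * K r * (c * v r / (2 * δ)))) := by
      gcongr; linarith
    linarith

lemma tail2 (hb : 0 < b) (hc : 0 < c) (hδ : 0 < δ) (hTn : 0 < Tn) (hδ2 : δ ≤ c / 2)
    (hB : 0 < B)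
    (hK : ∀ r, 0 < r → 0 < K r ∧ HasDerivAt K (-(κ r * K r)) r ∧ HasDerivAt κ (κ r ^ 2 - 1 - κ r / r) r ∧
      1 ≤ κ r)
    (J : Tj a m b δ u p v q) (N : NF a b δ Tn Tm c T u v q)
    (hQ : ∀ r, T ≤ r → Qf a K κ u p r ≤ 0 ∧ 0 ≤ Qf a K κ u p r + B * (r * K r * v r))
    (hw : 0 < a - u T) {t : ℝ} (hst : T ≤ t) :
    0 < a - u t ∧ a - u t ≤ (a - u T + B * (1 / (2 * b))) * exp (T - t) := by
  have hs0 : 0 < T := hTn.trans_le N.Tlo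
  have hp : ∀ r ∈ Icc T t, 0 < r := fun r hr => hs0.trans_le hr.1
  have key : ∀ r ∈ Icc T t, p r - κ r * (a - u r) ≤ 0 ∧ 0 ≤ p r - κ r * (a - u r) + B * v r := by
    intro r hr
    have r0 := hp r hr
    obtain ⟨h1, h2⟩ := hQ r hr.1
    have hrK : 0 < r * K r := mul_pos r0 (hK r r0).1
    refine ⟨by by_contra h; push Not at h; exact absurd h1 (not_le.2 (mul_pos hrK h)), ?_⟩
    have : 0 ≤ r * K r * (p r - κ r * (a - u r) + B * v r) := by
      refine h2.trans (le_of_eq ?_); rw [Qf]; ring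
    exact nonneg_of_mul_nonneg_right this hrK
  have pos : ∀ r ∈ Icc T t, 0 < a - u r := by
    intro r hr
    have dW : ∀ s ∈ Icc T r, HasDerivAt (fun s => (a - u s) / K s)
        ((-p s * K s - (a - u s) * (-(κ s * K s))) / K s ^ 2) s := fun s hs => by
      have s0 := hs0.trans_le hs.1
      exact ((J.du s s0).const_sub a).div (hK s s0).2.1 (hK s s0).1.ne'
    have := mono_of_d (fun r hr => (dW r hr).continuousAt.continuousWithinAt)
      (fun r hr => dW r (Ioo_subset_Icc_self hr)) (fun s hs => by
        have hs' : s ∈ Icc T t := ⟨hs.1.le, hs.2.le.trans hr.2⟩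
        have k1 := (key s hs').1
        have k2 := (hK s (hp s hs')).1
        apply div_nonneg _ (by positivity)
        nlinarith) (left_mem_Icc.2 hr.1) (right_mem_Icc.2 hr.1) hr.1
    have h1 : 0 < (a - u T) / K T := div_pos hw (hK T hs0).1
    have h2 := h1.trans_le this
    have h3 := (hK r (hp r hr)).1
    exact (div_pos_iff_of_pos_right h3).1 h2
  refine ⟨pos t ⟨hst, le_rfl⟩, ?_⟩
  have dZ : ∀ r ∈ Icc T t, HasDerivAt (fun r => (a - u r + B * v r) * exp r)
      ((-p r + B * (q r / δ)) * exp r + (a - u r + B * v r) * exp r) r := fun r hr =>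
    (((J.du r (hp r hr)).const_sub a).add ((J.dv r (hp r hr)).const_mul B)).mul (Real.hasDerivAt_exp r)
  have hZ := anti_of_d (fun r hr => (dZ r hr).continuousAt.continuousWithinAt)
      (fun r hr => dZ r (Ioo_subset_Icc_self hr)) (fun r hr => by
        have hr' := Ioo_subset_Icc_self hr
        obtain ⟨v0, q0, -⟩ := N.Q r hr'.1
        have k1 := (key r hr').2
        have k2 := pos r hr'
        have k3 := (hK r (hp r hr')).2.2.2
        have k4 : q r / δ ≤ -(2 * v r) := by
          rw [div_le_iff₀ hδ]; nlinarith
        have k5 : B * (q r / δ) ≤ B * (-(2 * v r)) := by gcongr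
        have k6 : (1 : ℝ) * (a - u r) ≤ κ r * (a - u r) := by gcongr
        have k7 : 0 < exp r := exp_pos r
        have : (-p r + B * (q r / δ)) + (a - u r + B * v r) ≤ 0 := by linarith
        nlinarith) (left_mem_Icc.2 hst) (right_mem_Icc.2 hst) hst
  have hv := (N.Q t hst).1
  simp only [N.vT] at hZ
  rw [exp_sub, ← mul_div_assoc, le_div_iff₀ (exp_pos t)]
  refine le_trans ?_ hZ
  gcongr
  have := mul_pos hB hv
  linarith
end


def BL (f : ℝ × ℝ → ℝ) : Prop := ∃ K M, 0 ≤ K ∧ 0 ≤ M ∧ ∀ x, |f x| ≤ M ∧ ∀ y, |f x - f y| ≤ K * dist x y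
lemma BL.mul {f g : ℝ × ℝ → ℝ} (hf : BL f) (hg : BL g) : BL (fun x => f x * g x) := by
  obtain ⟨K, M, hK, hM, h⟩ := hf
  obtain ⟨K', M', hK', hM', h'⟩ := hg
  refine ⟨K * M' + M * K', M * M', by positivity, by positivity, fun x => ⟨?_, fun y => ?_⟩⟩
  · rw [abs_mul]; have := (h x).1; have := (h' x).1; gcongr
  · have e : f x * g x - f y * g y = (f x - f y) * g x + f y * (g x - g y) := by ring
    rw [e]
    refine (abs_add_le _ _).trans ?_
    rw [abs_mul, abs_mul]
    have h1 := (h x).2 y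
    have h2 := (h' x).2 y
    have h3 := (h y).1
    have h4 := (h' x).1
    calc _ ≤ K * dist x y * M' + M * (K' * dist x y) := by gcongr
      _ = _ := by ring
lemma BL.sub {f g : ℝ × ℝ → ℝ} (hf : BL f) (hg : BL g) : BL (fun x => f x - g x) := by
  obtain ⟨K, M, hK, hM, h⟩ := hf
  obtain ⟨K', M', hK', hM', h'⟩ := hg
  refine ⟨K + K', M + M', by positivity, by positivity, fun x => ⟨?_, fun y => ?_⟩⟩
  · have := (h x).1; have := (h' x).1
    exact (abs_sub _ _).trans (by linarith)
  · have e : f x - g x - (f y - g y) = (f x - f y) - (g x - g y) := by ring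
    rw [e]
    refine (abs_sub _ _).trans ?_
    have h1 := (h x).2 y
    have h2 := (h' x).2 y
    linarith
lemma BL.const (c : ℝ) : BL (fun _ => c) := ⟨0, |c|, le_rfl, abs_nonneg _, fun x => ⟨le_rfl, fun y => by simp⟩⟩
lemma cl_lip (M x y : ℝ) : |cl M x - cl M y| ≤ |x - y| := by
  have := ((LipschitzWith.id (α := ℝ)).const_min M).const_max 0 |>.dist_le_mul x y
  simpa [Real.dist_eq, cl] using this
lemma BL.cl1 {M : ℝ} (hM : 0 ≤ M) : BL (fun x => cl M x.1) :=
  ⟨1, M, zero_le_one, hM, fun x => ⟨by rw [abs_of_nonneg (cl_bd hM).1]; exact (cl_bd hM).2, fun y =>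
    (cl_lip _ _ _).trans (by rw [one_mul, Prod.dist_eq]; exact le_max_left _ _)⟩⟩
lemma BL.cl2 {M : ℝ} (hM : 0 ≤ M) : BL (fun x => cl M x.2) :=
  ⟨1, M, zero_le_one, hM, fun x => ⟨by rw [abs_of_nonneg (cl_bd hM).1]; exact (cl_bd hM).2, fun y =>
    (cl_lip _ _ _).trans (by rw [one_mul, Prod.dist_eq]; exact le_max_right _ _)⟩⟩
lemma BL.lip {f : ℝ × ℝ → ℝ} (hf : BL f) : ∃ K, LipschitzWith K f := by
  obtain ⟨K, M, hK, hM, h⟩ := hf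
  exact ⟨⟨K, hK⟩, LipschitzWith.of_dist_le_mul fun x y => (h x).2 y⟩

lemma flow_tj {a m b δ : ℝ} (ha : 0 < a) (hb : 0 < b) (hδ : 0 < δ) : ∃ u p v q : ℝ × ℝ → ℝ → ℝ,
    (∀ x, u x 0 = x.1 ∧ v x 0 = x.2 ∧ Tj a m b δ (u x) (p x) (v x) (q x)) ∧
    Continuous (fun z : (ℝ × ℝ) × ℝ => u z.1 z.2) ∧ Continuous (fun z : (ℝ × ℝ) × ℝ => p z.1 z.2) ∧
    Continuous (fun z : (ℝ × ℝ) × ℝ => v z.1 z.2) ∧ Continuous (fun z : (ℝ × ℝ) × ℝ => q z.1 z.2) := by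
  have hb' : 0 ≤ 1 / b := by positivity
  obtain ⟨K1, h1⟩ := ((BL.cl1 ha.le).mul ((BL.cl2 hb').mul (BL.cl2 hb'))).lip
  obtain ⟨K2, h2⟩ := ((BL.const (1 / δ ^ 2)).mul (((BL.const m).mul (BL.cl2 hb')).sub
    (((BL.cl1 ha.le).mul ((BL.cl2 hb').mul (BL.cl2 hb'))).mul ((BL.const 1).sub
    ((BL.const b).mul (BL.cl2 hb')))))).lip
  have h3 : LipschitzWith (1 + K1) (fun x : ℝ × ℝ => (x.1 - a) + cl a x.1 * (cl (1 / b) x.2 * cl (1 / b) x.2)) :=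
    LipschitzWith.add (LipschitzWith.of_dist_le_mul fun x y => by
      simpa [Real.dist_eq] using LipschitzWith.prod_fst.dist_le_mul x y) h1
  obtain ⟨Y, P, Y0, P0, Yc, Pc, dY, dP⟩ := flow_exists _ (h3.prodMk h2)
  have ev : ∀ x : ℝ × ℝ, Continuous (fun r : ℝ => (x, r)) := fun x => by fun_prop
  have Y1 : ∀ x, Continuous (Y x) := fun x => Yc.comp (ev x)
  have P1 : ∀ x, Continuous (P x) := fun x => Pc.comp (ev x)
  refine ⟨fun x r => (Y x r).1, fun x r => (P x r).1, fun x r => (Y x r).2, fun x r => δ * (P x r).2,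
    fun x => ⟨by simp [Y0], by simp [Y0], ?_⟩, by fun_prop, by fun_prop, by fun_prop, by fun_prop⟩
  refine ⟨by simp [P0], by simp [P0], continuous_fst.comp (Y1 x), continuous_fst.comp (P1 x),
    continuous_snd.comp (Y1 x), continuous_const.mul (continuous_snd.comp (P1 x)), fun r hr => ?_,
    fun r hr => ?_, fun r hr => ?_, fun r hr => ?_⟩
  · exact hasFDerivAt_fst.comp_hasDerivAt r (dY x r hr)
  · convert! hasFDerivAt_fst.comp_hasDerivAt r (dP x r hr) using 1
    simp; ring
  · convert! hasFDerivAt_snd.comp_hasDerivAt r (dY x r hr) using 1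
    simp; field_simp
  · convert! (hasFDerivAt_snd.comp_hasDerivAt r (dP x r hr)).const_mul δ using 1
    simp; field_simp

lemma open_all {O : Set ((ℝ × ℝ) × ℝ)} (hO : IsOpen O) (s t : ℝ) :
    IsOpen {x : ℝ × ℝ | ∀ r ∈ Icc s t, (x, r) ∈ O} := by
  rw [isOpen_iff_eventually]
  intro x hx
  exact isCompact_Icc.eventually_forall_of_forall_eventually (P := fun x r => (x, r) ∈ O)
    (fun r hr => hO.eventually_mem (hx r hr))

section
variable {m b w uh : ℝ} {u v q : ℝ × ℝ → ℝ → ℝ} (hu : Continuous (fun z : (ℝ × ℝ) × ℝ => u z.1 z.2))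
  (hv : Continuous (fun z : (ℝ × ℝ) × ℝ => v z.1 z.2)) (hq : Continuous (fun z : (ℝ × ℝ) × ℝ => q z.1 z.2))

lemma Lq_cont (hv : Continuous (fun z : (ℝ × ℝ) × ℝ => v z.1 z.2))
    (hq : Continuous (fun z : (ℝ × ℝ) × ℝ => q z.1 z.2)) :
    Continuous (fun z : (ℝ × ℝ) × ℝ => Lf m b w (v z.1 z.2) - q z.1 z.2 ^ 2 / 2) := by
  unfold Lf; fun_prop

lemma at_cont {f : ℝ × ℝ → ℝ → ℝ} (hf : Continuous (fun z : (ℝ × ℝ) × ℝ => f z.1 z.2)) (r : ℝ) :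
    Continuous (fun x => f x r) := hf.comp (by fun_prop : Continuous (fun x : ℝ × ℝ => (x, r)))

lemma SA_open (hu : Continuous (fun z : (ℝ × ℝ) × ℝ => u z.1 z.2))
    (hv : Continuous (fun z : (ℝ × ℝ) × ℝ => v z.1 z.2)) (hq : Continuous (fun z : (ℝ × ℝ) × ℝ => q z.1 z.2)) :
    IsOpen {x | SA m b w uh (u x) (v x) (q x)} := by
  simp only [SA, setOf_exists]
  refine isOpen_iUnion fun r => ?_
  simp only [setOf_and]
  refine isOpen_const.inter ((isOpen_lt (at_cont hv r) continuous_const).inter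
    ((isOpen_lt continuous_const ((Lq_cont hv hq).comp (by fun_prop : Continuous (fun x : ℝ × ℝ => (x, r))))).inter
    ((open_all (isOpen_lt continuous_const hv) 0 r).inter
      (open_all (O := {z | v z.1 z.2 < 1 / (2 * b) ∨ (u z.1 z.2 < uh ∧ v z.1 z.2 < 1 / b)}) ?_ 0 r))))
  exact (isOpen_lt hv continuous_const).union ((isOpen_lt hu continuous_const).inter
    (isOpen_lt hv continuous_const))

lemma SB1_open (hu : Continuous (fun z : (ℝ × ℝ) × ℝ => u z.1 z.2))
    (hv : Continuous (fun z : (ℝ × ℝ) × ℝ => v z.1 z.2)) :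
    IsOpen {x | SB1 b uh (u x) (v x)} := by
  simp only [SB1, setOf_exists]
  refine isOpen_iUnion fun r => ?_
  simp only [setOf_and]
  exact isOpen_const.inter ((open_all (isOpen_lt continuous_const hv) 0 r).inter
    ((isOpen_lt continuous_const (at_cont hu r)).union (isOpen_lt continuous_const (at_cont hv r))))

lemma SB2_open (hv : Continuous (fun z : (ℝ × ℝ) × ℝ => v z.1 z.2))
    (hq : Continuous (fun z : (ℝ × ℝ) × ℝ => q z.1 z.2)) :
    IsOpen {x | SB2 m b w (v x) (q x)} := by
  simp only [SB2, setOf_exists]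
  refine isOpen_iUnion fun r => ?_
  simp only [setOf_and]
  refine isOpen_const.inter ((isOpen_lt (at_cont hv r) continuous_const).inter
      (open_all (O := {z | v z.1 z.2 < 0 ∨ 1 / (2 * b) < v z.1 z.2 ∨
        Lf m b w (v z.1 z.2) - q z.1 z.2 ^ 2 / 2 < 0}) ?_ 0 r))
  exact (isOpen_lt hv continuous_const).union ((isOpen_lt continuous_const hv).union
    (isOpen_lt (Lq_cont hv hq) continuous_const))
end


section
variable {a m b U cV CV L : ℝ} {V V1 V2 h : ℝ → ℝ} {X P : ℝ → ℝ → ℝ}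

set_option maxHeartbeats 2000000 in
lemma matching (H : Par a m b U cV CV L V V1 V2 h X P) : ∃ αI RI C δ0 Tn c : ℝ, U < αI ∧ αI < 9 * b * m / 2 ∧
    0 < RI ∧ 0 < C ∧ 0 < δ0 ∧ 0 < Tn ∧ 0 < c ∧ ∀ δ, 0 < δ → δ < δ0 → ∃ u p v q : ℝ → ℝ, ∃ Tm T : ℝ,
      Tj a m b δ u p v q ∧ NF a b δ Tn Tm c T u v q ∧ U ≤ u 0 ∧ |u 0 - αI| ≤ C * δ ∧
      |v 0 - V (u 0)| ≤ C * δ ∧ |T - RI| ≤ C * δ ∧ ∀ t, T ≤ t → 0 < a - u t ∧ a - u t ≤ a * exp (T - t) := by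
  have ha := H.a0
  have hb := H.b0
  have hm := H.m0
  have hU := H.U0
  have husa := H.usa
  obtain ⟨K, κ, hKκ⟩ := exists_K
  have hκ : ∀ r, 0 < r → HasDerivAt κ (κ r ^ 2 - 1 - κ r / r) r ∧ 1 ≤ κ r ∧
      κ r ^ 2 - 1 - κ r / r ≤ 0 := fun r hr => (hKκ r hr).2.2
  have hK : ∀ r, 0 < r → 0 < K r ∧ HasDerivAt K (-(κ r * K r)) r ∧ HasDerivAt κ (κ r ^ 2 - 1 - κ r / r) r ∧
      1 ≤ κ r := fun r hr => ⟨(hKκ r hr).1, (hKκ r hr).2.1, (hKκ r hr).2.2.1, (hKκ r hr).2.2.2.1⟩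
  obtain ⟨αI, c0, cD, LR, Rm, RM, R, hc0, hcD, hLR, hRm, hl, hh, hR⟩ := H.rf.main H.Uus H.usa hκ H.hE
  obtain ⟨w, uh, Tn, Tm, c, C, d1, hw, huh, huha, hTn, hTm, hc, hC, hd1, nf⟩ := nfacts H hl hh hκ
  have hθ : 0 < 1 / (2 * b) := by positivity
  have hθ2 : 1 / (2 * b) < 1 / b := by gcongr; linarith
  obtain ⟨B0, hB0⟩ : ∃ B, B = a / (b * c) := ⟨_, rfl⟩
  have hB00 : 0 < B0 := by rw [hB0]; positivity
  obtain ⟨K2, hK2⟩ : ∃ K, K = (C + B0 * (1 / (2 * b)) + 1) / cD := ⟨_, rfl⟩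
  have hK20 : 0 < K2 := by rw [hK2]; positivity
  have hK2' : cD * K2 = C + B0 * (1 / (2 * b)) + 1 := by rw [hK2]; field_simp
  have hRI := hR αI ⟨by linarith, by linarith⟩
  have hus : 0 < 9 * b * m / 2 := by positivity
  have hau : 0 < a - 9 * b * m / 2 := by linarith
  refine ⟨αI, R αI, K2 + C + LR * K2, min (min d1 (min (c0 / K2) (c * Tn / 2)))
    (min (c / 2) (min ((a - 9 * b * m / 2) / C) (9 * b * m / 2 / (C + B0 * (1 / (2 * b)))))), Tn, c, by linarith,
    by linarith, by linarith [hRI.1], by positivity, by positivity, hTn, hc, ?_⟩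
  intro δ hδ hδ0
  simp only [lt_min_iff] at hδ0
  obtain ⟨⟨e1, e2, e3⟩, e4, e5, e6⟩ := hδ0
  rw [lt_div_iff₀ hK20] at e2
  rw [lt_div_iff₀ hC] at e5
  rw [lt_div_iff₀ (by positivity)] at e6
  obtain ⟨B, hB⟩ : ∃ B, B = a / (b * c) * δ := ⟨_, rfl⟩
  have hBB : B = B0 * δ := by rw [hB, hB0]
  have hBp : 0 < B := by rw [hBB]; positivity
  have hK2δ : 0 < K2 * δ := by positivity
  obtain ⟨u, p, v, q, J, uc, pc, vc, qc⟩ := flow_tj (m := m) ha hb hδ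
  obtain ⟨S, hS⟩ : ∃ S : Set (ℝ × ℝ), S = {x | SA m b w uh (u x) (v x) (q x)}ᶜ ∩
    ({x | SB1 b uh (u x) (v x)} ∪ {x | SB2 m b w (v x) (q x)})ᶜ := ⟨_, rfl⟩
  have oA : IsOpen {x | SA m b w uh (u x) (v x) (q x)} := SA_open uc vc qc
  have oB : IsOpen ({x | SB1 b uh (u x) (v x)} ∪ {x | SB2 m b w (v x) (q x)}) :=
    (SB1_open uc vc).union (SB2_open vc qc)
  have Scl : IsClosed S := by rw [hS]; exact oA.isClosed_compl.inter oB.isClosed_compl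
  obtain ⟨Rc, hRc⟩ : ∃ S : Set (ℝ × ℝ), S = Icc (αI - K2 * δ) (αI + K2 * δ) ×ˢ Icc (1 / (2 * b)) (1 / b) := ⟨_, rfl⟩
  have Rcc : IsCompact (Rc ∩ S) := by
    rw [hRc]; exact (isCompact_Icc.prod isCompact_Icc).inter_right Scl
  have hα : ∀ x ∈ Rc, x.1 ∈ Icc (αI - c0) (αI + c0) := fun x hx => by
    rw [hRc] at hx; have := hx.1; exact ⟨by linarith [this.1], by linarith [this.2]⟩
  have NN : ∀ x ∈ Rc ∩ S, ∃ T, NF a b δ Tn Tm c T (u x) (v x) (q x) ∧ |u x T - 9 * b * m / 2| ≤ C * δ ∧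
      |v x 0 - V (u x 0)| ≤ C * δ ∧ |T - R x.1| ≤ C * δ ∧ |(p x T - (a - u x T) * κ T) -
        (P x.1 (R x.1) - (a - 9 * b * m / 2) * κ (R x.1))| ≤ C * δ := by
    rintro x ⟨hx, hxS⟩
    obtain ⟨j1, j2, j3⟩ := J x
    rw [hS] at hxS
    have h1 := hα x hx
    have h2 := hR _ h1
    obtain ⟨T, f1, f2, f3, f4, f5⟩ := nf hδ e1 j3 (by rw [j1]; exact h1) (by rw [j2]; rw [hRc] at hx; exact hx.2) hxS.1
      (fun h => hxS.2 (Or.inl h)) (fun h => hxS.2 (Or.inr h)) (R := R x.1) (hRm.trans_le h2.1) (by rw [j1]; exact h2.2.2.1)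
    rw [j1] at f5
    exact ⟨T, f1, f2, f3, f4, f5⟩
  have Qc : ∀ r, Continuous (fun x => Qf a K κ (u x) (p x) r) := fun r => by
    have := at_cont uc r
    have := at_cont pc r
    unfold Qf; fun_prop
  have T1 : ∀ x T, NF a b δ Tn Tm c T (u x) (v x) (q x) → ∀ {s t}, T ≤ s → s ≤ t → _ := fun x T N s t h1 h2 =>
    tail1 ha hb hc hδ hTn e3.le hB hK (J x).2.2 N h1 h2
  have hZ : ∀ n, Tm ≤ n → ∃ x ∈ Rc ∩ S, Qf a K κ (u x) (p x) n = 0 := by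
    intro n hn
    have hmem : ∀ x : ℝ × ℝ, x.1 ∈ Icc (αI - K2 * δ) (αI + K2 * δ) → x.2 ∈ Icc (1 / (2 * b)) (1 / b) →
        x ∉ {x | SA m b w uh (u x) (v x) (q x)} →
        x ∉ ({x | SB1 b uh (u x) (v x)} ∪ {x | SB2 m b w (v x) (q x)}) → x ∈ Rc ∩ S := fun x h1 h2 h3 h4 => by
      rw [hRc, hS]; exact ⟨⟨h1, h2⟩, h3, h4⟩
    obtain ⟨x, x1, x2, x3, x4, x5⟩ := topo_lemma (x0 := αI - K2 * δ) (x1 := αI + K2 * δ) (by linarith) hθ2 _ _ oA oB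
      (by
        rw [Set.disjoint_left]
        rintro x hA (hB | hB)
        · exact SA_SB1 hA hB
        · exact SA_SB2 hA hB)
      (fun x => -Qf a K κ (u x) (p x) n) (Qc n).neg
      (fun y hy => by
        obtain ⟨j1, j2, j3⟩ := J (y, 1 / (2 * b))
        exact bottom_SA H hw hδ j3 (by rw [j1]; linarith [hy.1]) (by rw [j1]; linarith [hy.2]) huha.le j2)
      (fun y hy => by
        obtain ⟨j1, j2, j3⟩ := J (y, 1 / b)
        refine Or.inl (top_SB1 hm hb hδ j3 le_rfl j3.q0 (fun r hr => ?_) j2)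
        rw [le_antisymm hr.2 hr.1, j2]; exact hθ2)
      (fun y hy hA hB => by
        obtain ⟨T, N, f2, f3, f4, f5⟩ := NN _ (hmem (αI - K2 * δ, y) ⟨le_rfl, by linarith⟩ hy hA hB)
        have g := (hR (αI - K2 * δ) ⟨by linarith, by linarith⟩).2.2.2.2.1 (by linarith)
        have t1 := (T1 _ T N le_rfl (N.Thi.trans hn)).1
        have T0 : 0 < T := hTn.trans_le N.Tlo
        have g2 := (abs_le.1 f5).1
        have g3 : C * δ < cD * (αI - (αI - K2 * δ)) := by
          rw [sub_sub_cancel, ← mul_assoc, hK2']; gcongr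
          have : 0 < B0 * (1 / (2 * b)) := by positivity
          linarith
        have : 0 < Qf a K κ (u (αI - K2 * δ, y)) (p (αI - K2 * δ, y)) T :=
          mul_pos (mul_pos T0 (hK T T0).1) (by dsimp only at g2; linarith)
        linarith)
      (fun y hy hA hB => by
        obtain ⟨T, N, f2, f3, f4, f5⟩ := NN _ (hmem (αI + K2 * δ, y) ⟨by linarith, le_rfl⟩ hy hA hB)
        have g := (hR (αI + K2 * δ) ⟨by linarith, by linarith⟩).2.2.2.2.2 (by linarith)
        have hTn' := N.Thi.trans hn
        have t1 := (T1 _ T N le_rfl hTn').2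
        have T0 : 0 < T := hTn.trans_le N.Tlo
        have g2 := (abs_le.1 f5).2
        have g3 : cD * (αI + K2 * δ - αI) = C * δ + B * (1 / (2 * b)) + δ := by
          rw [add_sub_cancel_left, ← mul_assoc, hK2', hBB]; ring
        have hv := (N.Q n hTn').1
        rw [N.vT] at t1
        have n0 := T0.trans_le hTn'
        have s1 : 0 < B * (n * K n * v (αI + K2 * δ, y) n) := mul_pos hBp (mul_pos (mul_pos n0 (hK n n0).1) hv)
        have : 0 < T * K T * -(p (αI + K2 * δ, y) T - κ T * (a - u (αI + K2 * δ, y) T) + B * (1 / (2 * b))) :=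
          mul_pos (mul_pos T0 (hK T T0).1) (by dsimp only at g2; linarith)
        have e : Qf a K κ (u (αI + K2 * δ, y)) (p (αI + K2 * δ, y)) T + B * (T * K T * (1 / (2 * b))) =
          -(T * K T * -(p (αI + K2 * δ, y) T - κ T * (a - u (αI + K2 * δ, y) T) + B * (1 / (2 * b)))) := by
          rw [Qf]; ring
        linarith)
    exact ⟨x, hmem x x1 x2 x3 x4, by linarith⟩
  choose! X' hX1 hX2 using hZ
  obtain ⟨x, hx, φ, hφ, hlim⟩ := Rcc.tendsto_subseq (x := fun k : ℕ => X' (Tm + k)) (fun k => hX1 _ (by simp))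
  have hQ1 : ∀ r, Tm ≤ r → Qf a K κ (u x) (p x) r ≤ 0 ∧ 0 ≤ Qf a K κ (u x) (p x) r + B * (r * K r * v x r) := by
    intro r hr
    have ev : ∀ᶠ k : ℕ in atTop, r ≤ Tm + φ k := by
      have : Tendsto (fun k : ℕ => (φ k : ℝ)) atTop atTop := tendsto_natCast_atTop_atTop.comp hφ.tendsto_atTop
      filter_upwards [this.eventually_ge_atTop (r - Tm)] with k hk
      linarith
    have ev2 : ∀ᶠ k : ℕ in atTop, Qf a K κ (u (X' (Tm + φ k))) (p (X' (Tm + φ k))) r ≤ 0 ∧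
        0 ≤ Qf a K κ (u (X' (Tm + φ k))) (p (X' (Tm + φ k))) r + B * (r * K r * v (X' (Tm + φ k)) r) := by
      filter_upwards [ev] with k hk
      have hk' := hr.trans hk
      obtain ⟨T, N, -⟩ := NN _ (hX1 _ hk')
      obtain ⟨t1, t2⟩ := T1 _ T N (N.Thi.trans hr) hk
      rw [hX2 _ hk'] at t1 t2
      have n0 := hTm.trans_le hk'
      have s1 := mul_pos hBp (mul_pos (mul_pos n0 (hK _ n0).1) (N.Q _ (N.Thi.trans hk')).1)
      exact ⟨t1, by linarith⟩
    constructor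
    · exact le_of_tendsto (((Qc r).tendsto x).comp hlim) (ev2.mono fun k hk => hk.1)
    · have : Continuous (fun x => Qf a K κ (u x) (p x) r + B * (r * K r * v x r)) :=
        (Qc r).add (continuous_const.mul (continuous_const.mul (at_cont vc r)))
      exact ge_of_tendsto ((this.tendsto x).comp hlim) (ev2.mono fun k hk => hk.2)
  obtain ⟨T, N, f2, f3, f4, -⟩ := NN x hx
  have hQ : ∀ r, T ≤ r → Qf a K κ (u x) (p x) r ≤ 0 ∧ 0 ≤ Qf a K κ (u x) (p x) r + B * (r * K r * v x r) := by
    intro r hr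
    rcases le_total Tm r with h | h
    · exact hQ1 r h
    · obtain ⟨t1, t2⟩ := T1 _ T N hr h
      obtain ⟨t3, t4⟩ := hQ1 Tm le_rfl
      exact ⟨t1.trans t3, t4.trans t2⟩
  obtain ⟨j1, j2, j3⟩ := J x
  have f2' := abs_le.1 f2
  have hxα : |x.1 - αI| ≤ K2 * δ := by
    have := hx.1; rw [hRc] at this
    rw [abs_le]; exact ⟨by linarith [this.1.1], by linarith [this.1.2]⟩
  have hxr := hR _ (hα x hx.1)
  refine ⟨u x, p x, v x, q x, Tm, T, j3, N, by rw [j1]; linarith [(hα x hx.1).1], ?_, ?_, ?_, fun t ht => ?_⟩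
  · rw [j1]; refine hxα.trans ?_
    have : 0 ≤ (C + LR * K2) * δ := by positivity
    linarith
  · refine f3.trans ?_
    have : 0 ≤ (K2 + LR * K2) * δ := by positivity
    linarith
  · have r1 := hxr.2.2.2.1
    have r2 : LR * |x.1 - αI| ≤ LR * (K2 * δ) := by gcongr
    have := abs_sub_le T (R x.1) (R αI)
    linarith
  · obtain ⟨g1, g2⟩ := tail2 hb hc hδ hTn e4.le hBp hK j3 N hQ (by linarith) ht
    refine ⟨g1, g2.trans ?_⟩
    gcongr
    rw [hBB]; linarith
end


lemma c2 {f f1 f2 : ℝ → ℝ} (h1 : ∀ r, 0 < r → HasDerivAt f (f1 r) r) (h2 : ∀ r, 0 < r → HasDerivAt f1 (f2 r) r)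
    (hc : ContinuousOn f2 (Ioi 0)) : ContDiffOn ℝ 2 f (Ioi 0) ∧ ∀ r, 0 < r → deriv f r = f1 r ∧
      deriv (deriv f) r = f2 r := by
  have e1 : ∀ r ∈ Ioi (0 : ℝ), deriv f r = f1 r := fun r hr => (h1 r hr).deriv
  have e2 : ∀ r ∈ Ioi (0 : ℝ), deriv f1 r = f2 r := fun r hr => (h2 r hr).deriv
  refine ⟨?_, fun r hr => ⟨e1 r hr, ?_⟩⟩
  · rw [show (2 : WithTop ℕ∞) = 1 + 1 by norm_num, contDiffOn_succ_iff_deriv_of_isOpen isOpen_Ioi]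
    refine ⟨fun r hr => (h1 r hr).differentiableAt.differentiableWithinAt, by simp, ?_⟩
    refine ContDiffOn.congr ?_ e1
    rw [show (1 : WithTop ℕ∞) = 0 + 1 by norm_num, contDiffOn_succ_iff_deriv_of_isOpen isOpen_Ioi]
    refine ⟨fun r hr => (h2 r hr).differentiableAt.differentiableWithinAt, by simp, ?_⟩
    rw [contDiffOn_zero]
    exact hc.congr e2
  · rw [← e2 r hr]
    exact Filter.EventuallyEq.deriv_eq (Filter.eventually_of_mem (isOpen_Ioi.mem_nhds hr) e1)

/-- Existence of radially symmetric vegetation spot solutions with a single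
interface at radius `r_I + O(δ)` (Theorem 1.2 of the paper). -/
theorem spot_existence
    (a m b : ℝ) (ha : 0 < a) (hm : 0 < m) (hb : 0 < b)
    (hparam₁ : max (9*b/2) (4*b + 1/b) < a/m) (hparam₂ : a/m < 9*b/2 + 2/b)
    (V₂ : ℝ) (hV₂ : V₂ = (a/m + Real.sqrt ((a/m)^2 - 4*(1 + a*b/m))) / (2*(1 + a*b/m)))
    (U₂ : ℝ) (hU₂ : U₂ = m * (a/m - V₂ / (1 - b*V₂)))
    (hcond : (1/2) * (a - U₂)^2
        < ∫ s in U₂..(9*b*m/2), (s - 2*m*b + Real.sqrt (s^2 - 4*s*m*b)) / (2*b^2)) :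
    ∃ Vc > (0:ℝ), ∃ rI > (0:ℝ), ∃ δ₀ > (0:ℝ), ∃ C > (0:ℝ),
      ∀ δ ∈ Set.Ioo (0:ℝ) δ₀,
        ∃ u v : ℝ → ℝ,
          -- boundedness
          (∃ M : ℝ, ∀ r ∈ Set.Ioi (0:ℝ), |u r| ≤ M ∧ |v r| ≤ M) ∧
          -- twice continuous differentiability
          ContDiffOn ℝ 2 u (Set.Ioi 0) ∧ ContDiffOn ℝ 2 v (Set.Ioi 0) ∧
          -- the stationary radially symmetric equations
          (∀ r ∈ Set.Ioi (0:ℝ),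
            deriv (deriv u) r + deriv u r / r + a - u r - u r * (v r)^2 = 0 ∧
            δ^2 * (deriv (deriv v) r + deriv v r / r) - m * v r
              + u r * (v r)^2 * (1 - b * v r) = 0) ∧
          -- far-field behavior: (u,v) → (a,0) as r → ∞
          Filter.Tendsto u Filter.atTop (nhds a) ∧
          Filter.Tendsto v Filter.atTop (nhds 0) ∧
          -- core behavior: v(0⁺) exists and is O(δ)-close to Vc
          (∃ v0 : ℝ, Filter.Tendsto v (nhdsWithin 0 (Set.Ioi 0)) (nhds v0) ∧
            |v0 - Vc| ≤ C * δ) ∧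
          -- single interface at radius rI + O(δ)
          (∃ rδ : ℝ, |rδ - rI| ≤ C * δ ∧ v rδ = 1/(3*b)) := by
  obtain ⟨cV, CV, L, V, V1, V2, h, X, P, H⟩ := par_exists a m b ha hm hb hparam₁ hparam₂ V₂ hV₂ U₂ hU₂ hcond
  obtain ⟨αI, RI, C, δ0, Tn, c, h1, h2, hRI, hC, hδ0, hTn, hc, main⟩ := matching H
  have hCV := H.CV0
  have hθ : 0 < 1 / (2 * b) := by positivity
  have hθ2 : 1 / (2 * b) ≤ 1 / b := by gcongr; linarith
  refine ⟨V αI, by linarith [H.Vlo αI h1.le, H.cV0], RI, hRI, δ0, hδ0, C + CV * C + 1 / c, by positivity, ?_⟩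
  rintro δ ⟨hδ, hδ1⟩
  obtain ⟨u, p, v, q, Tm, T, J, N, g1, g2, g3, g4, g5⟩ := main δ hδ hδ1
  have hT : 0 < T := hTn.trans_le N.Tlo
  have box : ∀ r, 0 ≤ r → 0 ≤ u r ∧ u r ≤ a ∧ 0 ≤ v r ∧ v r ≤ 1 / b := by
    intro r hr
    rcases le_total r T with hrT | hrT
    · exact N.box r ⟨hr, hrT⟩
    · obtain ⟨k1, k2⟩ := g5 r hrT
      have k3 : exp (T - r) ≤ 1 := exp_le_one_iff.2 (by linarith)
      have k4 : a * exp (T - r) ≤ a * 1 := by gcongr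
      exact ⟨by linarith, by linarith, (N.Q r hrT).1.le, (N.Q.vle hb hδ hc hrT).trans hθ2⟩
  have uc := J.uc
  have pc := J.pc
  have vc := J.vc
  have qc := J.qc
  have dp : ∀ r, 0 < r → HasDerivAt p (u r - a + u r * v r ^ 2 - p r / r) r := fun r hr => by
    obtain ⟨k1, k2, k3, k4⟩ := box r hr.le
    have := J.dp r hr
    rwa [cl_eq k1 k2, cl_eq k3 k4] at this
  have dq : ∀ r, 0 < r → HasDerivAt (fun r => q r / δ)
      (((m * v r - u r * v r ^ 2 * (1 - b * v r)) / δ - q r / r) / δ) r := fun r hr => by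
    obtain ⟨k1, k2, k3, k4⟩ := box r hr.le
    have := J.dq r hr
    rw [cl_eq k1 k2, cl_eq k3 k4] at this
    exact this.div_const δ
  have hne : ∀ r ∈ Ioi (0 : ℝ), r ≠ 0 := fun r hr => ne_of_gt hr
  obtain ⟨u1, u2⟩ := c2 J.du dp (by fun_prop (disch := assumption))
  obtain ⟨v1, v2⟩ := c2 J.dv dq (by fun_prop (disch := assumption))
  have lim0 : ∀ A k : ℝ, 0 < k → Tendsto (fun r => A * exp (-(k * (r - T)))) atTop (nhds 0) := fun A k hk => by
    have t1 : Tendsto (fun r : ℝ => k * (r - T)) atTop atTop :=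
      (tendsto_atTop_add_const_right atTop (-T) tendsto_id).const_mul_atTop hk
    have := (tendsto_exp_neg_atTop_nhds_zero.comp t1).const_mul A
    rw [mul_zero] at this; exact this
  have evT : ∀ᶠ r in atTop, T ≤ r := eventually_ge_atTop T
  refine ⟨u, v, ⟨a + 1 / b, fun r hr => ?_⟩, u1, v1, fun r hr => ⟨?_, ?_⟩, ?_, ?_, ⟨v 0, ?_, ?_⟩, ?_⟩
  · obtain ⟨k1, k2, k3, k4⟩ := box r (le_of_lt hr)
    rw [abs_of_nonneg k1, abs_of_nonneg k3]
    exact ⟨by linarith, by linarith⟩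
  · rw [(u2 r hr).1, (u2 r hr).2]; ring
  · rw [(v2 r hr).1, (v2 r hr).2]
    have := hne r hr
    field_simp
    ring
  · have : Tendsto (fun r => a - u r) atTop (nhds 0) := by
      refine squeeze_zero' (evT.mono fun r hr => (g5 r hr).1.le) (evT.mono fun r hr => (g5 r hr).2.trans (le_of_eq ?_))
        (lim0 a 1 one_pos)
      congr 2; ring
    have := this.const_sub a
    simpa using this
  · refine squeeze_zero' (evT.mono fun r hr => (N.Q r hr).1.le) (evT.mono fun r hr => (N.Q r hr).2.2.trans (le_of_eq ?_))
      (lim0 (1 / (2 * b)) (c / δ) (by positivity))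
    congr 2; ring
  · exact vc.continuousAt.tendsto.mono_left nhdsWithin_le_nhds
  · have l := lipd (s := αI) (t := u 0) (f := V) (C := CV) (fun r hr => by
      have : U₂ ≤ r := (le_min h1.le g1).trans hr.1
      exact ⟨H.dV r this, H.V1b r this⟩)
    have l2 : CV * |u 0 - αI| ≤ CV * (C * δ) := by gcongr
    have := abs_sub_le (v 0) (V (u 0)) (V αI)
    have : 0 ≤ 1 / c * δ := by positivity
    linarith
  · have hσ : 0 < δ / c := by positivity
    have hv := (N.Q (T + δ / c) (by linarith)).2.2
    have e : -(c * (T + δ / c - T) / δ) = -1 := by field_simp; ring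
    have e1 : exp (-1) ≤ 1 / 2 := by
      rw [exp_neg, one_div]
      gcongr
      linarith [add_one_le_exp 1]
    rw [e] at hv
    have hv2 : v (T + δ / c) ≤ 1 / (3 * b) := by
      calc v (T + δ / c) ≤ 1 / (2 * b) * (1 / 2) := hv.trans (by gcongr)
        _ = 1 / (4 * b) := by field_simp; norm_num
        _ ≤ 1 / (3 * b) := by gcongr; norm_num
    obtain ⟨r, hr, hr2⟩ := intermediate_value_Icc' (a := T) (b := T + δ / c) (by linarith) vc.continuousOn
      (show 1 / (3 * b) ∈ Icc _ _ from ⟨hv2, by rw [N.vT]; gcongr; norm_num⟩)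
    refine ⟨r, ?_, hr2⟩
    have l1 : |r - T| ≤ 1 / c * δ := by
      rw [abs_of_nonneg (by linarith [hr.1])]
      have := hr.2
      have : 1 / c * δ = δ / c := by ring
      linarith
    have := abs_sub_le r T RI
    have : 0 ≤ CV * C * δ := by positivity
    linarith
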